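/- arXiv:1504.04195 — 2 statements merged into one kernel-verified Lean document; each statement's English description precedes it below -/
import Mathlib

section
/- Let G be a connected claw-free graph on n ≥ 6 vertices. If e(G) ≥ n(n−9)/2 + 21, then G is traceable, unless G is isomorphic to a spanning subgraph of EN_n. -/
open SimpleGraph

/-- A graph is claw-free if it contains no induced `K_{1,3}`. -/
def ClawFree {V : Type*} (G : SimpleGraph V) : Prop :=
  ¬ ∃ v a b c : V, a ≠ b ∧ a ≠ c ∧ b ≠ c ∧
    G.Adj v a ∧ G.Adj v b ∧ G.Adj v c ∧ ¬ G.Adj a b ∧ ¬ G.Adj a c ∧ ¬ G.Adj b c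

/-- A graph is traceable if it has a Hamilton path. -/
def Traceable {V : Type*} (G : SimpleGraph V) : Prop := by
  classical
  exact ∃ (u v : V) (p : G.Walk u v), p.IsHamiltonian

/-- A graph is 2-connected if it has at least 3 vertices and deleting any
single vertex leaves a connected graph. -/
def TwoConnected {V : Type*} [Fintype V] (G : SimpleGraph V) : Prop :=
  3 ≤ Fintype.card V ∧ ∀ v : V, (G.induce ({v}ᶜ : Set V)).Connected

/-- A vertex is eligible if its neighbourhood induces a connected non-complete graph. -/
def Eligible {V : Type*} (G : SimpleGraph V) (x : V) : Prop :=
  (G.induce (G.neighborSet x)).Connected ∧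
    ∃ u v : V, G.Adj x u ∧ G.Adj x v ∧ u ≠ v ∧ ¬ G.Adj u v

/-- A claw-free graph is closed if it has no eligible vertex. -/
def IsClosedGraph {V : Type*} (G : SimpleGraph V) : Prop := ∀ x : V, ¬ Eligible G x

/-- The spectral radius of a graph: the largest eigenvalue of its adjacency matrix. -/
noncomputable def adjSpectralRadius {V : Type*} [Fintype V] (G : SimpleGraph V) : ℝ := by
  classical
  exact sSup {μ : ℝ | ∃ x : V → ℝ, x ≠ 0 ∧ (G.adjMatrix ℝ).mulVec x = μ • x}

/-- The `Q`-index of a graph: the largest eigenvalue of `Q = D + A`. -/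
noncomputable def qIndex {V : Type*} [Fintype V] (G : SimpleGraph V) : ℝ := by
  classical
  exact sSup {μ : ℝ | ∃ x : V → ℝ, x ≠ 0 ∧
    (Matrix.diagonal (fun v => (G.degree v : ℝ)) + G.adjMatrix ℝ).mulVec x = μ • x}

/-- `EN n`: the complete graph on `{0, …, n-4}` together with pendant vertices
`n-3, n-2, n-1` attached to `0, 1, 2` respectively. -/
def ENgraph (n : ℕ) : SimpleGraph (Fin n) :=
  SimpleGraph.fromRel (fun i j =>
    (i.val < n - 3 ∧ j.val < n - 3) ∨ j.val = i.val + (n - 3))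

/-- `EP n`: a clique on `{0,…,n-7}` with `a_i = i`, a triangle `b_i = n-6+i`,
and vertices `c_i = n-3+i` with edges `a_i b_i`, `a_i c_i`, `b_i c_i` (`i = 0,1,2`). -/
def EPgraph (n : ℕ) : SimpleGraph (Fin n) :=
  SimpleGraph.fromRel (fun i j =>
    (i.val < n - 6 ∧ j.val < n - 6) ∨
    (n - 6 ≤ i.val ∧ i.val < n - 3 ∧ n - 6 ≤ j.val ∧ j.val < n - 3) ∨
    (i.val < 3 ∧ (j.val = i.val + (n - 6) ∨ j.val = i.val + (n - 3))) ∨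
    (n - 6 ≤ i.val ∧ i.val < n - 3 ∧ j.val = i.val + 3))

/-- `EP' n`: a clique on `{0,…,n-7}` with `a₁ = 0`, `b₁ = 1`, `c₁ = 2`, triangles
`a₁a₂a₃` and `b₁b₂b₃` where `a₂ = n-6`, `a₃ = n-5`, `b₂ = n-4`, `b₃ = n-3`, and
vertices `c₂ = n-2`, `c₃ = n-1` with edges `a_i b_i`, `a_i c_i`, `b_i c_i` for `i = 2,3`. -/
def EP'graph (n : ℕ) : SimpleGraph (Fin n) :=
  SimpleGraph.fromRel (fun i j =>
    (i.val < n - 6 ∧ j.val < n - 6) ∨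
    (i.val = 0 ∧ (j.val = n - 6 ∨ j.val = n - 5)) ∨
    (i.val = 1 ∧ (j.val = n - 4 ∨ j.val = n - 3)) ∨
    (i.val = n - 6 ∧ (j.val = n - 5 ∨ j.val = n - 4 ∨ j.val = n - 2)) ∨
    (i.val = n - 5 ∧ (j.val = n - 3 ∨ j.val = n - 1)) ∨
    (i.val = n - 4 ∧ (j.val = n - 3 ∨ j.val = n - 2)) ∨
    (i.val = n - 3 ∧ j.val = n - 1))

section Paths

variable {V : Type*} {G : SimpleGraph V}

/-- No arrangement of the vertices `x :: l` is a path of `G`. -/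
def Unextendable (G : SimpleGraph V) (x : V) (l : List V) : Prop :=
  ∀ l' : List V, l'.Perm (x :: l) → ¬ l'.IsChain G.Adj

/-- `w` immediately follows `v` in the list `l`. -/
def IsSucc (l : List V) (v w : V) : Prop := ∃ A B, l = A ++ v :: w :: B

theorem isChain_adj_reverse {l : List V} : l.reverse.IsChain G.Adj ↔ l.IsChain G.Adj := by
  simp only [List.isChain_reverse, G.adj_comm]

theorem Unextendable.reverse {x : V} {l : List V} (h : Unextendable G x l) :
    Unextendable G x l.reverse := fun l' hl' =>
  h l' (hl'.trans ((List.reverse_perm l).cons x))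

theorem IsSucc.adj {l : List V} {v w : V} (h : IsSucc l v w) (hl : l.IsChain G.Adj) :
    G.Adj v w := by
  obtain ⟨A, B, rfl⟩ := h
  simp [List.isChain_append] at hl
  tauto

theorem IsSucc.mem_left {l : List V} {v w : V} (h : IsSucc l v w) : v ∈ l := by
  obtain ⟨A, B, rfl⟩ := h; simp

theorem IsSucc.mem_right {l : List V} {v w : V} (h : IsSucc l v w) : w ∈ l := by
  obtain ⟨A, B, rfl⟩ := h; simp

theorem IsSucc.reverse {l : List V} {v w : V} (h : IsSucc l v w) : IsSucc l.reverse w v := by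
  obtain ⟨A, B, rfl⟩ := h
  exact ⟨B.reverse, A.reverse, by simp⟩

theorem IsSucc.left_unique {l : List V} (hl : l.Nodup) {v v' w : V} (h : IsSucc l v w)
    (h' : IsSucc l v' w) : v = v' := by
  classical
  obtain ⟨A, B, rfl⟩ := h
  obtain ⟨A', B', h'⟩ := h'
  have h1 : (A ++ v :: w :: B).idxOf w = A.length + 1 := by
    simp [List.nodup_append] at hl
    rw [List.idxOf_append_of_notMem (by grind)]
    grind
  have h2 : (A ++ v :: w :: B).idxOf w = A'.length + 1 := by
    rw [h'] at hl ⊢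
    simp [List.nodup_append] at hl
    rw [List.idxOf_append_of_notMem (by grind)]
    grind
  have := (List.append_inj h' (by omega)).2
  simp_all

theorem IsSucc.right_unique {l : List V} (hl : l.Nodup) {v w w' : V} (h : IsSucc l v w)
    (h' : IsSucc l v w') : w = w' :=
  h.reverse.left_unique (List.nodup_reverse.2 hl) h'.reverse

theorem IsSucc.ne_head {l : List V} (hl : l.Nodup) {v w f : V} (h : IsSucc l v w)
    (hf : f ∈ l.head?) : w ≠ f := by
  obtain ⟨A, B, rfl⟩ := h
  cases A <;> simp at hf hl <;> grind

theorem IsSucc.ne_getLast {l : List V} (hl : l.Nodup) {v w e : V} (h : IsSucc l v w)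
    (he : e ∈ l.getLast?) : v ≠ e :=
  h.reverse.ne_head (List.nodup_reverse.2 hl) (by simpa using he)

theorem exists_isSucc_right {l : List V} {v : V} (hv : v ∈ l) (hlast : v ∉ l.getLast?) :
    ∃ w, IsSucc l v w := by
  obtain ⟨A, B, rfl⟩ := List.append_of_mem hv
  cases B with
  | nil => simp at hlast
  | cons w B => exact ⟨w, A, B, rfl⟩

theorem exists_isSucc_left {l : List V} {v : V} (hv : v ∈ l) (hhead : v ∉ l.head?) :
    ∃ w, IsSucc l w v := by
  obtain ⟨w, hw⟩ := exists_isSucc_right (l := l.reverse) (v := v) (by simpa) (by simpa)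
  exact ⟨w, by simpa using hw.reverse⟩

namespace Unextendable

variable {x : V} {l : List V}

theorem not_adj_head (h : Unextendable G x l) (hl : l.IsChain G.Adj) {f : V}
    (hf : f ∈ l.head?) : ¬ G.Adj x f := fun hx =>
  h (x :: l) (List.Perm.refl _)
    (List.isChain_cons.2 ⟨fun y hy => by rwa [Option.mem_unique hy hf], hl⟩)

theorem not_adj_getLast (h : Unextendable G x l) (hl : l.IsChain G.Adj) {e : V}
    (he : e ∈ l.getLast?) : ¬ G.Adj x e :=
  h.reverse.not_adj_head (isChain_adj_reverse.2 hl) (by simpa using he)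

theorem not_adj_both (h : Unextendable G x l) (hl : l.IsChain G.Adj) {v w : V}
    (hs : IsSucc l v w) (hv : G.Adj x v) : ¬ G.Adj x w := fun hw => by
  obtain ⟨A, B, rfl⟩ := hs
  refine h (A ++ v :: x :: w :: B) ?_ ?_
  · classical
    exact List.perm_iff_count.2 fun a => by
      simp [List.count_append, List.count_cons]; omega
  · simp [List.isChain_append, List.isChain_cons_cons] at hl ⊢
    grind [SimpleGraph.adj_comm]

theorem not_head_adj_succ (h : Unextendable G x l) (hl : l.IsChain G.Adj) {v w f : V}
    (hs : IsSucc l v w) (hv : G.Adj x v) (hf : f ∈ l.head?) : ¬ G.Adj f w := fun hw => by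
  obtain ⟨A, B, rfl⟩ := hs
  refine h (x :: v :: A.reverse ++ w :: B) ?_ ?_
  · classical
    exact List.perm_iff_count.2 fun a => by
      simp [List.count_append, List.count_cons]; omega
  · have h1 : (v :: A.reverse).IsChain G.Adj := by
      rw [← isChain_adj_reverse]
      simp [List.isChain_append, List.isChain_cons_cons] at hl ⊢
      grind
    rw [List.isChain_append]
    refine ⟨List.isChain_cons_cons.2 ⟨hv, h1⟩, ?_, ?_⟩
    · simp [List.isChain_append] at hl
      tauto
    · simp [List.getLast?_cons] at hf ⊢
      simpa [hf] using hw

theorem not_head_adj_getLast (h : Unextendable G x l) (hl : l.IsChain G.Adj) {v f e : V}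
    (hm : v ∈ l) (hv : G.Adj x v) (hf : f ∈ l.head?) (he : e ∈ l.getLast?) :
    ¬ G.Adj f e := fun hfe => by
  obtain ⟨A, B, rfl⟩ := List.append_of_mem hm
  refine h (x :: v :: B ++ A) ?_ ?_
  · classical
    exact List.perm_iff_count.2 fun a => by
      simp [List.count_append, List.count_cons]; omega
  · simp [List.isChain_append, List.isChain_cons] at hl hf he ⊢
    grind [SimpleGraph.adj_comm]

theorem not_succ_adj_succ_aux (h : Unextendable G x l) (hl : l.IsChain G.Adj) {v y w z : V}
    {A B D : List V} (hd : l = A ++ v :: y :: B ++ w :: z :: D) (hv : G.Adj x v)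
    (hw : G.Adj x w) : ∃ l₁ l₂, (l₁ ++ y :: z :: l₂).Perm (x :: l) ∧
      (l₁ ++ [y]).IsChain G.Adj ∧ (z :: l₂).IsChain G.Adj := by
  subst hd
  refine ⟨A ++ v :: x :: w :: B.reverse, D, ?_, ?_, ?_⟩
  · classical
    exact List.perm_iff_count.2 fun a => by
      simp [List.count_append, List.count_cons]; omega
  · have h1 : (w :: B.reverse ++ [y]).IsChain G.Adj := by
      rw [← isChain_adj_reverse]
      simp [List.isChain_append, List.isChain_cons] at hl ⊢
      grind
    simp [List.isChain_append, List.isChain_cons] at hl h1 ⊢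
    grind [SimpleGraph.adj_comm]
  · simp [List.isChain_append, List.isChain_cons] at hl ⊢
    grind

end Unextendable
end Paths

section Degrees

variable {V : Type*}

/-- The number of neighbours of `v` in `U`. -/
def degIn (G : SimpleGraph V) [DecidableRel G.Adj] (U : Finset V) (v : V) : ℕ :=
  (U.filter (G.Adj v)).card

/-- The number of vertices of `U` other than `v` that are not adjacent to `v`. -/
def codegIn [DecidableEq V] (G : SimpleGraph V) [DecidableRel G.Adj] (U : Finset V) (v : V) : ℕ :=
  (U.filter fun w => w ≠ v ∧ ¬ G.Adj v w).card

/-- Twice the number of non-edges of the graph induced on `U`. -/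
def codegSum [DecidableEq V] (G : SimpleGraph V) [DecidableRel G.Adj] (U : Finset V) : ℕ :=
  ∑ v ∈ U, codegIn G U v

variable {G : SimpleGraph V} [DecidableRel G.Adj]

theorem degIn_mono {U W : Finset V} (h : U ⊆ W) (v : V) : degIn G U v ≤ degIn G W v :=
  Finset.card_le_card (Finset.filter_subset_filter _ h)

variable [DecidableEq V]

theorem degIn_add_codegIn {U : Finset V} {v : V} (hv : v ∈ U) :
    degIn G U v + codegIn G U v + 1 = U.card := by
  have h1 := Finset.card_filter_add_card_filter_not (s := U.erase v) (fun w => G.Adj v w)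
  rw [Finset.card_erase_of_mem hv] at h1
  have h2 : (U.erase v).filter (fun w => G.Adj v w) = U.filter (G.Adj v) := by
    ext w; simp; intro h _; exact h.ne'
  have h3 : (U.erase v).filter (fun w => ¬ G.Adj v w) =
      U.filter (fun w => w ≠ v ∧ ¬ G.Adj v w) := by
    ext w; simp; tauto
  have := Finset.card_pos.2 ⟨v, hv⟩
  rw [h2, h3] at h1
  unfold degIn codegIn
  omega

theorem codegIn_erase {U : Finset V} {u v : V} (hv : v ∈ U) :
    codegIn G U u = codegIn G (U.erase v) u + if v ≠ u ∧ ¬ G.Adj u v then 1 else 0 := by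
  unfold codegIn
  conv_lhs => rw [← Finset.insert_erase hv, Finset.filter_insert]
  split_ifs with h
  · rw [Finset.card_insert_of_notMem (by simp)]
  · rfl

theorem codegSum_erase {U : Finset V} {v : V} (hv : v ∈ U) :
    codegSum G U = codegSum G (U.erase v) + 2 * codegIn G U v := by
  unfold codegSum
  rw [← Finset.add_sum_erase U _ hv,
    Finset.sum_congr rfl fun u _ => codegIn_erase (G := G) (u := u) hv, Finset.sum_add_distrib,
    Finset.sum_boole]
  have h : (U.erase v).filter (fun x => v ≠ x ∧ ¬ G.Adj x v) =
      U.filter fun w => w ≠ v ∧ ¬ G.Adj v w := by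
    ext w; simp [G.adj_comm, eq_comm]; tauto
  rw [h]
  simp only [Nat.cast_id]
  unfold codegIn
  omega

theorem two_mul_codegIn_le {U : Finset V} {v : V} (hv : v ∈ U) :
    2 * codegIn G U v ≤ codegSum G U := by
  rw [codegSum_erase hv]; omega

/-- Two non-adjacent vertices of `U` account for all but one of their joint non-edges. -/
theorem codegIn_add_codegIn_le {U : Finset V} {y z : V} (hy : y ∈ U) (hz : z ∈ U) (hyz : y ≠ z)
    (h : ¬ G.Adj y z) : 2 * (codegIn G U y + codegIn G U z) ≤ codegSum G U + 2 := by
  have h1 := codegSum_erase (G := G) hy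
  have h2 := two_mul_codegIn_le (G := G) (U := U.erase y) (v := z) (by simp [hz, hyz.symm])
  have h3 := codegIn_erase (G := G) (u := z) hy
  rw [if_pos ⟨hyz, fun h' => h h'.symm⟩] at h3
  omega

/-- In a claw-free graph, every vertex outside an independent set `I` has at least `|I| - 2`
non-neighbours in it. -/
theorem card_sub_two_le_codegIn (hG : ClawFree G) {U I : Finset V} (hIU : I ⊆ U)
    (hI : ∀ a ∈ I, ∀ b ∈ I, ¬ G.Adj a b) {v : V} (hv : v ∉ I) :
    I.card ≤ codegIn G U v + 2 := by
  have h1 := Finset.card_filter_add_card_filter_not (s := I) (fun w => G.Adj v w)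
  have h2 : (I.filter fun w => G.Adj v w).card ≤ 2 := by
    by_contra! h
    obtain ⟨a, b, c, ha, hb, hc, hab, hac, hbc⟩ := Finset.two_lt_card_iff.1 h
    simp only [Finset.mem_filter] at ha hb hc
    exact hG ⟨v, a, b, c, hab, hac, hbc, ha.2, hb.2, hc.2, hI a ha.1 b hb.1, hI a ha.1 c hc.1,
      hI b hb.1 c hc.1⟩
  have h3 : (I.filter fun w => ¬ G.Adj v w).card ≤ codegIn G U v := by
    refine Finset.card_le_card fun w hw => ?_
    simp only [Finset.mem_filter] at hw ⊢
    exact ⟨hIU hw.1, by rintro rfl; exact hv hw.1, hw.2⟩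
  omega

theorem codegSum_of_independent {I : Finset V} (hI : ∀ a ∈ I, ∀ b ∈ I, ¬ G.Adj a b) :
    codegSum G I = I.card * (I.card - 1) := by
  unfold codegSum
  rw [Finset.sum_const_nat (m := I.card - 1)]
  intro v hv
  have h := degIn_add_codegIn (G := G) hv
  have : degIn G I v = 0 := by
    unfold degIn
    rw [Finset.card_eq_zero, Finset.filter_eq_empty_iff]
    exact fun w hw => hI v hv w hw
  omega

theorem le_codegSum_of_independent (hG : ClawFree G) {I : Finset V}
    (hI : ∀ a ∈ I, ∀ b ∈ I, ¬ G.Adj a b) {U : Finset V} (hIU : I ⊆ U) :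
    I.card * (I.card - 1) + 2 * (I.card - 2) * (U.card - I.card) ≤ codegSum G U := by
  induction hk : U.card - I.card generalizing U with
  | zero =>
    have := Finset.eq_of_subset_of_card_le hIU (by omega)
    rw [← this, codegSum_of_independent hI]
    simp
  | succ k ih =>
    obtain ⟨v, hvU, hvI⟩ := Finset.exists_mem_notMem_of_card_lt_card (s := I) (t := U) (by omega)
    have h1 := ih (U := U.erase v) (fun a ha => by
      simp only [Finset.mem_erase]
      exact ⟨by rintro rfl; exact hvI ha, hIU ha⟩) (by
      rw [Finset.card_erase_of_mem hvU]; omega)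
    have h2 := codegSum_erase (G := G) hvU
    have h3 := card_sub_two_le_codegIn hG hIU hI hvI
    have h4 : I.card - 2 ≤ codegIn G U v := by omega
    rw [mul_add]
    omega

/-- Degree form of the Bondy-Chvátal closure step for Hamilton paths. -/
theorem degIn_add_degIn_add_two_le {L₁ L₂ : List V} {u v : V} {U : Finset V}
    (h₁ : (L₁ ++ [u]).IsChain G.Adj) (h₂ : (v :: L₂).IsChain G.Adj)
    (hnd : (L₁ ++ u :: v :: L₂).Nodup) (hU : ∀ a, a ∈ U ↔ a ∈ L₁ ++ u :: v :: L₂)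
    (hL : ∀ l' : List V, l'.Perm (L₁ ++ u :: v :: L₂) → ¬ l'.IsChain G.Adj) :
    degIn G U u + degIn G U v + 2 ≤ U.card := by
  set L := L₁ ++ u :: v :: L₂ with hLdef
  have huv : IsSucc L u v := ⟨L₁, L₂, rfl⟩
  have hnadj : ¬ G.Adj u v := fun h => hL L (List.Perm.refl _) (by
    simp [hLdef, List.isChain_append] at h₁ h₂ ⊢
    grind)
  obtain ⟨e, he⟩ : ∃ e, e ∈ L.getLast? := by
    cases hh : L.getLast? with
    | none => simp [hLdef] at hh
    | some e => exact ⟨e, rfl⟩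
  have hhead : ∀ w, w ∈ L.head? → ¬ G.Adj v w := by
    intro w hw hvw
    refine hL ((L₁ ++ [u]).reverse ++ v :: L₂) ?_ ?_
    · exact List.perm_iff_count.2 fun a => by
        simp [hLdef, List.count_append, List.count_cons]; omega
    · rw [List.isChain_append]
      refine ⟨isChain_adj_reverse.2 h₁, h₂, ?_⟩
      intro a ha b hb
      rw [List.getLast?_reverse] at ha
      have : a = w := by
        simp [hLdef] at ha hw
        grind
      simp at hb
      subst this hb
      exact hvw.symm
  have hlast : ¬ G.Adj u e := by
    intro hue
    refine hL ((L₁ ++ [u]) ++ (v :: L₂).reverse) ?_ ?_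
    · exact List.perm_iff_count.2 fun a => by
        simp [hLdef, List.count_append, List.count_cons]
    · rw [List.isChain_append]
      refine ⟨h₁, isChain_adj_reverse.2 h₂, ?_⟩
      intro a ha b hb
      rw [List.head?_reverse] at hb
      have : b = e := by
        simp [hLdef] at he hb
        grind
      simp at ha
      subst this ha
      exact hue
  have hcross : ∀ w w', IsSucc L w' w → G.Adj v w → ¬ G.Adj u w' := by
    rintro w w' hs hvw huw'
    obtain ⟨P, Q, hPQ⟩ := hs
    rw [hLdef, List.append_eq_append_iff] at hPQ
    rcases hPQ with ⟨as, rfl, h⟩ | ⟨bs, rfl, h⟩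
    · rcases as with _ | ⟨u', _ | ⟨v', as⟩⟩
      · simp at h; exact G.irrefl (h.1 ▸ huw')
      · simp at h
        exact hnadj (h.2.1 ▸ huw')
      · simp at h
        obtain ⟨rfl, rfl, rfl⟩ := h
        refine hL ((L₁ ++ [u]) ++ (v :: as ++ [w']).reverse ++ w :: Q) ?_ ?_
        · exact List.perm_iff_count.2 fun a => by
            simp [hLdef, List.count_append, List.count_cons]; omega
        · have h3 : (v :: as ++ [w']).reverse.IsChain G.Adj := by
            rw [isChain_adj_reverse]
            simp [List.isChain_append, List.isChain_cons] at h₂ ⊢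
            grind
          rw [List.isChain_append, List.isChain_append]
          refine ⟨⟨h₁, h3, ?_⟩, ?_, ?_⟩
          · simpa using huw'
          · simp [List.isChain_append, List.isChain_cons] at h₂ ⊢
            grind
          · simpa [List.getLast?_cons] using hvw
    · rcases bs with _ | ⟨p, _ | ⟨q, bs⟩⟩
      · simp at h; exact G.irrefl (h.1 ▸ huw')
      · simp at h
        exact hnadj (h.2.1 ▸ hvw.symm)
      · simp at h
        obtain ⟨rfl, rfl, rfl⟩ := h
        refine hL ((P ++ [w']) ++ (w :: bs ++ [u]).reverse ++ v :: L₂) ?_ ?_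
        · exact List.perm_iff_count.2 fun a => by
            simp [hLdef, List.count_append, List.count_cons]; omega
        · have h3 : (w :: bs ++ [u]).reverse.IsChain G.Adj := by
            rw [isChain_adj_reverse]
            simp [List.isChain_append, List.isChain_cons] at h₁ ⊢
            grind
          rw [List.isChain_append, List.isChain_append]
          refine ⟨⟨?_, h3, ?_⟩, h₂, ?_⟩
          · simp [List.isChain_append, List.isChain_cons] at h₁ ⊢
            grind
          · simpa using huw'.symm
          · simpa [List.getLast?_cons] using hvw.symm
  have hpred : ∀ w, ∃ w', w ∈ U.filter (G.Adj v) → IsSucc L w' w := by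
    intro w
    by_cases hw : w ∈ U.filter (G.Adj v)
    · simp only [Finset.mem_filter, hU] at hw
      obtain ⟨w', h⟩ := exists_isSucc_left hw.1 fun h => hhead w h hw.2
      exact ⟨w', fun _ => h⟩
    · exact ⟨w, fun h => absurd h hw⟩
  choose f hf using hpred
  have hinj : Set.InjOn f (U.filter (G.Adj v) : Finset V) := by
    intro a ha b hb hab
    have h1 := hf a ha
    rw [hab] at h1
    exact h1.right_unique hnd (hf b hb)
  have hdisj : Disjoint (U.filter (G.Adj u)) ((U.filter (G.Adj v)).image f) := by
    rw [Finset.disjoint_left]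
    intro a ha ha'
    obtain ⟨b, hb, rfl⟩ := Finset.mem_image.1 ha'
    exact hcross b _ (hf b hb) (Finset.mem_filter.1 hb).2 (Finset.mem_filter.1 ha).2
  have hsub : U.filter (G.Adj u) ∪ (U.filter (G.Adj v)).image f ⊆ (U.erase u).erase e := by
    intro a ha
    simp only [Finset.mem_erase]
    rcases Finset.mem_union.1 ha with ha | ha
    · have := Finset.mem_filter.1 ha
      exact ⟨by rintro rfl; exact hlast this.2, this.2.ne', this.1⟩
    · obtain ⟨b, hb, rfl⟩ := Finset.mem_image.1 ha
      have hs := hf b hb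
      refine ⟨hs.ne_getLast hnd he, fun h => ?_, (hU _).2 hs.mem_left⟩
      rw [h] at hs
      have := hs.right_unique hnd huv
      exact G.irrefl (this ▸ (Finset.mem_filter.1 hb).2)
  have hcard := Finset.card_le_card hsub
  rw [Finset.card_union_of_disjoint hdisj, Finset.card_image_of_injOn hinj] at hcard
  have hue : e ≠ u := (huv.ne_getLast hnd he).symm
  have huU : u ∈ U := (hU u).2 huv.mem_left
  have heU : e ∈ U := (hU e).2 (List.mem_of_getLast? he)
  have h5 := Finset.card_erase_add_one (Finset.mem_erase.2 ⟨hue, heU⟩)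
  have h6 := Finset.card_erase_add_one huU
  unfold degIn
  omega

end Degrees

section LongestPaths

variable {V : Type*} {G : SimpleGraph V} {x : V} {l : List V}

theorem IsSucc.exists_triple (hl : l.Nodup) {p v q : V} (h₁ : IsSucc l p v) (h₂ : IsSucc l v q) :
    ∃ A B, l = A ++ p :: v :: q :: B := by
  obtain ⟨A, B, h⟩ := h₂
  rcases List.eq_nil_or_concat A with rfl | ⟨A, p', rfl⟩
  · exact absurd rfl (h₁.ne_head hl (f := v) (by simp [h]))
  · have h₃ : IsSucc l p' v := ⟨A, q :: B, by simp [h]⟩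
    rw [h₁.left_unique hl h₃]
    exact ⟨A, B, by simp [h]⟩

theorem IsSucc.exists_of_head {v w f : V} (h : IsSucc l v w) (hf : f ∈ l.head?) :
    ∃ g, IsSucc l f g := by
  obtain ⟨A, B, rfl⟩ := h
  rcases A with _ | ⟨a, _ | ⟨b, A⟩⟩
  · exact ⟨w, [], B, by simpa using hf⟩
  · exact ⟨v, [], w :: B, by simpa using hf⟩
  · exact ⟨b, [], A ++ v :: w :: B, by simpa using hf⟩

theorem IsSucc.exists_of_getLast {v w e : V} (h : IsSucc l v w) (he : e ∈ l.getLast?) :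
    ∃ g, IsSucc l g e := by
  obtain ⟨g, hg⟩ := h.reverse.exists_of_head (f := e) (by simpa using he)
  exact ⟨g, by simpa using hg.reverse⟩

theorem IsSucc.comparable {v y w z : V} (h₁ : IsSucc l v y) (h₂ : IsSucc l w z) :
    v = w ∨ y = w ∨ z = v ∨ (∃ A B D, l = A ++ v :: y :: B ++ w :: z :: D) ∨
      ∃ A B D, l = A ++ w :: z :: B ++ v :: y :: D := by
  obtain ⟨A, B, h₁⟩ := h₁
  obtain ⟨A', B', h₂⟩ := h₂
  rw [h₁, List.append_eq_append_iff] at h₂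
  rcases h₂ with ⟨C, rfl, h⟩ | ⟨C, rfl, h⟩
  · rcases C with _ | ⟨c, _ | ⟨d, C⟩⟩
    · simp at h; tauto
    · simp at h; tauto
    · simp at h
      obtain ⟨rfl, rfl, rfl⟩ := h
      exact .inr (.inr (.inr (.inl ⟨A, C, B', by simp [h₁]⟩)))
  · rcases C with _ | ⟨c, _ | ⟨d, C⟩⟩
    · simp at h; grind
    · simp at h; grind
    · simp at h
      obtain ⟨rfl, rfl, rfl⟩ := h
      exact .inr (.inr (.inr (.inr ⟨A', C, B, by simp [h₁]⟩)))

namespace Unextendable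

theorem exists_interior (h : Unextendable G x l) (hl : l.IsChain G.Adj) {v : V} (hv : v ∈ l)
    (hx : G.Adj x v) : ∃ p q, IsSucc l p v ∧ IsSucc l v q := by
  obtain ⟨p, hp⟩ := exists_isSucc_left hv fun h' => h.not_adj_head hl h' hx
  obtain ⟨q, hq⟩ := exists_isSucc_right hv fun h' => h.not_adj_getLast hl h' hx
  exact ⟨p, q, hp, hq⟩

theorem not_head_adj (h : Unextendable G x l) (hG : ClawFree G) (hl : l.IsChain G.Adj)
    (hnd : l.Nodup) (hxl : x ∉ l) {v f : V} (hv : v ∈ l) (hx : G.Adj x v) (hf : f ∈ l.head?) :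
    ¬ G.Adj f v := by
  intro hfv
  obtain ⟨p, q, hp, hq⟩ := h.exists_interior hl hv hx
  exact hG ⟨v, x, f, q, fun h' => hxl (h' ▸ List.mem_of_mem_head? hf),
    fun h' => hxl (h' ▸ hq.mem_right), (hq.ne_head hnd hf).symm, hx.symm, hfv.symm, hq.adj hl,
    h.not_adj_head hl hf, h.not_adj_both hl hq hx, h.not_head_adj_succ hl hq hx hf⟩

theorem not_getLast_adj (h : Unextendable G x l) (hG : ClawFree G) (hl : l.IsChain G.Adj)
    (hnd : l.Nodup) (hxl : x ∉ l) {v e : V} (hv : v ∈ l) (hx : G.Adj x v) (he : e ∈ l.getLast?) :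
    ¬ G.Adj e v :=
  h.reverse.not_head_adj hG (isChain_adj_reverse.2 hl) (List.nodup_reverse.2 hnd) (by simpa)
    (by simpa) hx (by simpa using he)

theorem succ_ne_getLast (h : Unextendable G x l) (hG : ClawFree G) (hl : l.IsChain G.Adj)
    (hnd : l.Nodup) (hxl : x ∉ l) {v q e : V} (hx : G.Adj x v) (hq : IsSucc l v q)
    (he : e ∈ l.getLast?) : q ≠ e := by
  rintro rfl
  exact h.not_getLast_adj hG hl hnd hxl hq.mem_left hx he (hq.adj hl).symm

theorem exists_closure_gap (h : Unextendable G x l) (hl : l.IsChain G.Adj)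
    (hnd : l.Nodup) {v y w z : V} (hv : G.Adj x v) (hw : G.Adj x w) (hy : IsSucc l v y)
    (hz : IsSucc l w z) (hyz : y ≠ z) :
    ∃ l₁ l₂ u t, (u = y ∧ t = z ∨ u = z ∧ t = y) ∧ (l₁ ++ u :: t :: l₂).Perm (x :: l) ∧
      (l₁ ++ [u]).IsChain G.Adj ∧ (t :: l₂).IsChain G.Adj := by
  rcases hy.comparable hz with rfl | rfl | rfl | ⟨A, B, D, hd⟩ | ⟨A, B, D, hd⟩
  · exact absurd (hy.right_unique hnd hz) hyz
  · exact absurd hw (h.not_adj_both hl hy hv)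
  · exact absurd hv (h.not_adj_both hl hz hw)
  · obtain ⟨l₁, l₂, h'⟩ := h.not_succ_adj_succ_aux hl hd hv hw
    exact ⟨l₁, l₂, y, z, .inl ⟨rfl, rfl⟩, h'⟩
  · obtain ⟨l₁, l₂, h'⟩ := h.not_succ_adj_succ_aux hl hd hw hv
    exact ⟨l₁, l₂, z, y, .inr ⟨rfl, rfl⟩, h'⟩

theorem not_succ_adj_succ (h : Unextendable G x l) (hl : l.IsChain G.Adj)
    (hnd : l.Nodup) {v y w z : V} (hv : G.Adj x v) (hw : G.Adj x w) (hy : IsSucc l v y)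
    (hz : IsSucc l w z) : ¬ G.Adj y z := by
  intro hyz
  obtain ⟨l₁, l₂, u, t, hut, hp, h₁, h₂⟩ := h.exists_closure_gap hl hnd hv hw hy hz hyz.ne
  have : G.Adj u t := by
    rcases hut with ⟨rfl, rfl⟩ | ⟨rfl, rfl⟩
    · exact hyz
    · exact hyz.symm
  refine h _ hp ?_
  simp [List.isChain_append] at h₁ h₂ ⊢
  tauto

variable [DecidableEq V] [DecidableRel G.Adj]

/-- The successors on a longest path of the neighbours of a vertex `x` off that path. -/
theorem exists_succs (h : Unextendable G x l) (hG : ClawFree G) (hl : l.IsChain G.Adj)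
    (hnd : l.Nodup) (hxl : x ∉ l) {U : Finset V} (hU : ∀ a, a ∈ U ↔ a = x ∨ a ∈ l) {f e : V}
    (hf : f ∈ l.head?) (he : e ∈ l.getLast?) :
    ∃ Y : Finset V, Y.card = degIn G U x ∧
      (∀ y ∈ Y, y ∈ l ∧ ¬ G.Adj x y ∧ y ≠ f ∧ y ≠ e ∧ ¬ G.Adj f y) ∧
      (∀ y ∈ Y, ∀ z ∈ Y, ¬ G.Adj y z) ∧
      ∀ y ∈ Y, ∀ z ∈ Y, y ≠ z → degIn G U y + degIn G U z + 2 ≤ U.card := by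
  have hmem : ∀ v ∈ U.filter (G.Adj x), v ∈ l ∧ G.Adj x v := by
    intro v hv
    simp only [Finset.mem_filter, hU] at hv
    rcases hv with ⟨rfl | hv, hx⟩
    · exact absurd hx (G.irrefl)
    · exact ⟨hv, hx⟩
  have hsucc : ∀ v, ∃ y, v ∈ U.filter (G.Adj x) → IsSucc l v y := by
    intro v
    by_cases hv : v ∈ U.filter (G.Adj x)
    · obtain ⟨_, q, _, hq⟩ := h.exists_interior hl (hmem v hv).1 (hmem v hv).2
      exact ⟨q, fun _ => hq⟩
    · exact ⟨v, fun h' => absurd h' hv⟩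
  choose s hs using hsucc
  refine ⟨(U.filter (G.Adj x)).image s, ?_, ?_, ?_, ?_⟩
  · refine Finset.card_image_of_injOn fun a ha b hb hab => ?_
    have h1 := hs a ha
    rw [hab] at h1
    exact h1.left_unique hnd (hs b hb)
  · intro y hy
    obtain ⟨v, hv, rfl⟩ := Finset.mem_image.1 hy
    have hx := (hmem v hv).2
    exact ⟨(hs v hv).mem_right, h.not_adj_both hl (hs v hv) hx, (hs v hv).ne_head hnd hf,
      h.succ_ne_getLast hG hl hnd hxl hx (hs v hv) he,
      h.not_head_adj_succ hl (hs v hv) hx hf⟩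
  · intro y hy z hz
    obtain ⟨v, hv, rfl⟩ := Finset.mem_image.1 hy
    obtain ⟨w, hw, rfl⟩ := Finset.mem_image.1 hz
    exact h.not_succ_adj_succ hl hnd (hmem v hv).2 (hmem w hw).2 (hs v hv) (hs w hw)
  · intro y hy z hz hyz
    obtain ⟨v, hv, rfl⟩ := Finset.mem_image.1 hy
    obtain ⟨w, hw, rfl⟩ := Finset.mem_image.1 hz
    obtain ⟨l₁, l₂, u, t, hut, hp, h₁, h₂⟩ :=
      h.exists_closure_gap hl hnd (hmem v hv).2 (hmem w hw).2 (hs v hv) (hs w hw) hyz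
    have := degIn_add_degIn_add_two_le (U := U) h₁ h₂ (hp.nodup_iff.2 (by simp [hxl, hnd]))
      (fun a => by rw [hp.mem_iff, hU]; simp) (fun l' hl' => h l' (hl'.trans hp))
    rcases hut with ⟨rfl, rfl⟩ | ⟨rfl, rfl⟩ <;> omega

end Unextendable

/-- An interior vertex of a path has at least two neighbours on it. -/
theorem two_le_degIn_of_interior [DecidableRel G.Adj] {U : Finset V}
    (hl : l.IsChain G.Adj) (hnd : l.Nodup) (hU : ∀ a ∈ l, a ∈ U) {v : V} (hv : v ∈ l)
    (hf : v ∉ l.head?) (he : v ∉ l.getLast?) : 2 ≤ degIn G U v := by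
  obtain ⟨p, hp⟩ := exists_isSucc_left hv hf
  obtain ⟨q, hq⟩ := exists_isSucc_right hv he
  have hne : p ≠ q := by
    obtain ⟨A, B, rfl⟩ := hp.exists_triple hnd hq
    simp [List.nodup_append] at hnd
    tauto
  exact Finset.one_lt_card.2 ⟨p, by simp [hU p hp.mem_left, (hp.adj hl).symm], q,
    by simp [hU q hq.mem_right, hq.adj hl], hne⟩

end LongestPaths

section Induction

variable {V : Type*}

/-- `G` has a path with vertex set `U`. -/
def TraceIn (G : SimpleGraph V) (U : Finset V) : Prop :=
  ∃ l : List V, l.Nodup ∧ l.IsChain G.Adj ∧ ∀ a, a ∈ l ↔ a ∈ U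

/-- The graph induced on `U` has no empty edge cut. -/
def ConnIn (G : SimpleGraph V) (U : Finset V) : Prop :=
  ∀ A ⊆ U, A.Nonempty → A ≠ U → ∃ a ∈ A, ∃ b ∈ U, b ∉ A ∧ G.Adj a b

/-- The graph induced on `U` is a spanning subgraph of a clique with three pendant vertices
`s 0`, `s 1`, `s 2` attached at distinct vertices `a 0`, `a 1`, `a 2`. -/
def NetIn (G : SimpleGraph V) (U : Finset V) : Prop :=
  ∃ s a : Fin 3 → V, s.Injective ∧ a.Injective ∧ (∀ i j, s i ≠ a j) ∧
    (∀ i, s i ∈ U ∧ a i ∈ U) ∧ ∀ i, ∀ w ∈ U, G.Adj (s i) w → w = a i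

variable {G : SimpleGraph V} {U : Finset V}

theorem forall_or_forall_not_of_isChain {P : V → Prop} {l : List V}
    (h : l.IsChain fun a b => (P a ↔ P b)) : (∀ a ∈ l, P a) ∨ ∀ a ∈ l, ¬ P a := by
  induction l with
  | nil => simp
  | cons a l ih =>
    rw [List.isChain_cons] at h
    cases l with
    | nil => simp; tauto
    | cons b l =>
      have h1 := h.1 b (by simp)
      have := ih h.2
      simp only [List.mem_cons, forall_eq_or_imp] at this ⊢
      tauto

theorem ConnIn.exists_adj (h : ConnIn G U) {v : V} (hv : v ∈ U) (hU : 1 < U.card) :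
    ∃ w ∈ U, G.Adj v w := by
  obtain ⟨a, ha, b, hb, -, hab⟩ := h {v} (by simpa) (by simp) (by
    rintro rfl; simp at hU)
  rw [Finset.mem_singleton] at ha
  exact ⟨b, hb, ha ▸ hab⟩

theorem unextendable_of_not_traceIn {l : List V} {x : V} (hT : ¬ TraceIn G U) (hnd : l.Nodup)
    (hxl : x ∉ l) (hU : ∀ a, a ∈ U ↔ a = x ∨ a ∈ l) : Unextendable G x l :=
  fun l' hp hc => hT ⟨l', hp.nodup_iff.2 (by simp [hxl, hnd]), hc, fun a => by
    rw [hp.mem_iff, hU]; simp⟩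

theorem eq_of_degIn_le_one [DecidableRel G.Adj] {v a w : V} (h : degIn G U v ≤ 1)
    (ha : a ∈ U) (hva : G.Adj v a) (hw : w ∈ U) (hvw : G.Adj v w) : w = a :=
  Finset.card_le_one.1 h w (by simp [hw, hvw]) a (by simp [ha, hva])

variable [DecidableEq V]

theorem ConnIn.erase_head (h : ConnIn G U) {f : V} {t : List V} (hl : (f :: t).IsChain G.Adj)
    (ht : ∀ a ∈ t, a ∈ U ∧ a ≠ f) (hfU : f ∈ U) (hf : ∀ a ∈ U, G.Adj f a → a ∈ t) :
    ConnIn G (U.erase f) := by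
  intro A hA hne hAU
  by_contra! hcut
  have hAf : f ∉ A := fun h' => by simpa using hA h'
  have hAsub : A ⊆ U := hA.trans (Finset.erase_subset _ _)
  have hside : t.IsChain fun a b => (a ∈ A ↔ b ∈ A) := by
    have h1 : t.IsChain fun a b => G.Adj a b ∧ a ∈ t ∧ b ∈ t := by
      rw [List.isChain_iff_forall_rel_of_append_cons_cons]
      rintro a b l₁ l₂ rfl
      simp [List.isChain_cons, List.isChain_append] at hl
      simp
      tauto
    refine h1.imp fun a b ⟨hab, ha, hb⟩ => ?_
    have ha' := ht a ha
    have hb' := ht b hb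
    constructor
    · intro h2
      by_contra h3
      exact hcut a h2 b (by simp [hb']) h3 hab
    · intro h2
      by_contra h3
      exact hcut b h2 a (by simp [ha']) h3 hab.symm
  rcases forall_or_forall_not_of_isChain hside with hin | hout
  · obtain ⟨a, ha, b, hb, hba, hab⟩ := h (U.erase f \ A) (by
      intro a ha; simp at ha; tauto) (by
      rw [Finset.sdiff_nonempty]; intro h'; exact hAU (hA.antisymm h')) (by
      intro h'; rw [← h'] at hfU; simp at hfU)
    simp only [Finset.mem_sdiff, Finset.mem_erase] at ha hba
    by_cases hbf : b = f
    · subst hbf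
      exact ha.2 (hin a (hf a ha.1.2 hab.symm))
    · exact hcut b (by tauto) a (by simp [ha.1]) ha.2 hab.symm
  · obtain ⟨a, ha, b, hb, hba, hab⟩ := h A hAsub hne (by rintro rfl; exact hAf hfU)
    by_cases hbf : b = f
    · subst hbf
      exact hout a (hf a (hAsub ha) hab.symm) ha
    · exact hcut a ha b (by simp [hbf, hb]) hba hab

theorem ConnIn.insert (h : ConnIn G U) {v w : V} (hw : w ∈ U) (hv : v ∉ U) (hvw : G.Adj v w) :
    ConnIn G (insert v U) := by
  intro A hA hne hAU
  by_cases hvA : v ∈ A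
  · by_cases hA1 : A.erase v = ∅
    · refine ⟨v, hvA, w, by simp [hw], fun hwA => ?_, hvw⟩
      have : w ∈ A.erase v := by simp [hwA, hvw.ne']
      simp [hA1] at this
    · obtain ⟨a, ha, b, hb, hba, hab⟩ := h (A.erase v) (by
        intro a ha
        have := hA (Finset.mem_of_mem_erase ha)
        simp at ha this
        tauto) (Finset.nonempty_iff_ne_empty.2 hA1) (by
        intro h'
        rw [← h', Finset.insert_erase hvA] at hAU
        exact hAU rfl)
      refine ⟨a, Finset.mem_of_mem_erase ha, b, by simp [hb], fun hbA => hba ?_, hab⟩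
      simp only [Finset.mem_erase]
      exact ⟨by rintro rfl; exact hv hb, hbA⟩
  · have hAU' : A ⊆ U := fun a ha => by
      have := hA ha
      simp at this
      rcases this with rfl | h'
      · exact absurd ha hvA
      · exact h'
    by_cases hA1 : A = U
    · subst hA1
      exact ⟨w, hw, v, by simp, hv, hvw.symm⟩
    · obtain ⟨a, ha, b, hb, hba, hab⟩ := h A hAU' hne hA1
      exact ⟨a, ha, b, by simp [hb], hba, hab⟩

theorem ConnIn.erase_pendant (h : ConnIn G U) {z a : V} (hz : z ∈ U)
    (hza : ∀ w ∈ U, G.Adj z w → w = a) : ConnIn G (U.erase z) := by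
  intro A hA hne hAU
  by_contra! hcut
  have hzA : z ∉ A := fun h' => by simpa using hA h'
  have hAsub : A ⊆ U := hA.trans (Finset.erase_subset _ _)
  obtain ⟨c, hc, b, hb, hbA, hcb⟩ := h A hAsub hne (by rintro rfl; exact hzA hz)
  have hbz : b = z := by
    by_contra h'
    exact hcut c hc b (by simp [h', hb]) hbA hcb
  subst hbz
  have hca := hza c (hAsub hc) hcb.symm
  obtain ⟨d, hd, b', hb', hbA', hdb⟩ := h (U.erase b \ A) (by
    intro a ha; simp at ha; tauto) (by
    rw [Finset.sdiff_nonempty]; intro h'; exact hAU (hA.antisymm h')) (by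
    intro h'; rw [← h'] at hz; simp at hz)
  simp only [Finset.mem_sdiff, Finset.mem_erase] at hd hbA'
  by_cases hbb : b' = b
  · subst hbb
    rw [hza d hd.1.2 hdb.symm, ← hca] at hd
    exact hd.2 hc
  · exact hcut b' (by tauto) d (by simp [hd.1]) hd.2 hdb.symm

theorem length_le_card {l : List V} (hnd : l.Nodup) (hl : ∀ a ∈ l, a ∈ U) :
    l.length ≤ U.card := by
  rw [← List.toFinset_card_of_nodup hnd]
  exact Finset.card_le_card fun a ha => hl a (by simpa using ha)

theorem traceIn_of_length_eq {l : List V} (hnd : l.Nodup) (hc : l.IsChain G.Adj)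
    (hl : ∀ a ∈ l, a ∈ U) (hlen : U.card ≤ l.length) : TraceIn G U := by
  have := Finset.eq_of_subset_of_card_le (s := l.toFinset) (t := U)
    (fun a ha => hl a (by simpa using ha)) (by rwa [List.toFinset_card_of_nodup hnd])
  exact ⟨l, hnd, hc, fun a => by rw [← this]; simp⟩

variable [DecidableRel G.Adj]

theorem codegSum_erase_three {p q r : V} (hp : p ∈ U) (hq : q ∈ U) (hr : r ∈ U) (hpq : p ≠ q)
    (hpr : p ≠ r) (hqr : q ≠ r) :
    codegSum G (((U.erase p).erase q).erase r) + 6 * U.card ≤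
      codegSum G U + 12 + 2 * (degIn G U p + degIn G U q + degIn G U r) := by
  have hq' : q ∈ U.erase p := by simp [hpq.symm, hq]
  have hr' : r ∈ (U.erase p).erase q := by simp [hpr.symm, hqr.symm, hr]
  have h1 := codegSum_erase (G := G) hp
  have h2 := codegSum_erase (G := G) hq'
  have h3 := codegSum_erase (G := G) hr'
  have c1 := Finset.card_erase_add_one hp
  have c2 := Finset.card_erase_add_one hq'
  have d1 := degIn_add_codegIn (G := G) hp
  have d2 := degIn_add_codegIn (G := G) hq'
  have d3 := degIn_add_codegIn (G := G) hr'
  have m2 := degIn_mono (G := G) (Finset.erase_subset p U) q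
  have m3 := degIn_mono (G := G)
    ((Finset.erase_subset q (U.erase p)).trans (Finset.erase_subset p U)) r
  omega

theorem card_erase_three {p q r : V} (hp : p ∈ U) (hq : q ∈ U) (hr : r ∈ U) (hpq : p ≠ q)
    (hpr : p ≠ r) (hqr : q ≠ r) : (((U.erase p).erase q).erase r).card + 3 = U.card := by
  have c1 := Finset.card_erase_add_one hp
  have c2 := Finset.card_erase_add_one (s := U.erase p) (a := q) (by simp [hpq.symm, hq])
  have c3 := Finset.card_erase_add_one (s := (U.erase p).erase q) (a := r)
    (by simp [hpr.symm, hqr.symm, hr])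
  omega

/-- The end of a longest path can be deleted without disconnecting the graph, and it has at least
four non-neighbours. -/
theorem erase_head_of_longest (hG : ClawFree G) (hconn : ConnIn G U) (hT : ¬ TraceIn G U)
    {l : List V} (hnd : l.Nodup) (hl : l.IsChain G.Adj) (hlU : ∀ a ∈ l, a ∈ U)
    (hmax : ∀ l' : List V, l'.Nodup → l'.IsChain G.Adj → (∀ a ∈ l', a ∈ U) →
      l'.length ≤ l.length) {f : V} (hf : f ∈ l.head?) :
    ConnIn G (U.erase f) ∧ 4 ≤ codegIn G U f := by
  have hfl := List.mem_of_mem_head? hf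
  have hun : ∀ y ∈ U, y ∉ l → Unextendable G y l := fun y hy hyl l' hp hc => by
    have h1 := hmax l' (hp.nodup_iff.2 (by simp [hyl, hnd])) hc (fun a ha => by
      rw [hp.mem_iff] at ha
      rcases List.mem_cons.1 ha with rfl | ha
      · exact hy
      · exact hlU a ha)
    rw [hp.length_eq] at h1
    simp at h1
  obtain ⟨v, hv, x, hxU, hxl, hvx⟩ := hconn l.toFinset
    (fun a ha => hlU a (by simpa using ha)) ⟨f, by simpa⟩ (fun h' => hT ⟨l, hnd, hl, fun a => by
      rw [← h']; simp⟩)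
  rw [List.mem_toFinset] at hv hxl
  have hux := hun x hxU hxl
  refine ⟨?_, ?_⟩
  · cases l with
    | nil => simp at hf
    | cons g t =>
      obtain rfl : g = f := by simpa using hf
      refine hconn.erase_head hl (fun a ha => ⟨hlU a (by simp [ha]), ?_⟩) (hlU _ hfl) ?_
      · rintro rfl; simp [ha] at hnd
      · intro a ha hfa
        by_contra hat
        exact (hun a ha (by simp [hat, hfa.ne'])).not_adj_head hl hf hfa.symm
  · obtain ⟨e, he⟩ : ∃ e, e ∈ l.getLast? := by
      cases h : l.getLast? with
      | none => simp at h; simp [h] at hfl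
      | some e => exact ⟨e, rfl⟩
    obtain ⟨p, q, hp, hq⟩ := hux.exists_interior hl hv hvx.symm
    obtain ⟨g, hg⟩ := hp.exists_of_head hf
    have hxv := hvx.symm
    have hqe := hux.succ_ne_getLast hG hl hnd hxl hxv hq he
    have hve : v ≠ e := by rintro rfl; exact hux.not_adj_getLast hl he hxv
    have hvf : v ≠ f := by rintro rfl; exact hux.not_adj_head hl hf hxv
    have hcard : ({x, v, q, e} : Finset V).card = 4 := by
      rw [Finset.card_insert_of_notMem, Finset.card_insert_of_notMem,
        Finset.card_insert_of_notMem, Finset.card_singleton]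
      · simpa using hqe
      · simp [hve, (hq.adj hl).ne]
      · have := hq.mem_right
        have := List.mem_of_getLast? he
        simp only [Finset.mem_insert, Finset.mem_singleton]
        rintro (rfl | rfl | rfl) <;> contradiction
    rw [← hcard]
    refine Finset.card_le_card fun w hw => ?_
    simp only [Finset.mem_insert, Finset.mem_singleton] at hw
    rw [Finset.mem_filter]
    rcases hw with rfl | rfl | rfl | rfl
    · exact ⟨hxU, by rintro rfl; contradiction, fun h => hux.not_adj_head hl hf h.symm⟩
    · exact ⟨hlU _ hv, hvf, hux.not_head_adj hG hl hnd hxl hv hxv hf⟩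
    · exact ⟨hlU _ hq.mem_right, hq.ne_head hnd hf, hux.not_head_adj_succ hl hq hxv hf⟩
    · exact ⟨hlU _ (List.mem_of_getLast? he), (hg.ne_getLast hnd he).symm,
        hux.not_head_adj_getLast hl hv hxv hf he⟩

/-- A dense non-traceable claw-free graph in which a vertex `x` of a suitably large degree can be
deleted to leave a traceable graph is a net. -/
theorem netIn_of_path_erase (hG : ClawFree G) (hconn : ConnIn G U)
    (hc : codegSum G U + 42 ≤ 8 * U.card) (hT : ¬ TraceIn G U) {x f e : V} {l : List V}
    (hnd : l.Nodup) (hl : l.IsChain G.Adj) (hxl : x ∉ l) (hU : ∀ a, a ∈ U ↔ a = x ∨ a ∈ l)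
    (hf : f ∈ l.head?) (he : e ∈ l.getLast?) (hfx : degIn G U f ≤ degIn G U x)
    (hex : degIn G U e ≤ degIn G U x) : NetIn G U := by
  have hux := unextendable_of_not_traceIn hT hnd hxl hU
  have hxU : x ∈ U := by simp [hU]
  have hlU : ∀ a ∈ l, a ∈ U := fun a ha => (hU a).2 (.inr ha)
  have hfl := List.mem_of_mem_head? hf
  have hel := List.mem_of_getLast? he
  have hxf : x ≠ f := by rintro rfl; contradiction
  have hxe : x ≠ e := by rintro rfl; contradiction
  obtain ⟨v, hvU, hxv⟩ := hconn.exists_adj hxU (by omega)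
  have hvl : v ∈ l := by
    rcases (hU v).1 hvU with rfl | h
    · exact absurd hxv G.irrefl
    · exact h
  obtain ⟨p, q, hp, hq⟩ := hux.exists_interior hl hvl hxv
  obtain ⟨f', hf'⟩ := hp.exists_of_head hf
  obtain ⟨e', he'⟩ := hp.exists_of_getLast he
  have hfe : f ≠ e := hf'.ne_getLast hnd he
  obtain ⟨Y, hYc, hYl, hYi, hYd⟩ := hux.exists_succs hG hl hnd hxl hU hf he
  have hd3 : degIn G U x ≤ 3 := by
    by_contra! hd
    have hcard : 6 ≤ (insert x (insert f Y)).card := by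
      rw [Finset.card_insert_of_notMem, Finset.card_insert_of_notMem]
      · omega
      · intro h; exact (hYl f h).2.2.1 rfl
      · simp only [Finset.mem_insert, hxf, false_or]
        intro h; exact hxl (hYl x h).1
    obtain ⟨I, hIs, hI6⟩ := Finset.exists_subset_card_eq hcard
    have hxf' := hux.not_adj_head hl hf
    have hI : ∀ a ∈ insert x (insert f Y), ∀ b ∈ insert x (insert f Y), ¬ G.Adj a b := by
      intro a ha b hb hab
      simp only [Finset.mem_insert] at ha hb
      rcases ha with rfl | rfl | ha <;> rcases hb with rfl | rfl | hb
      · exact G.irrefl hab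
      · exact hxf' hab
      · exact (hYl b hb).2.1 hab
      · exact hxf' hab.symm
      · exact G.irrefl hab
      · exact (hYl b hb).2.2.2.2 hab
      · exact (hYl a ha).2.1 hab.symm
      · exact (hYl a ha).2.2.2.2 hab.symm
      · exact hYi a ha b hb hab
    have hIU : I ⊆ U := fun a ha => by
      have := hIs ha
      simp only [Finset.mem_insert] at this
      rcases this with rfl | rfl | h
      · exact hxU
      · exact hlU _ hfl
      · exact hlU _ (hYl a h).1
    have h1 := le_codegSum_of_independent hG (I := I) (U := U)
      (fun a ha b hb => hI a (hIs ha) b (hIs hb)) hIU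
    have h2 := Finset.card_le_card hIU
    rw [hI6] at h1 h2
    omega
  set H := ((U.erase x).erase f).erase e with hH
  have hcH := codegSum_erase_three (G := G) hxU (hlU f hfl) (hlU e hel) hxf hxe hfe
  have hHc := card_erase_three hxU (hlU f hfl) (hlU e hel) hxf hxe hfe
  rw [← hH] at hcH hHc
  have hYH : Y ⊆ H := fun y hy => by
    have h := hYl y hy
    simp only [hH, Finset.mem_erase]
    exact ⟨h.2.2.2.1, h.2.2.1, by rintro rfl; exact hxl h.1, hlU y h.1⟩
  have hHU : H ⊆ U := (Finset.erase_subset _ _).trans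
    ((Finset.erase_subset _ _).trans (Finset.erase_subset _ _))
  have hd1 : degIn G U x ≤ 1 := by
    by_contra! hd
    rcases (show degIn G U x = 2 ∨ degIn G U x = 3 by omega) with hd | hd
    · obtain ⟨y, hy, z, hz, hyz⟩ := Finset.one_lt_card.1 (show 1 < Y.card by omega)
      have h1 := codegIn_add_codegIn_le (hYH hy) (hYH hz) hyz (hYi y hy z hz)
      have h2 := degIn_add_codegIn (G := G) (hYH hy)
      have h3 := degIn_add_codegIn (G := G) (hYH hz)
      have h4 := degIn_mono (G := G) hHU y
      have h5 := degIn_mono (G := G) hHU z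
      have h6 := hYd y hy z hz hyz
      omega
    · have h1 := le_codegSum_of_independent hG hYi hYH
      have h2 := Finset.card_le_card hYH
      rw [hYc, hd] at h1
      omega
  have hvf : v ≠ f := by rintro rfl; exact hux.not_adj_head hl hf hxv
  have hve : v ≠ e := by rintro rfl; exact hux.not_adj_getLast hl he hxv
  have hfv := hux.not_head_adj hG hl hnd hxl hvl hxv hf
  have hev := hux.not_getLast_adj hG hl hnd hxl hvl hxv he
  have hfe' := hux.not_head_adj_getLast hl hvl hxv hf he
  have hff' := hf'.adj hl
  have hee' := (he'.adj hl).symm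
  have hvf' : v ≠ f' := by rintro rfl; exact hfv hff'
  have hve' : v ≠ e' := by rintro rfl; exact hev hee'
  have hfe1 : f' ≠ e' := by
    rintro rfl
    obtain ⟨A, B, h⟩ := hf'.exists_triple hnd he'
    have hA : A = [] := by
      rcases A with _ | ⟨b, A⟩
      · rfl
      · simp [h] at hf; subst hf; simp [h] at hnd
    have hB : B = [] := by
      rcases List.eq_nil_or_concat B with rfl | ⟨B, b, rfl⟩
      · rfl
      · have : b = e := by
          rw [h] at he
          simpa [List.getLast?_append, List.getLast?_cons] using he
        subst this
        simp [h, List.nodup_append] at hnd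
    subst hA hB
    rw [h] at hvl
    simp at hvl
    tauto
  refine ⟨![x, f, e], ![v, f', e'], ?_, ?_, ?_, ?_, ?_⟩
  · intro i j; fin_cases i <;> fin_cases j <;> simp [hxf, hxe, hfe, hxf.symm, hxe.symm, hfe.symm]
  · intro i j
    fin_cases i <;> fin_cases j <;>
      simp [hvf', hve', hfe1, hvf'.symm, hve'.symm, hfe1.symm]
  · have hxf1 : x ≠ f' := by rintro rfl; exact hxl hf'.mem_right
    have hxe1 : x ≠ e' := by rintro rfl; exact hxl he'.mem_left
    have hfe2 : f ≠ e' := by rintro rfl; exact hfe' hee'.symm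
    have hef2 : e ≠ f' := by rintro rfl; exact hfe' hff'
    intro i j
    fin_cases i <;> fin_cases j <;>
      simp [hxv.ne, hxf1, hxe1, hvf.symm, hff'.ne, hfe2, hve.symm, hef2, hee'.ne]
  · intro i
    fin_cases i
    · exact ⟨hxU, hvU⟩
    · exact ⟨hlU _ hfl, hlU _ hf'.mem_right⟩
    · exact ⟨hlU _ hel, hlU _ he'.mem_left⟩
  · intro i w hw hadj
    fin_cases i
    · exact eq_of_degIn_le_one hd1 hvU hxv hw hadj
    · exact eq_of_degIn_le_one (hfx.trans hd1) (hlU _ hf'.mem_right) hff' hw hadj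
    · exact eq_of_degIn_le_one (hex.trans hd1) (hlU _ he'.mem_left) hee' hw hadj

end Induction

section Reduction

variable {V : Type*} {G : SimpleGraph V} {U : Finset V} [DecidableRel G.Adj]

theorem degIn_le_card_of_forall {v : V} (S : Finset V) (h : ∀ w ∈ U, G.Adj v w → w ∈ S) :
    degIn G U v ≤ S.card :=
  Finset.card_le_card fun w hw => h w (Finset.mem_filter.1 hw).1 (Finset.mem_filter.1 hw).2

theorem exists_adj_notMem_of_card_lt {v : V} {S : Finset V} (h : S.card < degIn G U v) :
    ∃ w ∈ U, w ∉ S ∧ G.Adj v w := by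
  obtain ⟨w, hw, hwS⟩ := Finset.exists_mem_notMem_of_card_lt_card h
  rw [Finset.mem_filter] at hw
  exact ⟨w, hw.1, hwS, hw.2⟩

variable [DecidableEq V]

/-- If deleting a vertex `v` leaves a net then the graph itself is a net, provided that suitable
vertices can be deleted to leave a traceable graph or a net. -/
theorem netIn_of_netIn_erase (hG : ClawFree G) (hc : codegSum G U + 42 ≤ 8 * U.card)
    (hT : ¬ TraceIn G U) {v : V} (hv : v ∈ U) (hconn : ConnIn G (U.erase v))
    (hN : NetIn G (U.erase v))
    (ih : ∀ z ∈ U, ConnIn G (U.erase z) → 4 ≤ codegIn G U z →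
      TraceIn G (U.erase z) ∨ NetIn G (U.erase z)) : NetIn G U := by
  obtain ⟨s, a, hs, ha, hsa, hmem, hpen⟩ := hN
  have hsv : ∀ i, s i ≠ v := fun i => Finset.ne_of_mem_erase (hmem i).1
  have hsU : ∀ i, s i ∈ U := fun i => Finset.mem_of_mem_erase (hmem i).1
  have hav : ∀ i, a i ≠ v := fun i => Finset.ne_of_mem_erase (hmem i).2
  have haU : ∀ i, a i ∈ U := fun i => Finset.mem_of_mem_erase (hmem i).2
  have hpen' : ∀ i, ∀ w ∈ U, G.Adj (s i) w → w = v ∨ w = a i := fun i w hw h => by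
    by_cases hwv : w = v
    · exact .inl hwv
    · exact .inr (hpen i w (Finset.mem_erase.2 ⟨hwv, hw⟩) h)
  have hcv : codegIn G U v + 9 ≤ U.card := by
    have hd : ∀ i, degIn G (U.erase v) (s i) ≤ 1 := fun i =>
      degIn_le_card_of_forall {a i} fun w hw h => by simpa using hpen i w hw h
    have h1 := codegSum_erase_three (G := G) (hmem 0).1 (hmem 1).1 (hmem 2).1
      (hs.ne (by decide)) (hs.ne (by decide)) (hs.ne (by decide))
    have h2 := codegSum_erase (G := G) hv
    have h3 := Finset.card_erase_add_one hv
    have := hd 0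
    have := hd 1
    have := hd 2
    omega
  have hdv := degIn_add_codegIn (G := G) hv
  by_cases h : ∀ i, ¬ G.Adj v (s i)
  · exact ⟨s, a, hs, ha, hsa, fun i => ⟨hsU i, haU i⟩, fun i w hw hadj =>
      (hpen' i w hw hadj).resolve_left (by rintro rfl; exact h i hadj.symm)⟩
  push Not at h
  obtain ⟨i, hvi⟩ := h
  exfalso
  have hnss : ∀ i j, ¬ G.Adj (s i) (s j) := fun i j h => by
    rcases hpen' i _ (hsU j) h with h | h
    · exact hsv j h
    · exact hsa j i h
  have hnv : ∀ j, j ≠ i → ¬ G.Adj v (s j) := by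
    intro j hj hvj
    obtain ⟨w, hwU, hw, hvw⟩ := exists_adj_notMem_of_card_lt (G := G) (U := U) (v := v)
      (S := {s i, s j, a i, a j}) (by
        have := Finset.card_le_four (a := s i) (b := s j) (c := a i) (d := a j)
        omega)
    simp only [Finset.mem_insert, Finset.mem_singleton, not_or] at hw
    refine hG ⟨v, s i, s j, w, hs.ne hj.symm, Ne.symm hw.1, Ne.symm hw.2.1, hvi, hvj, hvw,
      hnss i j, fun h => ?_, fun h => ?_⟩
    · rcases hpen' i w hwU h with h | h
      · exact hvw.ne' h
      · exact hw.2.2.1 h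
    · rcases hpen' j w hwU h with h | h
      · exact hvw.ne' h
      · exact hw.2.2.2 h
  have hdi : degIn G U (s i) ≤ 2 :=
    (degIn_le_card_of_forall {v, a i} fun w hw h => by simpa using hpen' i w hw h).trans
      Finset.card_le_two
  have hdj : ∀ j, j ≠ i → degIn G U (s j) ≤ 1 := fun j hj =>
    degIn_le_card_of_forall {a j} fun w hw h => by
      simpa using (hpen' j w hw h).resolve_left (by rintro rfl; exact hnv j hj h.symm)
  have hcz := degIn_add_codegIn (G := G) (hsU i)
  have hzconn : ConnIn G (U.erase (s i)) := by
    obtain ⟨w, hwU, hw, hvw⟩ := exists_adj_notMem_of_card_lt (G := G) (U := U) (v := v)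
      (S := {s i}) (by simp; omega)
    have h1 := (hconn.erase_pendant (hmem i).1 (hpen i)).insert (v := v) (w := w)
      (by simp only [Finset.mem_singleton] at hw; simp [hw, hvw.ne', hwU]) (by simp) hvw
    rwa [Finset.erase_right_comm, Finset.insert_erase (by simp [(hsv i).symm, hv])] at h1
  obtain ⟨j, k, hji, hki, hjk⟩ : ∃ j k : Fin 3, j ≠ i ∧ k ≠ i ∧ j ≠ k :=
    (by decide : ∀ i : Fin 3, ∃ j k, j ≠ i ∧ k ≠ i ∧ j ≠ k) i
  have hHc := codegSum_erase_three (G := G) (hsU i) (hsU j) (hsU k) (hs.ne hji.symm)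
    (hs.ne hki.symm) (hs.ne hjk)
  have hHn := card_erase_three (hsU i) (hsU j) (hsU k) (hs.ne hji.symm)
    (hs.ne hki.symm) (hs.ne hjk)
  have hdj' := hdj j hji
  have hdk' := hdj k hki
  set H := ((U.erase (s i)).erase (s j)).erase (s k) with hH
  have hmemH : ∀ w ∈ U.erase (s i), w ∈ H ∨ w = s j ∨ w = s k := fun w hw => by
    simp only [hH, Finset.mem_erase] at hw ⊢
    tauto
  have hHU : H ⊆ U.erase (s i) := (Finset.erase_subset _ _).trans (Finset.erase_subset _ _)
  rcases ih (s i) (hsU i) hzconn (by omega) with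
    ⟨l, hnd, hl, hlU⟩ | ⟨s', a', hs', -, -, hmem', hpen₂⟩
  · have hzl : s i ∉ l := by simp [hlU]
    have hU : ∀ b, b ∈ U ↔ b = s i ∨ b ∈ l := fun b => by
      rw [hlU, Finset.mem_erase]
      constructor
      · tauto
      · rintro (rfl | h)
        · exact hsU i
        · exact h.2
    have hux := unextendable_of_not_traceIn hT hnd hzl hU
    obtain ⟨f, hf⟩ : ∃ f, f ∈ l.head? := by
      cases l with
      | nil => have := (hU v).1 hv; simp [(hsv i).symm] at this
      | cons f l => exact ⟨f, by simp⟩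
    obtain ⟨e, he⟩ : ∃ e, e ∈ l.getLast? := by
      cases l with
      | nil => simp at hf
      | cons f l => exact ⟨_, List.getLast?_cons⟩
    obtain ⟨Y, hYc, hYl, hYi, hYd⟩ := hux.exists_succs hG hl hnd hzl hU hf he
    obtain ⟨w, hw, hzw⟩ := hconn.exists_adj (hmem i).1 (by
      have := Finset.card_erase_add_one hv
      omega)
    rw [hpen i w hw hzw] at hzw
    have hd2 : 1 < degIn G U (s i) := Finset.one_lt_card.2
      ⟨v, by simp [hv, hvi.symm], a i, by simp [haU, hzw], (hav i).symm⟩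
    obtain ⟨y, hy, z, hz, hyz⟩ := Finset.one_lt_card.1 (hYc ▸ hd2)
    have hYj : ∀ y ∈ Y, y ∈ H := fun y hy => by
      obtain ⟨hyl, -, hyf, hye, -⟩ := hYl y hy
      have h2 := two_le_degIn_of_interior (U := U) hl hnd (fun b hb => (hU b).2 (.inr hb)) hyl
        (fun h => hyf (Option.mem_unique h hf)) (fun h => hye (Option.mem_unique h he))
      rcases hmemH y ((hlU y).1 hyl) with h | rfl | rfl
      · exact h
      · omega
      · omega
    have h1 := codegIn_add_codegIn_le (hYj y hy) (hYj z hz) hyz (hYi y hy z hz)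
    have h2 := degIn_add_codegIn (G := G) (hYj y hy)
    have h3 := degIn_add_codegIn (G := G) (hYj z hz)
    have hHU' := hHU.trans (Finset.erase_subset _ _)
    have h4 := degIn_mono (G := G) hHU' y
    have h5 := degIn_mono (G := G) hHU' z
    have h6 := hYd y hy z hz hyz
    omega
  · have hout : ∀ m, s' m = s j ∨ s' m = s k := fun m => by
      refine (hmemH _ (hmem' m).1).resolve_left fun hm => ?_
      have h1 : degIn G (U.erase (s i)) (s' m) ≤ 1 :=
        degIn_le_card_of_forall {a' m} fun w hw h => by simpa using hpen₂ m w hw h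
      have h2 := degIn_mono (G := G) hHU (s' m)
      have h3 := degIn_add_codegIn (G := G) hm
      have h4 := two_mul_codegIn_le (G := G) hm
      omega
    have h01 : s' 0 ≠ s' 1 := hs'.ne (by decide)
    have h02 : s' 0 ≠ s' 2 := hs'.ne (by decide)
    have h12 : s' 1 ≠ s' 2 := hs'.ne (by decide)
    rcases hout 0 with h0 | h0 <;> rcases hout 1 with h1 | h1 <;> rcases hout 2 with h2 | h2 <;>
      first
      | exact h01 (h0.trans h1.symm)
      | exact h02 (h0.trans h2.symm)
      | exact h12 (h1.trans h2.symm)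

theorem exists_longest (G : SimpleGraph V) (U : Finset V) :
    ∃ l : List V, (l.Nodup ∧ l.IsChain G.Adj ∧ ∀ a ∈ l, a ∈ U) ∧
      ∀ l' : List V, l'.Nodup → l'.IsChain G.Adj → (∀ a ∈ l', a ∈ U) → l'.length ≤ l.length := by
  classical
  have h0 : ∃ l : List V, (l.Nodup ∧ l.IsChain G.Adj ∧ ∀ a ∈ l, a ∈ U) ∧ l.length = 0 :=
    ⟨[], by simp⟩
  obtain ⟨l, hl, hlen⟩ := Nat.findGreatest_spec
    (P := fun m => ∃ l : List V, (l.Nodup ∧ l.IsChain G.Adj ∧ ∀ a ∈ l, a ∈ U) ∧ l.length = m)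
    (Nat.zero_le U.card) h0
  refine ⟨l, hl, fun l' h1 h2 h3 => ?_⟩
  rw [hlen]
  exact Nat.le_findGreatest (length_le_card h1 h3) ⟨l', ⟨h1, h2, h3⟩, rfl⟩

/-- A connected claw-free graph with few non-edges has a Hamilton path or is a net. -/
theorem traceIn_or_netIn (hG : ClawFree G) (hconn : ConnIn G U)
    (hc : codegSum G U + 42 ≤ 8 * U.card) : TraceIn G U ∨ NetIn G U := by
  induction U using Finset.strongInduction with
  | H U ih =>
  by_contra! hcon
  obtain ⟨hT, hN⟩ := hcon
  have ih' : ∀ z ∈ U, ConnIn G (U.erase z) → 4 ≤ codegIn G U z →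
      TraceIn G (U.erase z) ∨ NetIn G (U.erase z) := fun z hz hzc h4 => by
    refine ih _ (Finset.erase_ssubset hz) hzc ?_
    have := codegSum_erase (G := G) hz
    have := Finset.card_erase_add_one hz
    omega
  have hhead : ∀ l : List V, l.Nodup → l.IsChain G.Adj → (∀ a ∈ l, a ∈ U) →
      (∀ l' : List V, l'.Nodup → l'.IsChain G.Adj → (∀ a ∈ l', a ∈ U) → l'.length ≤ l.length) →
      ∀ f ∈ l.head?, TraceIn G (U.erase f) := fun l h1 h2 h3 h4 f hf => by
    have hfU := h3 f (List.mem_of_mem_head? hf)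
    obtain ⟨hfc, hf4⟩ := erase_head_of_longest hG hconn hT h1 h2 h3 h4 hf
    exact (ih' f hfU hfc hf4).resolve_right fun h =>
      hN (netIn_of_netIn_erase hG hc hT hfU hfc h ih')
  classical
  have hR : (U.filter fun x => TraceIn G (U.erase x)).Nonempty := by
    obtain ⟨l, ⟨h1, h2, h3⟩, h4⟩ := exists_longest G U
    obtain ⟨u, hu⟩ : U.Nonempty := Finset.card_pos.1 (by omega)
    have h5 := h4 [u] (by simp) (by simp) (by simpa)
    cases l with
    | nil => simp at h5
    | cons f l => exact ⟨f, Finset.mem_filter.2 ⟨h3 f (by simp), hhead _ h1 h2 h3 h4 f (by simp)⟩⟩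
  obtain ⟨x, hx, hmax⟩ := Finset.exists_max_image _ (degIn G U) hR
  obtain ⟨hxU, l, hnd, hl, hlU⟩ := Finset.mem_filter.1 hx
  have hlU' : ∀ a ∈ l, a ∈ U := fun a ha => Finset.mem_of_mem_erase ((hlU a).1 ha)
  have hlen : l.length + 1 = U.card := by
    rw [← Finset.card_erase_add_one hxU, ← List.toFinset_card_of_nodup hnd]
    congr 2
    ext a
    simp [hlU]
  have hlong : ∀ l' : List V, l'.Nodup → l'.IsChain G.Adj → (∀ a ∈ l', a ∈ U) →
      l'.length ≤ l.length := fun l' h1 h2 h3 => by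
    by_contra! h
    exact hT (traceIn_of_length_eq h1 h2 h3 (by omega))
  have hne : l ≠ [] := by rintro rfl; simp at hlen; omega
  have hf : l.head hne ∈ l.head? := List.head?_eq_some_head hne
  have he : l.getLast hne ∈ l.getLast? := List.getLast?_eq_some_getLast hne
  have hfT := hhead l hnd hl hlU' hlong _ hf
  have heT := hhead l.reverse (List.nodup_reverse.2 hnd) (isChain_adj_reverse.2 hl)
    (by simpa using hlU') (by simpa using hlong) (l.getLast hne) (by simpa using he)
  refine hN (netIn_of_path_erase hG hconn hc hT hnd hl (by simp [hlU]) (fun a => ?_) hf he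
    (hmax _ (Finset.mem_filter.2 ⟨hlU' _ (List.head_mem hne), hfT⟩))
    (hmax _ (Finset.mem_filter.2 ⟨hlU' _ (List.getLast_mem hne), heT⟩)))
  rw [hlU, Finset.mem_erase]
  constructor
  · tauto
  · rintro (rfl | h)
    · exact hxU
    · exact h.2

end Reduction

section Conversion

variable {V : Type*} [Fintype V] {G : SimpleGraph V}

theorem connIn_univ (hconn : G.Connected) : ConnIn G Finset.univ := by
  rintro A - ⟨a, ha⟩ hA
  obtain ⟨b, hb⟩ : ∃ b, b ∉ A := by simpa [Finset.eq_univ_iff_forall] using hA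
  obtain ⟨p⟩ := hconn a b
  obtain ⟨d, -, h1, h2⟩ := p.exists_boundary_dart A ha hb
  exact ⟨d.fst, h1, d.snd, Finset.mem_univ _, h2, d.adj⟩

theorem codegSum_univ_add [DecidableEq V] [DecidableRel G.Adj] :
    codegSum G Finset.univ + 2 * G.edgeFinset.card + Fintype.card V =
      Fintype.card V * Fintype.card V := by
  have h : ∀ v ∈ Finset.univ, G.degree v + codegIn G Finset.univ v + 1 = Fintype.card V :=
    fun v hv => by
      rw [← Finset.card_univ, ← degIn_add_codegIn (G := G) hv, degIn,
        ← SimpleGraph.neighborFinset_eq_filter, SimpleGraph.card_neighborFinset_eq_degree]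
  have h' := Finset.sum_congr rfl h
  simp only [Finset.sum_add_distrib, SimpleGraph.sum_degrees_eq_twice_card_edges,
    Finset.sum_const, smul_eq_mul, Finset.card_univ, mul_one] at h'
  rw [← h', codegSum]
  omega

theorem traceable_of_traceIn_univ [Nonempty V] (h : TraceIn G Finset.univ) : Traceable G := by
  classical
  obtain ⟨l, hnd, hl, hlU⟩ := h
  have hne : l ≠ [] := List.ne_nil_of_mem ((hlU (Classical.arbitrary V)).2 (Finset.mem_univ _))
  refine ⟨_, _, SimpleGraph.Walk.ofSupport l hne hl, fun a => ?_⟩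
  rw [SimpleGraph.Walk.support_ofSupport]
  convert! List.count_eq_one_of_mem hnd ((hlU a).2 (Finset.mem_univ a))

theorem exists_iso_le_ENgraph {n : ℕ} (hn : 6 ≤ n) (hcard : Fintype.card V = n)
    (h : NetIn G Finset.univ) :
    ∃ H : SimpleGraph (Fin n), H ≤ ENgraph n ∧ Nonempty (G ≃g H) := by
  classical
  obtain ⟨s, a, hs, ha, hsa, -, hpen⟩ := h
  let p : Fin 3 ⊕ Fin 3 → V := Sum.elim a s
  let q : Fin 3 ⊕ Fin 3 → Fin n :=
    Sum.elim (fun i => ⟨i, by omega⟩) fun i => ⟨i + (n - 3), by omega⟩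
  have hp : p.Injective := ha.sumElim hs fun i j => (hsa j i).symm
  have hq : q.Injective := by
    refine Function.Injective.sumElim (fun i j h => ?_) (fun i j h => ?_) fun i j h => ?_
    all_goals
      simp only [Fin.mk.injEq] at h
      omega
  obtain ⟨g, hg⟩ := Set.MapsTo.exists_equiv_extend_of_card_eq (α := Fin n) (t := Finset.univ)
    (s := Set.range q) (f := Function.extend q p fun _ => a 0) (by simpa using hcard.symm)
    (fun _ _ => by simp) (by
      rintro _ ⟨i, rfl⟩ _ ⟨j, rfl⟩ hij
      rw [hq.extend_apply, hq.extend_apply] at hij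
      rw [hp hij])
  let g' : Fin n ≃ V := g.trans (Equiv.subtypeUnivEquiv Finset.mem_univ)
  have hg' : ∀ i, g' (q i) = p i := fun i => by
    rw [← hq.extend_apply p (fun _ => a 0) i]
    exact hg _ ⟨i, rfl⟩
  have hlow : ∀ u w : Fin n, n - 3 ≤ u.val → G.Adj (g' u) (g' w) → u.val = w.val + (n - 3) := by
    intro u w hu huw
    let i : Fin 3 := ⟨u - (n - 3), by omega⟩
    have hui : u = q (.inr i) := by
      apply Fin.ext
      simp [q, i]
      omega
    rw [hui, hg'] at huw
    have hwa : g' w = g' (q (.inl i)) := by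
      rw [hg']
      exact hpen i _ (Finset.mem_univ _) huw
    rw [hui, g'.injective hwa]
    simp [q]
  refine ⟨G.comap g', fun u w huw => ?_, ⟨(SimpleGraph.Iso.comap g' G).symm⟩⟩
  rw [SimpleGraph.comap_adj] at huw
  rw [ENgraph, SimpleGraph.fromRel_adj]
  refine ⟨by rintro rfl; exact G.irrefl huw, ?_⟩
  rcases lt_or_ge u.val (n - 3) with hu | hu
  · rcases lt_or_ge w.val (n - 3) with hw | hw
    · exact .inl (.inl ⟨hu, hw⟩)
    · exact .inl (.inr (hlow w u hw huw.symm))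
  · exact .inr (.inr (hlow u w hu huw))

end Conversion

theorem statement_7 {V : Type*} [Fintype V] [DecidableEq V] (G : SimpleGraph V)
    [DecidableRel G.Adj] (n : ℕ) (hn : 6 ≤ n) (hcard : Fintype.card V = n)
    (hconn : G.Connected) (hclaw : ClawFree G)
    (he : (G.edgeFinset.card : ℝ) ≥ (n : ℝ) * ((n : ℝ) - 9) / 2 + 21) :
    Traceable G ∨ ∃ H : SimpleGraph (Fin n), H ≤ ENgraph n ∧ Nonempty (G ≃g H) := by
  have hsum := codegSum_univ_add (G := G)
  rw [hcard] at hsum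
  have hc : codegSum G Finset.univ + 42 ≤ 8 * (Finset.univ : Finset V).card := by
    rw [Finset.card_univ, hcard]
    have hsum' : (codegSum G Finset.univ : ℝ) + 2 * G.edgeFinset.card + n = n * n := by
      exact_mod_cast hsum
    have : (codegSum G Finset.univ : ℝ) + 42 ≤ 8 * n := by linarith
    exact_mod_cast this
  have := hconn.nonempty
  exact (traceIn_or_netIn hclaw (connIn_univ hconn) hc).imp traceable_of_traceIn_univ
    (exists_iso_le_ENgraph hn hcard)
end

section
/- Let G be a 2-connected claw-free graph on n ≥ 12 vertices. If e(G) ≥ n(n−15)/2 + 57, then G is Hamiltonian, unless G is isomorphic to a spanning subgraph of EP_n or of EP'_n. -/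
open SimpleGraph

namespace SimpleGraph

variable {V : Type*} {G : SimpleGraph V}

/-- `G.PathList a b l`: the list `l` is the vertex list of a walk of `G` from `a` to `b`. -/
inductive PathList (G : SimpleGraph V) : V → V → List V → Prop
  | single (a : V) : PathList G a a [a]
  | cons {a b c : V} {l : List V} (h : G.Adj a b) (p : PathList G b c l) : PathList G a c (a :: l)

namespace PathList

variable {a b c d x : V} {l m : List V}

lemma append (p : G.PathList a b l) (h : G.Adj b c) (q : G.PathList c d m) :
    G.PathList a d (l ++ m) := by
  induction p with
  | single a => exact .cons h q
  | cons h' _ ih => exact .cons h' (ih h)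

lemma reverse (p : G.PathList a b l) : G.PathList b a l.reverse := by
  induction p with
  | single a => exact .single a
  | cons h _ ih =>
    rw [List.reverse_cons]
    exact ih.append h.symm (.single _)

lemma concat (p : G.PathList a b l) (h : G.Adj b c) : G.PathList a c (l ++ [c]) :=
  p.append h (.single c)

lemma left_mem (p : G.PathList a b l) : a ∈ l := by
  cases p <;> simp

lemma right_mem (p : G.PathList a b l) : b ∈ l := by
  induction p <;> simp_all

lemma ne_nil (p : G.PathList a b l) : l ≠ [] := List.ne_nil_of_mem p.left_mem

lemma exists_cons (p : G.PathList a b l) : ∃ t, l = a :: t := by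
  cases p <;> simp

lemma of_walk (p : G.Walk a b) : G.PathList a b p.support := by
  induction p with
  | nil => exact .single _
  | cons h _ ih => exact .cons h ih

lemma exists_walk (p : G.PathList a b l) : ∃ w : G.Walk a b, w.support = l := by
  induction p with
  | single a => exact ⟨.nil, rfl⟩
  | cons h _ ih =>
    obtain ⟨w, rfl⟩ := ih
    exact ⟨.cons h w, rfl⟩

lemma left_eq (p : G.PathList a b (x :: l)) : a = x := by
  cases p <;> rfl

/-- Split a path just before an inner vertex. -/
lemma split (p : G.PathList a b (l ++ x :: m)) (hl : l ≠ []) :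
    ∃ y, G.PathList a y l ∧ G.Adj y x ∧ G.PathList x b (x :: m) := by
  induction l generalizing a with
  | nil => exact absurd rfl hl
  | cons u t ih =>
    obtain _ | ⟨v, t⟩ := t
    · cases p with
      | cons h p =>
        obtain rfl := p.left_eq
        exact ⟨_, .single _, h, p⟩
    · cases p with
      | cons h p =>
        obtain ⟨y, h1, h2, h3⟩ := ih p (by simp)
        exact ⟨y, .cons h h1, h2, h3⟩

lemma eq_of_singleton (p : G.PathList a b [x]) : a = x ∧ b = x := by
  cases p with
  | single => simp
  | cons h p => exact absurd rfl p.ne_nil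

lemma right_eq (p : G.PathList a b (l ++ [x])) : b = x := by
  by_cases hl : l = []
  · subst hl; exact p.eq_of_singleton.2
  · obtain ⟨_, _, _, q⟩ := p.split hl
    exact q.eq_of_singleton.2

/-- Split a path at an inner vertex. -/
lemma split_inner (p : G.PathList a b l) (hx : x ∈ l) (ha : x ≠ a) (hb : x ≠ b) :
    ∃ l₁ l₂ y z, l = l₁ ++ x :: l₂ ∧ G.PathList a y l₁ ∧ G.Adj y x ∧ G.Adj x z ∧
      G.PathList z b l₂ := by
  obtain ⟨l₁, l₂, rfl⟩ := List.append_of_mem hx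
  have h1 : l₁ ≠ [] := by
    rintro rfl
    exact ha p.left_eq.symm
  obtain ⟨y, h2, h3, h4⟩ := p.split h1
  cases h4 with
  | single => exact absurd rfl hb
  | cons h q => exact ⟨l₁, l₂, y, _, rfl, h2, h3, h, q⟩

/-- Split a path after its last vertex satisfying `P`, when there is one and the end does not. -/
lemma split_last (P : V → Prop) (p : G.PathList a b l) (hex : ∃ v ∈ l, P v) (hb : ¬ P b) :
    ∃ l₁ l₂ y z, l = l₁ ++ l₂ ∧ G.PathList a y l₁ ∧ G.Adj y z ∧ G.PathList z b l₂ ∧ P y ∧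
      ∀ v ∈ l₂, ¬ P v := by
  induction p with
  | single a => simp_all
  | @cons a c b l h p ih =>
    by_cases h1 : ∃ v ∈ l, P v
    · obtain ⟨l₁, l₂, y, z, rfl, h2, h3, h4, h5, h6⟩ := ih h1 hb
      exact ⟨a :: l₁, l₂, y, z, rfl, .cons h h2, h3, h4, h5, h6⟩
    · push Not at h1
      refine ⟨[a], l, a, c, rfl, .single a, h, p, ?_, h1⟩
      obtain ⟨v, hv, hPv⟩ := hex
      rcases List.mem_cons.1 hv with rfl | hv
      · exact hPv
      · exact absurd hPv (h1 v hv)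

/-- A path between distinct vertices of a list of pairwise adjacent vertices. -/
lemma of_isClique {s : Set V} (hs : G.IsClique s) : ∀ {l : List V} {a : V}, (a :: l).Nodup →
    (∀ v ∈ a :: l, v ∈ s) → ∃ b, b ∈ s ∧ G.PathList a b (a :: l)
  | [], a, _, h => ⟨a, h a (by simp), .single a⟩
  | c :: l, a, hn, h => by
    obtain ⟨b, hb, p⟩ := of_isClique hs (List.nodup_cons.1 hn).2 fun v hv => h v (by simp_all)
    refine ⟨b, hb, .cons (hs (h a (by simp)) (h c (by simp)) ?_) p⟩
    rintro rfl
    simp at hn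

end PathList

lemma isHamiltonian_of_pathList [Fintype V] [DecidableEq V] {a b : V} {l : List V}
    (hV : 3 ≤ Fintype.card V) (p : G.PathList a b l) (hba : G.Adj b a) (hn : l.Nodup)
    (hl : ∀ v, v ∈ l) : G.IsHamiltonian := by
  intro _
  obtain ⟨w, rfl⟩ := p.exists_walk
  have hw : w.IsPath := Walk.IsPath.mk' hn
  have hlen : w.length + 1 = Fintype.card V := by
    rw [← Walk.length_support, ← List.toFinset_card_of_nodup hn, ← Finset.card_univ]
    congr 1
    ext v
    simp [hl v]
  refine ⟨b, .cons hba w, Walk.isHamiltonianCycle_iff_isCycle_and_length_eq.2 ⟨?_, by simpa⟩⟩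
  refine (Walk.cons_isCycle_iff _ _).2 ⟨hw, fun he => ?_⟩
  cases w with
  | nil => simp at hlen; omega
  | @cons _ c _ h w =>
    rw [Walk.cons_isPath_iff] at hw
    rw [Walk.edges_cons, List.mem_cons] at he
    rcases he with he | he
    · have hbc : b = c := by simpa [hba.ne] using he
      subst hbc
      have := (Walk.isPath_iff_nil.1 hw.1).length_eq_zero
      simp only [Walk.length_cons] at hlen
      omega
    · exact hw.2 (w.snd_mem_support_of_mem_edges he)

end SimpleGraph

lemma ClawFree.adj {V : Type*} {G : SimpleGraph V} (h : ClawFree G) {v a b c : V}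
    (ha : G.Adj v a) (hb : G.Adj v b) (hc : G.Adj v c) (hab : a ≠ b) (hac : a ≠ c) (hbc : b ≠ c) :
    G.Adj a b ∨ G.Adj a c ∨ G.Adj b c := by
  by_contra! hno
  exact h ⟨v, a, b, c, hab, hac, hbc, ha, hb, hc, hno⟩

namespace SimpleGraph

variable {V : Type*} {G : SimpleGraph V}

/-- The graph obtained from `G` by turning the neighbourhood of `x` into a clique. -/
def localCompletion (G : SimpleGraph V) (x : V) : SimpleGraph V where
  Adj u v := G.Adj u v ∨ (u ≠ v ∧ G.Adj x u ∧ G.Adj x v)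
  symm := ⟨fun _ _ h => h.imp (fun h => h.symm) fun h => ⟨h.1.symm, h.2.2, h.2.1⟩⟩
  loopless := ⟨fun u h => h.elim (G.loopless.irrefl u) fun h => h.1 rfl⟩

lemma localCompletion_adj {x u v : V} :
    (G.localCompletion x).Adj u v ↔ G.Adj u v ∨ (u ≠ v ∧ G.Adj x u ∧ G.Adj x v) := Iff.rfl

lemma le_localCompletion (x : V) : G ≤ G.localCompletion x := fun _ _ h => Or.inl h

lemma localCompletion_adj_self {x v : V} : (G.localCompletion x).Adj x v ↔ G.Adj x v := by
  simp [localCompletion_adj]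

lemma clawFree_localCompletion (hG : ClawFree G) (x : V) : ClawFree (G.localCompletion x) := by
  have key : ∀ v a b c : V, a ≠ b → a ≠ c → b ≠ c → G.Adj x v → G.Adj x a →
      (G.localCompletion x).Adj v b → (G.localCompletion x).Adj v c →
      ¬ (G.localCompletion x).Adj a b → ¬ (G.localCompletion x).Adj a c →
      ¬ (G.localCompletion x).Adj b c → False := by
    intro v a b c hab hac hbc hv ha hvb hvc nab nac nbc
    simp only [localCompletion_adj] at *
    have hxb : ¬ G.Adj x b := by tauto
    have hxc : ¬ G.Adj x c := by tauto
    have hxb' : x ≠ b := by rintro rfl; exact nab (.inl ha.symm)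
    have hxc' : x ≠ c := by rintro rfl; exact nac (.inl ha.symm)
    have := hG.adj hv.symm (hvb.resolve_right (by tauto)) (hvc.resolve_right (by tauto)) hxb' hxc'
      hbc
    tauto
  rintro ⟨v, a, b, c, hab, hac, hbc, ha, hb, hc, nab, nac, nbc⟩
  have sym : ∀ {p q}, ¬ (G.localCompletion x).Adj p q → ¬ (G.localCompletion x).Adj q p :=
    fun h h' => h h'.symm
  rcases id ha with ha' | ⟨-, hxv, hxa⟩
  · rcases id hb with hb' | ⟨-, hxv, hxb⟩
    · rcases id hc with hc' | ⟨-, hxv, hxc⟩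
      · rcases hG.adj ha' hb' hc' hab hac hbc with h | h | h
        exacts [nab (.inl h), nac (.inl h), nbc (.inl h)]
      · exact key v c a b hac.symm hbc.symm hab hxv hxc ha hb (sym nac) (sym nbc) nab
    · exact key v b a c hab.symm hbc hac hxv hxb ha hc (sym nab) nbc nac
  · exact key v a b c hab hac hbc hxv hxa hb hc nab nac nbc

/-- Up to reordering, `L` is the vertex list of a path both of whose ends are adjacent to `x`. -/
def Merged (G : SimpleGraph V) (x : V) (L : List V) : Prop :=
  ∃ l a b, G.PathList a b l ∧ G.Adj x a ∧ G.Adj x b ∧ l.Perm L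

namespace Merged

variable {x y y₁ y₂ a b a₁ b₁ a₂ b₂ : V} {l l₁ l₂ : List V}

lemma of_perm {L L' : List V} (h : G.Merged x L) (hL : L.Perm L') : G.Merged x L' := by
  obtain ⟨l, a, b, h1, h2, h3, h4⟩ := h
  exact ⟨l, a, b, h1, h2, h3, h4.trans hL⟩

lemma swap (h : G.Merged x (l₁ ++ l₂)) : G.Merged x (l₂ ++ l₁) := h.of_perm List.perm_append_comm

lemma join (P₁ : G.PathList a₁ b₁ l₁) (P₂ : G.PathList a₂ b₂ l₂) (hb₁ : G.Adj x b₁)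
    (hb₂ : G.Adj x b₂) (h : G.Adj a₁ a₂) : G.Merged x (l₁ ++ l₂) :=
  ⟨_, _, _, P₁.reverse.append h P₂, hb₁, hb₂, (List.reverse_perm _).append_right _⟩

lemma perm_inner {s t : List V} : (s ++ t ++ [y]).Perm (s ++ y :: t) := by
  classical
  rw [List.perm_iff_count]
  intro v
  simp only [List.count_append, List.count_cons, List.count_nil]
  omega

lemma adj_ends (hG : ClawFree G) (P₁ : G.PathList a₁ b₁ l₁) (P₂ : G.PathList a₂ b₂ l₂)
    (hn : (l₁ ++ l₂).Nodup) (ha₁ : G.Adj x a₁) (hb₁ : G.Adj x b₁) (ha₂ : G.Adj x a₂)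
    (hb₂ : G.Adj x b₂) (hne : a₁ ≠ b₁) : G.Merged x (l₁ ++ l₂) ∨ G.Adj a₁ b₁ := by
  have hd := List.disjoint_of_nodup_append hn
  have h1 : a₁ ≠ a₂ := fun h => hd P₁.left_mem (h ▸ P₂.left_mem)
  have h2 : b₁ ≠ a₂ := fun h => hd P₁.right_mem (h ▸ P₂.left_mem)
  rcases hG.adj ha₁ hb₁ ha₂ hne h1 h2 with h | h | h
  · exact .inr h
  · exact .inl (join P₁ P₂ hb₁ hb₂ h)
  · refine .inl ((join P₁.reverse P₂ ha₁ hb₂ h).of_perm ?_)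
    exact (List.reverse_perm _).append_right _

lemma of_adj_end (hG : ClawFree G) (P₁ : G.PathList a₁ b₁ l₁) (P₂ : G.PathList a₂ b₂ l₂)
    (hn : (l₁ ++ l₂).Nodup) (ha₁ : G.Adj x a₁) (hb₁ : G.Adj x b₁) (ha₂ : G.Adj x a₂)
    (hb₂ : G.Adj x b₂) (hy : G.Adj x y) (hyl : y ∈ l₁) (hya : G.Adj y a₂) :
    G.Merged x (l₁ ++ l₂) ∨ ∃ l, G.PathList a₁ b₁ l ∧ l₁.Perm (y :: l) := by
  by_cases h1 : y = a₁
  · exact .inl (join P₁ P₂ hb₁ hb₂ (h1 ▸ hya))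
  by_cases h2 : y = b₁
  · exact .inl ((join P₁.reverse P₂ ha₁ hb₂ (h2 ▸ hya)).of_perm
      ((List.reverse_perm _).append_right _))
  obtain ⟨s, t, u, v, rfl, Ps, huy, hyv, Pt⟩ := P₁.split_inner hyl h1 h2
  have hd := List.disjoint_of_nodup_append hn
  have hst := (List.nodup_append.1 hn).1
  have hst' : ∀ p ∈ s, ∀ q ∈ t, p ≠ q := fun p hp q hq =>
    (List.nodup_append.1 hst).2.2 p hp q (List.mem_cons_of_mem _ hq)
  have hab : a₁ ≠ b₁ := hst' _ Ps.left_mem _ Pt.right_mem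
  have huv : u ≠ v := hst' _ Ps.right_mem _ Pt.left_mem
  have hua : u ≠ a₂ := fun h => hd (by simp [Ps.right_mem]) (h ▸ P₂.left_mem)
  have hva : v ≠ a₂ := fun h => hd (by simp [Pt.left_mem]) (h ▸ P₂.left_mem)
  rcases adj_ends hG P₁ P₂ hn ha₁ hb₁ ha₂ hb₂ hab with h | hadj
  · exact .inl h
  rcases hG.adj huy.symm hyv hya huv hua hva with h | h | h
  · exact .inr ⟨s ++ t, Ps.append h Pt, List.perm_middle⟩
  · refine .inl ⟨_, _, _, (P₂.reverse.append h.symm (Ps.reverse.append hadj Pt.reverse)).concat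
      hyv.symm, hb₂, hy, ?_⟩
    refine List.Perm.trans ?_ List.perm_append_comm
    rw [List.append_assoc]
    refine (List.reverse_perm _).append (List.Perm.trans ?_ perm_inner)
    exact ((List.reverse_perm _).append (List.reverse_perm _)).append_right _
  · refine .inl ⟨_, _, _, (P₂.reverse.append h.symm (Pt.append hadj.symm Ps)).concat
      huy, hb₂, hy, ?_⟩
    refine List.Perm.trans ?_ List.perm_append_comm
    rw [List.append_assoc]
    refine (List.reverse_perm _).append (List.Perm.trans ?_ perm_inner)
    exact List.perm_append_comm.append_right _

lemma of_adj_ends_left (hG : ClawFree G) (P₁ : G.PathList a₁ b₁ l₁) (P₂ : G.PathList a₂ b₂ l₂)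
    (hn : (l₁ ++ l₂).Nodup) (ha₁ : G.Adj x a₁) (hb₁ : G.Adj x b₁) (ha₂ : G.Adj x a₂)
    (hb₂ : G.Adj x b₂) (hy : G.Adj x y) (hyl : y ∈ l₁) (hy₁ : G.Adj y a₁) (hy₂ : G.Adj y a₂) :
    G.Merged x (l₁ ++ l₂) := by
  rcases of_adj_end hG P₁ P₂ hn ha₁ hb₁ ha₂ hb₂ hy hyl hy₂ with h | ⟨l, P, hl⟩
  · exact h
  · refine (join (.cons hy₁ P) P₂ hb₁ hb₂ hy₂).of_perm ?_
    exact hl.symm.append_right _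

/-- Two paths with ends adjacent to `x` merge when the left ends have a common neighbour which is
adjacent to `x`. -/
lemma of_adj_ends (hG : ClawFree G) (P₁ : G.PathList a₁ b₁ l₁) (P₂ : G.PathList a₂ b₂ l₂)
    (hn : (l₁ ++ l₂).Nodup) (ha₁ : G.Adj x a₁) (hb₁ : G.Adj x b₁) (ha₂ : G.Adj x a₂)
    (hb₂ : G.Adj x b₂) (hy : G.Adj x y) (hyl : y ∈ l₁ ++ l₂) (hy₁ : G.Adj y a₁)
    (hy₂ : G.Adj y a₂) : G.Merged x (l₁ ++ l₂) := by
  rcases List.mem_append.1 hyl with h | h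
  · exact of_adj_ends_left hG P₁ P₂ hn ha₁ hb₁ ha₂ hb₂ hy h hy₁ hy₂
  · exact (of_adj_ends_left hG P₂ P₁ (List.nodup_append_comm.1 hn) ha₂ hb₂ ha₁ hb₁ hy h hy₂
      hy₁).swap

/-- Two paths with ends adjacent to `x` merge when their left ends are joined by a path of length
three through `y₁` and `y₂`, where `y₁` lies on the second path. -/
lemma of_adj_adj_of_mem (hG : ClawFree G) (P₁ : G.PathList a₁ b₁ l₁) (P₂ : G.PathList a₂ b₂ l₂)
    (hn : (l₁ ++ l₂).Nodup) (ha₁ : G.Adj x a₁) (hb₁ : G.Adj x b₁) (ha₂ : G.Adj x a₂)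
    (hb₂ : G.Adj x b₂) (hy₁ : G.Adj x y₁) (hy₂ : G.Adj x y₂) (hl₁ : y₁ ∈ l₂) (hl₂ : y₂ ∈ l₁ ++ l₂)
    (h₁ : G.Adj y₁ a₁) (h₁₂ : G.Adj y₁ y₂) (h₂ : G.Adj y₂ a₂) : G.Merged x (l₁ ++ l₂) := by
  rcases of_adj_end hG P₂ P₁ (List.nodup_append_comm.1 hn) ha₂ hb₂ ha₁ hb₁ hy₁ hl₁ h₁ with
    h | ⟨l, P, hl⟩
  · exact h.swap
  · have hp : (y₁ :: l₁ ++ l).Perm (l₁ ++ l₂) :=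
      List.Perm.trans List.perm_middle.symm (hl.symm.append_left _)
    exact (of_adj_ends hG (.cons h₁ P₁) P (hp.nodup_iff.2 hn) hy₁ hb₁ ha₂ hb₂ hy₂
      (hp.mem_iff.2 hl₂) h₁₂.symm h₂).of_perm hp

lemma of_adj_adj (hG : ClawFree G) (P₁ : G.PathList a₁ b₁ l₁) (P₂ : G.PathList a₂ b₂ l₂)
    (hn : (l₁ ++ l₂).Nodup) (ha₁ : G.Adj x a₁) (hb₁ : G.Adj x b₁) (ha₂ : G.Adj x a₂)
    (hb₂ : G.Adj x b₂) (hy₁ : G.Adj x y₁) (hy₂ : G.Adj x y₂) (hl₁ : y₁ ∈ l₁ ++ l₂)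
    (hl₂ : y₂ ∈ l₁ ++ l₂) (h₁ : G.Adj y₁ a₁) (h₁₂ : G.Adj y₁ y₂) (h₂ : G.Adj y₂ a₂) :
    G.Merged x (l₁ ++ l₂) := by
  by_cases hm₁ : y₁ ∈ l₂
  · exact of_adj_adj_of_mem hG P₁ P₂ hn ha₁ hb₁ ha₂ hb₂ hy₁ hy₂ hm₁ hl₂ h₁ h₁₂ h₂
  have hn' := List.nodup_append_comm.1 hn
  by_cases hm₂ : y₂ ∈ l₁
  · exact (of_adj_adj_of_mem hG P₂ P₁ hn' ha₂ hb₂ ha₁ hb₁ hy₂ hy₁ hm₂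
      (List.perm_append_comm.mem_iff.1 hl₁) h₂ h₁₂.symm h₁).swap
  replace hl₁ : y₁ ∈ l₁ := (List.mem_append.1 hl₁).resolve_right hm₁
  replace hl₂ : y₂ ∈ l₂ := (List.mem_append.1 hl₂).resolve_left hm₂
  have hr₁ : (l₁.reverse ++ l₂).Perm (l₁ ++ l₂) := (List.reverse_perm _).append_right _
  have hr₂ : (l₁ ++ l₂.reverse).Perm (l₁ ++ l₂) := (List.reverse_perm _).append_left _
  by_cases he₁ : y₁ = b₁
  · subst he₁
    exact (of_adj_ends hG P₁.reverse P₂ (hr₁.nodup_iff.2 hn) hb₁ ha₁ ha₂ hb₂ hy₂ (by simp [hl₂])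
      h₁₂.symm h₂).of_perm hr₁
  by_cases he₂ : y₂ = b₂
  · subst he₂
    exact (of_adj_ends hG P₁ P₂.reverse (hr₂.nodup_iff.2 hn) ha₁ hb₁ hb₂ ha₂ hy₁ (by simp [hl₁])
      h₁ h₁₂).of_perm hr₂
  obtain ⟨s₁, t₁, u₁, v₁, rfl, Ps₁, hu₁, hv₁, Pt₁⟩ := P₁.split_inner hl₁ h₁.ne he₁
  obtain ⟨s₂, t₂, u₂, v₂, rfl, Ps₂, hu₂, hv₂, Pt₂⟩ := P₂.split_inner hl₂ h₂.ne he₂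
  have disj : ∀ {s t : List V} {y : V}, (s ++ y :: t).Nodup → ∀ p ∈ s, ∀ q ∈ t, p ≠ q :=
    fun h p hp q hq => (List.nodup_append.1 h).2.2 p hp q (List.mem_cons_of_mem _ hq)
  have hst₁ := disj (List.nodup_append.1 hn).1
  have hst₂ := disj (List.nodup_append.1 hn).2.1
  rcases adj_ends hG P₁ P₂ hn ha₁ hb₁ ha₂ hb₂ (hst₁ _ Ps₁.left_mem _ Pt₁.right_mem) with
    h | hadj₁
  · exact h
  rcases adj_ends hG P₂ P₁ hn' ha₂ hb₂ ha₁ hb₁ (hst₂ _ Ps₂.left_mem _ Pt₂.right_mem) with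
    h | hadj₂
  · exact h.swap
  have hy₂u : u₁ ≠ y₂ := by rintro rfl; exact hm₂ (by simp [Ps₁.right_mem])
  have hy₂v : v₁ ≠ y₂ := by rintro rfl; exact hm₂ (by simp [Pt₁.left_mem])
  have hy₁u : u₂ ≠ y₁ := by rintro rfl; exact hm₁ (by simp [Ps₂.right_mem])
  have hy₁v : v₂ ≠ y₁ := by rintro rfl; exact hm₁ (by simp [Pt₂.left_mem])
  by_cases hc₁ : G.Adj u₁ v₁
  · have hp : (y₁ :: (s₁ ++ t₁) ++ (s₂ ++ y₂ :: t₂)).Perm (s₁ ++ y₁ :: t₁ ++ (s₂ ++ y₂ :: t₂)) :=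
      List.perm_middle.symm.append_right _
    exact (of_adj_ends hG (.cons h₁ (Ps₁.append hc₁ Pt₁)) P₂ (hp.nodup_iff.2 hn) hy₁ hb₁ ha₂ hb₂
      hy₂ (by simp) h₁₂.symm h₂).of_perm hp
  by_cases hc₂ : G.Adj u₂ v₂
  · have hp : (s₁ ++ y₁ :: t₁ ++ y₂ :: (s₂ ++ t₂)).Perm (s₁ ++ y₁ :: t₁ ++ (s₂ ++ y₂ :: t₂)) :=
      List.perm_middle.symm.append_left _
    exact (of_adj_ends hG P₁ (.cons h₂ (Ps₂.append hc₂ Pt₂)) (hp.nodup_iff.2 hn) ha₁ hb₁ hy₂ hb₂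
      hy₁ (by simp) h₁ h₁₂).of_perm hp
  obtain ⟨w, m, hw, Pm, hm⟩ : ∃ w m, G.Adj y₁ w ∧ G.PathList w y₂ m ∧ m.Perm (s₂ ++ y₂ :: t₂) := by
    rcases hG.adj hu₂.symm hv₂ h₁₂.symm (hst₂ _ Ps₂.right_mem _ Pt₂.left_mem) hy₁u hy₁v with
      h | h | h
    · exact absurd h hc₂
    · exact ⟨u₂, _, h.symm, (Ps₂.reverse.append hadj₂ Pt₂.reverse).concat hv₂.symm,
        (((List.reverse_perm _).append (List.reverse_perm _)).append_right _).trans perm_inner⟩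
    · exact ⟨v₂, _, h.symm, (Pt₂.append hadj₂.symm Ps₂).concat hu₂,
        (List.perm_append_comm.append_right _).trans perm_inner⟩
  have hperm : (s₁ ++ [y₁] ++ (m ++ t₁)).Perm (s₁ ++ y₁ :: t₁ ++ (s₂ ++ y₂ :: t₂)) := by
    rw [List.append_assoc, List.append_assoc]
    exact ((List.perm_append_comm.trans (hm.append_left t₁)).cons y₁).append_left s₁
  rcases hG.adj hu₁.symm hv₁ h₁₂ (hst₁ _ Ps₁.right_mem _ Pt₁.left_mem) hy₂u hy₂v with h | h | h
  · exact absurd h hc₁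
  · refine ⟨_, _, _, (Pt₁.reverse.concat hv₁.symm).append hw (Pm.append h.symm Ps₁.reverse), hb₁,
      ha₁, List.Perm.trans ?_ hperm⟩
    classical
    rw [List.perm_iff_count]
    intro v
    simp only [List.count_append, List.count_reverse]
    omega
  · exact ⟨_, _, _, (Ps₁.concat hu₁).append hw (Pm.append h.symm Pt₁), ha₁, hb₁, hperm⟩

/-- Two paths with ends adjacent to `x` merge when they cover the neighbourhood of `x` and this
neighbourhood contains an induced path on three vertices. -/
lemma of_diamond (hG : ClawFree G) {u v : V} (P₁ : G.PathList a₁ b₁ l₁)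
    (P₂ : G.PathList a₂ b₂ l₂) (hn : (l₁ ++ l₂).Nodup) (ha₁ : G.Adj x a₁) (hb₁ : G.Adj x b₁)
    (ha₂ : G.Adj x a₂) (hb₂ : G.Adj x b₂) (hcov : ∀ w, G.Adj x w → w ∈ l₁ ++ l₂)
    (hu : G.Adj x u) (hv : G.Adj x v) (hy : G.Adj x y) (huy : G.Adj u y) (hyv : G.Adj y v)
    (huv : u ≠ v) (hnuv : ¬ G.Adj u v) : G.Merged x (l₁ ++ l₂) := by
  by_contra hno
  have hd := List.disjoint_of_nodup_append hn
  have hne : a₁ ≠ a₂ := fun h => hd P₁.left_mem (h ▸ P₂.left_mem)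
  have hadj : ¬ G.Adj a₁ a₂ := fun h => hno (join P₁ P₂ hb₁ hb₂ h)
  have hnot : ∀ w, G.Adj x w → G.Adj w a₁ → G.Adj w a₂ → False := fun w hw h₁ h₂ =>
    hno (of_adj_ends hG P₁ P₂ hn ha₁ hb₁ ha₂ hb₂ hw (hcov w hw) h₁ h₂)
  have hnot₂ : ∀ w w', G.Adj x w → G.Adj x w' → G.Adj w a₁ → G.Adj w w' → G.Adj w' a₂ → False :=
    fun w w' hw hw' h₁ h h₂ => hno (of_adj_adj hG P₁ P₂ hn ha₁ hb₁ ha₂ hb₂ hw hw' (hcov w hw)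
      (hcov w' hw') h₁ h h₂)
  have hcross : ∀ w w', G.Adj x w → G.Adj x w' → (w = a₁ ∨ G.Adj w a₁) →
      (w' = a₂ ∨ G.Adj w' a₂) → ¬ G.Adj w w' := by
    rintro w w' hw hw' (rfl | h₁) (rfl | h₂) h
    · exact hadj h
    · exact hnot w' hw' h.symm h₂
    · exact hnot w hw h₁ h
    · exact hnot₂ w w' hw hw' h₁ h h₂
  have hside : ∀ w, G.Adj x w → (w = a₁ ∨ G.Adj w a₁) ∨ (w = a₂ ∨ G.Adj w a₂) := by
    intro w hw
    by_contra! h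
    rcases hG.adj hw ha₁ ha₂ h.1.1 h.2.1 hne with h' | h' | h'
    exacts [h.1.2 h', h.2.2 h', hadj h']
  have hclq : ∀ {c c' : V}, G.Adj x c → G.Adj x c' → c ≠ c' → ¬ G.Adj c c' →
      (∀ w, G.Adj x w → G.Adj w c → G.Adj w c' → False) →
      (u = c ∨ G.Adj u c) → (v = c ∨ G.Adj v c) → False := by
    intro c c' hc hc' hcc hncc hw hu' hv'
    have hu₁ : G.Adj u c := hu'.resolve_left fun h => hnuv (h ▸ (hv'.resolve_left
      fun h' => huv (h.trans h'.symm)).symm)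
    have hv₁ : G.Adj v c := hv'.resolve_left fun h => hnuv (h ▸ hu₁)
    have huc : u ≠ c' := by rintro rfl; exact hncc hu₁.symm
    have hvc : v ≠ c' := by rintro rfl; exact hncc hv₁.symm
    rcases hG.adj hu hv hc' huv huc hvc with h | h | h
    exacts [hnuv h, hw u hu hu₁ h, hw v hv hv₁ h]
  rcases hside u hu with hu' | hu' <;> rcases hside v hv with hv' | hv'
  · exact hclq ha₁ ha₂ hne hadj hnot hu' hv'
  · rcases hside y hy with hy' | hy'
    · exact hcross y v hy hv hy' hv' hyv
    · exact hcross u y hu hy hu' hy' huy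
  · rcases hside y hy with hy' | hy'
    · exact hcross y u hy hu hy' hu' huy.symm
    · exact hcross v y hv hy hv' hy' hyv.symm
  · exact hclq ha₂ ha₁ hne.symm (fun h => hadj h.symm) (fun w hw h h' => hnot w hw h' h) hu' hv'

lemma of_flatten (hG : ClawFree G) {u v : V} (hu : G.Adj x u) (hv : G.Adj x v) (hy : G.Adj x y)
    (huy : G.Adj u y) (hyv : G.Adj y v) (huv : u ≠ v) (hnuv : ¬ G.Adj u v) :
    ∀ (n : ℕ) (L : List (List V)), L.length = n → L ≠ [] →
      (∀ l ∈ L, ∃ a b, G.PathList a b l ∧ G.Adj x a ∧ G.Adj x b) → L.flatten.Nodup →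
      (∀ w, G.Adj x w → w ∈ L.flatten) → G.Merged x L.flatten
  | _, [], _, hL, _, _, _ => absurd rfl hL
  | _, [l], _, _, h, _, _ => by
    obtain ⟨a, b, hP, ha, hb⟩ := h l (by simp)
    exact ⟨l, a, b, hP, ha, hb, by simp⟩
  | _, [l₁, l₂], _, _, h, hn, hcov => by
    obtain ⟨a₁, b₁, P₁, ha₁, hb₁⟩ := h l₁ (by simp)
    obtain ⟨a₂, b₂, P₂, ha₂, hb₂⟩ := h l₂ (by simp)
    have he : [l₁, l₂].flatten = l₁ ++ l₂ := by simp
    rw [he] at hn hcov ⊢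
    exact of_diamond hG P₁ P₂ hn ha₁ hb₁ ha₂ hb₂ hcov hu hv hy huy hyv huv hnuv
  | 0, _ :: _ :: _ :: _, hlen, _, _, _, _ => by simp at hlen
  | n + 1, l₁ :: l₂ :: l₃ :: T, hlen, _, h, hn, hcov => by
    obtain ⟨a₁, b₁, P₁, ha₁, hb₁⟩ := h l₁ (by simp)
    obtain ⟨a₂, b₂, P₂, ha₂, hb₂⟩ := h l₂ (by simp)
    obtain ⟨a₃, b₃, P₃, ha₃, hb₃⟩ := h l₃ (by simp)
    have step : ∀ l m, (∃ a b, G.PathList a b m ∧ G.Adj x a ∧ G.Adj x b) → G.Merged x l →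
        (l ++ m).Perm (l₁ ++ (l₂ ++ l₃)) → G.Merged x (l₁ :: l₂ :: l₃ :: T).flatten := by
      rintro l m hm ⟨l', a, b, P, ha, hb, hl'⟩ hp
      have hperm : (l' :: m :: T).flatten.Perm (l₁ :: l₂ :: l₃ :: T).flatten := by
        have := ((hl'.append_right m).trans hp).append_right T.flatten
        simpa using this
      refine of_perm (of_flatten hG hu hv hy huy hyv huv hnuv n _ (by simpa using hlen) (by simp)
        ?_ (hperm.nodup_iff.2 hn) fun w hw => hperm.mem_iff.2 (hcov w hw)) hperm
      intro k hk
      rcases List.mem_cons.1 hk with rfl | hk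
      · exact ⟨a, b, P, ha, hb⟩
      rcases List.mem_cons.1 hk with rfl | hk
      · exact hm
      · exact h k (by simp [hk])
    have hne : ∀ {k m : List V} {p q : V}, (k ++ m).Nodup → p ∈ k → q ∈ m → p ≠ q :=
      fun h hp hq => (List.nodup_append.1 h).2.2 _ hp _ hq
    have hn' : (l₁ ++ (l₂ ++ (l₃ ++ T.flatten))).Nodup := by simpa using hn
    have h12 : a₁ ≠ a₂ := hne hn' P₁.left_mem (by simp [P₂.left_mem])
    have h13 : a₁ ≠ a₃ := hne hn' P₁.left_mem (by simp [P₃.left_mem])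
    have h23 : a₂ ≠ a₃ := hne (List.nodup_append.1 hn').2.1 P₂.left_mem (by simp [P₃.left_mem])
    rcases hG.adj ha₁ ha₂ ha₃ h12 h13 h23 with h' | h' | h'
    · exact step _ l₃ ⟨_, _, P₃, ha₃, hb₃⟩ (join P₁ P₂ hb₁ hb₂ h') (by simp)
    · refine step _ l₂ ⟨_, _, P₂, ha₂, hb₂⟩ (join P₁ P₃ hb₁ hb₃ h') ?_
      rw [List.append_assoc]
      exact List.perm_append_comm.append_left _
    · exact step _ l₁ ⟨_, _, P₁, ha₁, hb₁⟩ (join P₂ P₃ hb₂ hb₃ h') List.perm_append_comm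

end Merged

/-- A path in the local completion at `x` which avoids `x` splits into paths of `G` whose ends are
adjacent to `x`. -/
lemma PathList.exists_flatten {x a b : V} {l : List V} (p : (G.localCompletion x).PathList a b l)
    (hb : G.Adj x b) : ∃ (l' : List V) (L : List (List V)), l = l' ++ L.flatten ∧
      (∃ c, G.PathList a c l' ∧ G.Adj x c) ∧
      ∀ m ∈ L, ∃ a b, G.PathList a b m ∧ G.Adj x a ∧ G.Adj x b := by
  induction p with
  | single a => exact ⟨[a], [], by simp, ⟨a, .single a, hb⟩, by simp⟩
  | @cons a d b l h p ih =>
    obtain ⟨l', L, rfl, ⟨c, hc, hxc⟩, hL⟩ := ih hb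
    rcases h with h | ⟨-, ha, hd⟩
    · exact ⟨a :: l', L, rfl, ⟨c, .cons h hc, hxc⟩, hL⟩
    · refine ⟨[a], l' :: L, by simp, ⟨a, .single a, ha⟩, ?_⟩
      intro m hm
      rcases List.mem_cons.1 hm with rfl | hm
      · exact ⟨d, c, hc, hd, hxc⟩
      · exact hL m hm

/-- Local completion at a vertex lying in an induced diamond preserves non-Hamiltonicity. -/
lemma isHamiltonian_of_localCompletion [Fintype V] [DecidableEq V] (hG : ClawFree G)
    {x y u v : V} (hV : 3 ≤ Fintype.card V) (hu : G.Adj x u) (hv : G.Adj x v) (hy : G.Adj x y)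
    (huy : G.Adj u y) (hyv : G.Adj y v) (huv : u ≠ v) (hnuv : ¬ G.Adj u v)
    (hH : (G.localCompletion x).IsHamiltonian) : G.IsHamiltonian := by
  have : Nontrivial V := ⟨u, v, huv⟩
  obtain ⟨p, hp⟩ := hH.exists_isHamiltonianCycle x
  have hlen := hp.length_eq
  have hcount := (Walk.isHamiltonianCycle_iff_isCycle_and_support_count_tail_eq_one.1 hp).2
  cases p with
  | nil => simp at hlen; omega
  | @cons _ b _ h w =>
    simp only [Walk.support_cons, List.tail_cons] at hcount
    obtain ⟨m, hm⟩ : ∃ m, w.support = m ++ [x] :=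
      ⟨w.support.dropLast, by
        conv_lhs => rw [← List.dropLast_append_getLast w.support_ne_nil, Walk.getLast_support]⟩
    have hw : (G.localCompletion x).PathList b x (m ++ [x]) := hm ▸ .of_walk w
    have hmne : m ≠ [] := by
      rintro rfl
      have := hw.left_eq
      simp [this] at h
    obtain ⟨z, hbm, hzx, -⟩ := hw.split hmne
    rw [hm] at hcount
    rw [localCompletion_adj_self] at h
    have hz : G.Adj x z := localCompletion_adj_self.1 hzx.symm
    obtain ⟨l', L, rfl, ⟨c, hl', hc⟩, hL⟩ := hbm.exists_flatten hz
    have hnd : (l' ++ L.flatten ++ [x]).Nodup :=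
      List.nodup_iff_count_le_one.2 fun a => (hcount a).le
    have hmem : ∀ a, a ∈ l' ++ L.flatten ++ [x] := fun a =>
      List.count_pos_iff.1 (by rw [hcount a]; exact one_pos)
    obtain ⟨k, s, t, P, hs, ht, hk⟩ := Merged.of_flatten hG hu hv hy huy hyv huv hnuv _ (l' :: L)
      rfl (by simp) (by
        intro k hk
        rcases List.mem_cons.1 hk with rfl | hk
        · exact ⟨b, c, hl', h, hc⟩
        · exact hL k hk) (by simpa using (List.nodup_append.1 hnd).1) (by
        intro w hw
        have := hmem w
        simpa [hw.ne.symm] using this)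
    have hperm : (x :: k).Perm (l' ++ L.flatten ++ [x]) :=
      (hk.cons x).trans (by
        simpa using (List.perm_append_singleton x (l' ++ L.flatten)).symm)
    exact isHamiltonian_of_pathList hV (.cons hs P) ht.symm (hperm.nodup_iff.2 hnd)
      fun a => hperm.mem_iff.2 (hmem a)

end SimpleGraph

namespace SimpleGraph

variable {V : Type*} {G : SimpleGraph V}

/-- `G` has no induced `K₄⁻`: two common neighbours of adjacent vertices are adjacent. -/
def DiamondFree (G : SimpleGraph V) : Prop :=
  ∀ ⦃x y u v : V⦄, G.Adj x y → G.Adj x u → G.Adj x v → G.Adj y u → G.Adj y v → u ≠ v → G.Adj u v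

/-- The number of edges at a set `S` all of whose outer neighbours are `x` or in `R`. -/
lemma sum_degree_le_of_neighbors [Fintype V] [DecidableEq V] [DecidableRel G.Adj] {x : V}
    {S R : Finset V} {k : ℕ} (hxS : x ∉ S) (hk : ∀ z ∈ R, (S.filter (G.Adj z)).card ≤ k)
    (hS : ∀ v ∈ S, ∀ w, G.Adj v w → w = x ∨ w ∈ S ∨ w ∈ R) :
    ∑ v ∈ S, G.degree v ≤ S.card * S.card + R.card * k := by
  have h1 : ∀ v ∈ S, G.degree v ≤ S.card + (R.filter (G.Adj v)).card := by
    intro v hv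
    rw [← G.card_neighborFinset_eq_degree]
    have hsub : G.neighborFinset v ⊆ (insert x S).erase v ∪ R.filter (G.Adj v) := by
      intro w hw
      rw [mem_neighborFinset] at hw
      simp only [Finset.mem_union, Finset.mem_erase, Finset.mem_insert, Finset.mem_filter]
      rcases hS v hv w hw with h | h | h
      exacts [.inl ⟨hw.ne.symm, .inl h⟩, .inl ⟨hw.ne.symm, .inr h⟩, .inr ⟨h, hw⟩]
    refine (Finset.card_le_card hsub).trans ((Finset.card_union_le _ _).trans ?_)
    rw [Finset.card_erase_of_mem (Finset.mem_insert_of_mem hv), Finset.card_insert_of_notMem hxS]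
    simp
  have h2 : ∑ v ∈ S, (R.filter (G.Adj v)).card = ∑ z ∈ R, (S.filter (G.Adj z)).card := by
    have := Finset.sum_card_bipartiteAbove_eq_sum_card_bipartiteBelow (s := S) (t := R) G.Adj
    simp only [Finset.bipartiteAbove, Finset.bipartiteBelow] at this
    simpa only [G.adj_comm] using this
  calc ∑ v ∈ S, G.degree v ≤ ∑ v ∈ S, (S.card + (R.filter (G.Adj v)).card) :=
        Finset.sum_le_sum h1
    _ = S.card * S.card + ∑ z ∈ R, (S.filter (G.Adj z)).card := by
        rw [Finset.sum_add_distrib, h2, Finset.sum_const, smul_eq_mul]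
    _ ≤ S.card * S.card + R.card * k := by
        gcongr
        exact Finset.sum_le_card_nsmul _ _ _ hk

/-- In a claw-free and diamond-free graph every non-isolated vertex is in one or two
maximal cliques, which cover its neighbourhood; this bounds the number of edges. -/
lemma DiamondFree.exists_sum_degree_le [Fintype V] [DecidableEq V] [DecidableRel G.Adj]
    (hD : G.DiamondFree) (hG : ClawFree G) {x u : V} (hxu : G.Adj x u) :
    ∃ (A B : Finset V) (r : ℕ), x ∉ A ∧ x ∉ B ∧ G.IsClique (insert x A : Finset V) ∧
      G.IsClique (insert x B : Finset V) ∧ 1 ≤ A.card ∧ A.card + B.card = G.degree x ∧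
      A.card + B.card + r + 1 = Fintype.card V ∧
      ∑ v, G.degree v ≤ A.card * (A.card + 1) + B.card * (B.card + 1) + r * (r + 1) +
        2 * (r * min 1 B.card) := by
  obtain ⟨A, hA⟩ : ∃ S, S = (G.neighborFinset x).filter fun w => w = u ∨ G.Adj w u := ⟨_, rfl⟩
  obtain ⟨B, hB⟩ : ∃ S, S = (G.neighborFinset x).filter fun w => ¬ (w = u ∨ G.Adj w u) := ⟨_, rfl⟩
  obtain ⟨R, hR⟩ : ∃ S, S = Finset.univ.filter fun w => w ≠ x ∧ ¬ G.Adj x w := ⟨_, rfl⟩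
  have memA : ∀ {w}, w ∈ A ↔ G.Adj x w ∧ (w = u ∨ G.Adj w u) := by simp [hA]
  have memB : ∀ {w}, w ∈ B ↔ G.Adj x w ∧ w ≠ u ∧ ¬ G.Adj w u := by simp [hB]
  have memR : ∀ {w}, w ∈ R ↔ w ≠ x ∧ ¬ G.Adj x w := by simp [hR]
  have cA : ∀ {v w}, v ∈ A → w ∈ A → v ≠ w → G.Adj v w := by
    intro v w hv hw hvw
    rw [memA] at hv hw
    rcases hv.2 with rfl | hv'
    · exact (hw.2.resolve_left hvw.symm).symm
    rcases hw.2 with rfl | hw'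
    · exact hv'
    exact hD hxu hv.1 hw.1 hv'.symm hw'.symm hvw
  have cB : ∀ {v w}, v ∈ B → w ∈ B → v ≠ w → G.Adj v w := by
    intro v w hv hw hvw
    rw [memB] at hv hw
    rcases hG.adj hv.1 hw.1 hxu hvw hv.2.1 hw.2.1 with h | h | h
    exacts [h, absurd h hv.2.2, absurd h hw.2.2]
  have nAB : ∀ {v w}, v ∈ A → w ∈ B → ¬ G.Adj v w := by
    intro v w hv hw hvw
    rw [memA] at hv
    rw [memB] at hw
    rcases hv.2 with rfl | hv'
    · exact hw.2.2 hvw.symm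
    · exact hw.2.2 (hD hv.1 hw.1 hxu hvw hv' hw.2.1)
  have uniq : ∀ {v w z}, G.Adj x v → G.Adj x w → G.Adj v w → z ∈ R → G.Adj z v → G.Adj z w →
      False := by
    intro v w z hv hw hvw hz hzv hzw
    rw [memR] at hz
    exact hz.2 (hD hvw hv.symm hzv.symm hw.symm hzw.symm hz.1.symm)
  have dA : ∀ z ∈ R, (A.filter (G.Adj z)).card ≤ 1 := by
    refine fun z hz => Finset.card_le_one.2 fun v hv w hw => ?_
    rw [Finset.mem_filter] at hv hw
    by_contra hvw
    exact uniq (memA.1 hv.1).1 (memA.1 hw.1).1 (cA hv.1 hw.1 hvw) hz hv.2 hw.2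
  have dB : ∀ z ∈ R, (B.filter (G.Adj z)).card ≤ min 1 B.card := by
    refine fun z hz => le_min (Finset.card_le_one.2 fun v hv w hw => ?_) (Finset.card_filter_le _ _)
    rw [Finset.mem_filter] at hv hw
    by_contra hvw
    exact uniq (memB.1 hv.1).1 (memB.1 hw.1).1 (cB hv.1 hw.1 hvw) hz hv.2 hw.2
  have hxA : x ∉ A := fun h => (memA.1 h).1.ne rfl
  have hxB : x ∉ B := fun h => (memB.1 h).1.ne rfl
  have hdeg : A.card + B.card = G.degree x := by
    rw [← G.card_neighborFinset_eq_degree, hA, hB, Finset.card_filter_add_card_filter_not]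
  have hsum : ∀ f : V → ℕ, ∑ v, f v = f x + ∑ v ∈ A, f v + ∑ v ∈ B, f v + ∑ v ∈ R, f v := by
    intro f
    have hAB : Disjoint A B := hA ▸ hB ▸ Finset.disjoint_filter_filter_not _ _ _
    have hABR : Disjoint (A ∪ B) R := Finset.disjoint_left.2 fun v hv hv' => by
      rw [Finset.mem_union, memA, memB] at hv
      rw [memR] at hv'
      tauto
    have hx : x ∉ A ∪ B ∪ R := by simp [memA, memB, memR]
    have huniv : Finset.univ = insert x (A ∪ B ∪ R) := by
      ext v
      simp only [Finset.mem_univ, Finset.mem_insert, Finset.mem_union, memA, memB, memR, true_iff]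
      tauto
    rw [huniv, Finset.sum_insert hx, Finset.sum_union hABR, Finset.sum_union hAB]
    ring
  have hcard : A.card + B.card + R.card + 1 = Fintype.card V := by
    have := hsum fun _ => 1
    simp only [Finset.sum_const, smul_eq_mul, mul_one, Finset.card_univ] at this
    omega
  have hins : ∀ {S : Finset V}, (∀ w ∈ S, G.Adj x w) → (∀ {v w}, v ∈ S → w ∈ S → v ≠ w →
      G.Adj v w) → G.IsClique (insert x S : Finset V) := by
    intro S hS cS
    rw [Finset.coe_insert]
    exact isClique_insert.2 ⟨fun v hv w hw => cS hv hw, fun w hw _ => hS w hw⟩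
  have hother : ∀ w, w = x ∨ w ∈ A ∨ w ∈ B ∨ w ∈ R := by
    intro w
    rw [memA, memB, memR]
    tauto
  have hsA := sum_degree_le_of_neighbors hxA dA fun v hv w hvw => by
    have : w ∉ B := fun h => nAB hv h hvw
    simpa only [this, false_or] using hother w
  have hsB := sum_degree_le_of_neighbors hxB dB fun v hv w hvw => by
    have : w ∉ A := fun h => nAB h hv hvw.symm
    simpa only [this, false_or] using hother w
  have hsR : ∑ v ∈ R, G.degree v ≤ R.card * (R.card + min 1 B.card) := by
    refine Finset.sum_le_card_nsmul _ _ _ fun z hz => ?_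
    rw [← G.card_neighborFinset_eq_degree]
    have hsub : G.neighborFinset z ⊆ A.filter (G.Adj z) ∪ B.filter (G.Adj z) ∪ R.erase z := by
      intro w hw
      rw [mem_neighborFinset] at hw
      simp only [Finset.mem_union, Finset.mem_erase, Finset.mem_filter]
      have hwx : w ≠ x := by
        rintro rfl
        exact (memR.1 hz).2 hw.symm
      rcases hother w with h | h | h | h
      exacts [absurd h hwx, .inl (.inl ⟨h, hw⟩), .inl (.inr ⟨h, hw⟩), .inr ⟨hw.ne.symm, h⟩]
    refine (Finset.card_le_card hsub).trans ((Finset.card_union_le _ _).trans ?_)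
    have h1 := Finset.card_union_le (A.filter (G.Adj z)) (B.filter (G.Adj z))
    have h2 := dA z hz
    have h3 := dB z hz
    have h4 := Finset.card_erase_add_one hz
    omega
  refine ⟨A, B, R.card, hxA, hxB, hins (fun w hw => (memA.1 hw).1) cA,
    hins (fun w hw => (memB.1 hw).1) cB,
    Finset.card_pos.2 ⟨u, memA.2 ⟨hxu, .inl rfl⟩⟩, hdeg, hcard, ?_⟩
  rw [hsum, ← hdeg]
  linarith

/-- A dense claw-free and diamond-free graph has a clique missing at most six vertices. -/
lemma DiamondFree.exists_isClique [Fintype V] [DecidableEq V] [DecidableRel G.Adj]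
    (hD : G.DiamondFree) (hG : ClawFree G) {n : ℕ} (hn : 12 ≤ n) (hV : Fintype.card V = n)
    (hE : n * n + 114 ≤ ∑ v, G.degree v + 15 * n) :
    ∃ K : Finset V, G.IsClique K ∧ n ≤ K.card + 6 := by
  have : Nonempty V := Fintype.card_pos_iff.1 (by omega)
  obtain ⟨x, hx⟩ := G.exists_maximal_degree_vertex
  have hmax : ∑ v, G.degree v ≤ n * G.degree x := by
    rw [← hV, ← Finset.card_univ]
    exact Finset.sum_le_card_nsmul _ _ _ fun v _ => hx ▸ G.degree_le_maxDegree v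
  have hpos : G.degree x ≠ 0 := by
    intro h
    rw [h] at hmax
    nlinarith only [hmax, hE, sq_nonneg (n : ℤ), hn]
  obtain ⟨u, hxu⟩ := (G.degree_pos_iff_exists_adj x).1 (Nat.pos_of_ne_zero hpos)
  obtain ⟨A, B, r, hxA, hxB, cA, cB, hp, hdeg, hcard, hsum⟩ := hD.exists_sum_degree_le hG hxu
  by_contra! hno
  have hA := hno _ cA
  have hB := hno _ cB
  rw [Finset.card_insert_of_notMem hxA] at hA
  rw [Finset.card_insert_of_notMem hxB] at hB
  rw [← hdeg] at hmax
  generalize ∑ v, G.degree v = e at *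
  generalize A.card = p at *
  generalize B.card = q at *
  rw [hV] at hcard
  have hmin : r * min 1 q ≤ r * q := Nat.mul_le_mul_left _ (min_le_right _ _)
  have hmin' : r * min 1 q ≤ r * 1 := Nat.mul_le_mul_left _ (min_le_left _ _)
  have hlt : ∀ s t : ℕ, 7 ≤ s → 7 ≤ t → s + t + 1 = n →
      e ≤ s * (s + 1) + t * (t + 1) → False := by
    intro s t hs ht hst he
    subst hst
    obtain ⟨s, rfl⟩ := Nat.exists_eq_add_of_le hs
    obtain ⟨t, rfl⟩ := Nat.exists_eq_add_of_le ht
    nlinarith only [hE, he, Nat.zero_le (s * t)]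
  rcases le_or_gt 7 p with h7 | h7
  · exact hlt p (q + r) h7 (by omega) (by omega) (by linarith only [hsum, hmin])
  rcases le_or_gt 7 q with h7' | h7'
  · refine hlt q (p + r) h7' (by omega) (by omega) ?_
    have := Nat.mul_le_mul_left r hp
    linarith only [hsum, hmin', this]
  have hn' : n < 22 := by
    have : n * (p + q) ≤ n * 12 := Nat.mul_le_mul_left _ (by omega)
    nlinarith only [hE, hmax, this]
  have hfin : ∀ n < 22, ∀ p < 7, ∀ q < 7,
      ¬ (12 ≤ n ∧ 1 ≤ p ∧ p + 8 ≤ n ∧ q + 8 ≤ n ∧ n * n + 114 ≤ n * (p + q) + 15 * n ∧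
        n * n + 114 ≤ p * (p + 1) + q * (q + 1) + (n - 1 - p - q) * (n - 1 - p - q + 1) +
          2 * ((n - 1 - p - q) * min 1 q) + 15 * n) := by
    decide +kernel
  obtain rfl : r = n - 1 - p - q := by omega
  exact hfin n hn' p h7 q h7' ⟨hn, hp, by omega, by omega, by omega, by omega⟩

end SimpleGraph

namespace SimpleGraph

variable {V : Type*} {G : SimpleGraph V}

namespace PathList

/-- A path through a whole clique with prescribed distinct ends. -/
lemma of_isClique_of_ends {s : Set V} (hs : G.IsClique s) {a b : V} {l : List V}
    (hn : (a :: l ++ [b]).Nodup) (h : ∀ v ∈ a :: l ++ [b], v ∈ s) :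
    G.PathList a b (a :: l ++ [b]) := by
  obtain ⟨c, -, p⟩ := of_isClique hs hn h
  obtain rfl : c = b := p.right_eq (l := a :: l)
  exact p

lemma uncons {a b c : V} {l : List V} (p : G.PathList a b (c :: l)) (hl : l ≠ []) :
    ∃ d, G.Adj c d ∧ G.PathList d b l := by
  cases p with
  | single => exact absurd rfl hl
  | cons h p => exact ⟨_, h, p⟩

/-- Rotate a cycle so that it starts at a given vertex. -/
lemma rotate {a b c : V} {l : List V} (p : G.PathList a b l) (hba : G.Adj b a) (hc : c ∈ l) :
    ∃ t m, G.PathList c t (c :: m) ∧ G.Adj t c ∧ (c :: m).Perm l := by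
  obtain ⟨l₁, l₂, rfl⟩ := List.append_of_mem hc
  by_cases h : l₁ = []
  · subst h
    obtain rfl := p.left_eq
    exact ⟨b, l₂, p, hba, .refl _⟩
  · obtain ⟨y, h1, h2, h3⟩ := p.split h
    exact ⟨y, l₂ ++ l₁, h3.append hba h1, h2, List.perm_append_comm (l₁ := c :: l₂)⟩

end PathList

lemma _root_.TwoConnected.exists_pathList [Fintype V] (h : TwoConnected G) {a b v : V} (ha : a ≠ v)
    (hb : b ≠ v) : ∃ l, G.PathList a b l ∧ l.Nodup ∧ v ∉ l := by
  classical
  obtain ⟨w, hw⟩ := ((h.2 v).preconnected ⟨a, ha⟩ ⟨b, hb⟩).exists_isPath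
  refine ⟨w.support.map Subtype.val, ?_, hw.support_nodup.map Subtype.val_injective, by simp⟩
  have := PathList.of_walk (w.map (Embedding.induce ({v}ᶜ : Set V)).toHom)
  rwa [Walk.support_map] at this

/-- In a 2-connected graph, every proper subset with two elements has an ear. -/
lemma _root_.TwoConnected.exists_ear [Fintype V] (h : TwoConnected G) {C : Set V} {a b x : V}
    (ha : a ∈ C) (hb : b ∈ C) (hab : a ≠ b) (hx : x ∉ C) :
    ∃ c ∈ C, ∃ d ∈ C, c ≠ d ∧ ∃ z z' Q, G.PathList z z' Q ∧ Q.Nodup ∧ (∀ v ∈ Q, v ∉ C) ∧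
      G.Adj c z ∧ G.Adj z' d := by
  obtain ⟨l, p, -, -⟩ := h.exists_pathList (a := x) (b := b) (v := a) (by rintro rfl; exact hx ha)
    hab.symm
  obtain ⟨-, l', y, c, -, -, hyc, p', hy, hl'⟩ :=
    p.split_last (· ∉ C) ⟨x, p.left_mem, hx⟩ (not_not.2 hb)
  have hc : c ∈ C := not_not.1 (hl' c p'.left_mem)
  obtain ⟨d₀, hd₀, hd₀c⟩ : ∃ d ∈ C, d ≠ c := by
    by_cases hac : a = c
    · exact ⟨b, hb, hac ▸ hab.symm⟩
    · exact ⟨a, ha, hac⟩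
  obtain ⟨l, p, hn, hcl⟩ := h.exists_pathList hd₀c hyc.ne
  obtain ⟨l₁, l₂, d, z, rfl, p₁, hdz, p₂, hd, hl₂⟩ :=
    p.split_last (· ∈ C) ⟨d₀, p.left_mem, hd₀⟩ hy
  refine ⟨c, hc, d, hd, ?_, y, z, l₂.reverse, p₂.reverse, ?_, fun v hv => hl₂ v (by simpa using hv),
    hyc.symm, hdz.symm⟩
  · rintro rfl
    exact hcl (by simp [p₁.right_mem])
  · exact List.nodup_reverse.2 (List.nodup_append.1 hn).2.1

/-- `K` is a clique missing at most six vertices of the non-Hamiltonian claw-free graph `G`, and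
no vertex outside `K` has two neighbours in `K`. -/
structure IsBigClique [Fintype V] [DecidableEq V] (G : SimpleGraph V) (K : Finset V) : Prop where
  clawFree : ClawFree G
  isClique : G.IsClique K
  six_le : 6 ≤ K.card
  card_le : Fintype.card V ≤ K.card + 6
  unique : ∀ ⦃w a b⦄, w ∉ K → a ∈ K → b ∈ K → G.Adj w a → G.Adj w b → a = b
  not_isHamiltonian : ¬ G.IsHamiltonian

namespace IsBigClique

variable [Fintype V] [DecidableEq V] {K : Finset V}

lemma adj (h : G.IsBigClique K) {a b : V} (ha : a ∈ K) (hb : b ∈ K) (hab : a ≠ b) : G.Adj a b :=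
  h.isClique ha hb hab

/-- The neighbours outside `K` of a vertex of `K` are pairwise adjacent. -/
lemma adj_of_notMem (h : G.IsBigClique K) {a v w : V} (ha : a ∈ K) (hv : v ∉ K) (hw : w ∉ K)
    (hav : G.Adj a v) (haw : G.Adj a w) (hvw : v ≠ w) : G.Adj v w := by
  obtain ⟨k, hk, hka⟩ := Finset.exists_mem_ne (lt_of_lt_of_le (by simp) h.six_le) a
  rcases h.clawFree.adj hav haw (h.adj ha hk hka.symm) hvw (by rintro rfl; exact hv hk)
    (by rintro rfl; exact hw hk) with h' | h' | h'
  · exact h'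
  · exact absurd (h.unique hv hk ha h' hav.symm) hka
  · exact absurd (h.unique hw hk ha h' haw.symm) hka

lemma card_list_le (h : G.IsBigClique K) {L : List V} (hn : L.Nodup) (hL : ∀ v ∈ L, v ∉ K) :
    L.length ≤ 6 := by
  have hd : Disjoint K L.toFinset := Finset.disjoint_right.2 fun v hv => hL v (by simpa using hv)
  have := (K ∪ L.toFinset).card_le_univ
  rw [Finset.card_union_of_disjoint hd, List.toFinset_card_of_nodup hn] at this
  have := h.card_le
  omega

lemma mem_or_mem (h : G.IsBigClique K) {L : List V} (hn : L.Nodup) (hL : ∀ v ∈ L, v ∉ K)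
    (hL6 : 6 ≤ L.length) (v : V) : v ∈ K ∨ v ∈ L := by
  by_contra! hv
  have := h.card_list_le (L := v :: L) (List.nodup_cons.2 ⟨hv.2, hn⟩)
    (by simpa using ⟨hv.1, hL⟩)
  simp at this
  omega

/-- There is no path containing all vertices outside `K` whose ends have distinct neighbours in
`K` off the path. -/
lemma false_of_pathList (h : G.IsBigClique K) {u v a b : V} {l : List V} (p : G.PathList u v l)
    (hn : l.Nodup) (hl : ∀ w, w ∈ K ∨ w ∈ l) (ha : a ∈ K) (hb : b ∈ K) (hab : a ≠ b) (hal : a ∉ l)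
    (hbl : b ∉ l) (hau : G.Adj a u) (hbv : G.Adj b v) : False := by
  have hn' : (b :: (((K.filter (· ∉ l)).erase a).erase b).toList ++ [a]).Nodup := by
    simp [List.nodup_append, Finset.nodup_toList, hab.symm]
    tauto
  have q := PathList.of_isClique_of_ends h.isClique hn' (by
    intro w hw
    simp at hw
    rcases hw with rfl | hw | rfl
    exacts [hb, hw.2.2.1, ha])
  have h3 : 3 ≤ Fintype.card V := le_trans (by simp) (h.six_le.trans K.card_le_univ)
  refine h.not_isHamiltonian (isHamiltonian_of_pathList h3 (q.append hau p) hbv.symm ?_ ?_)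
  · refine List.nodup_append.2 ⟨hn', hn, ?_⟩
    rintro w hw w' hw' rfl
    simp at hw
    rcases hw with rfl | hw | rfl
    exacts [hbl hw', hw.2.2.2 hw', hal hw']
  · intro w
    have := hl w
    simp
    tauto

end IsBigClique

/-- A cycle `c A d B` through all vertices of `K`, longest with this property, together with an
ear `Q` from `c` to `d`. -/
structure Ear [Fintype V] [DecidableEq V] (G : SimpleGraph V) (K : Finset V) (c d : V)
    (A B Q : List V) (p q r s z z' : V) : Prop extends G.IsBigClique K where
  pathA : G.PathList p q A
  pathB : G.PathList r s B
  pathQ : G.PathList z z' Q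
  cp : G.Adj c p
  qd : G.Adj q d
  dr : G.Adj d r
  sc : G.Adj s c
  cz : G.Adj c z
  zd : G.Adj z' d
  nodup : (c :: d :: (A ++ B ++ Q)).Nodup
  subset : ∀ k ∈ K, k ∈ c :: d :: (A ++ B)
  longest : ∀ ⦃a b l⦄, G.PathList a b l → G.Adj b a → l.Nodup → (∀ k ∈ K, k ∈ l) →
    l.length ≤ A.length + B.length + 2

/-- If a non-Hamiltonian 2-connected graph has a big clique, then it has a longest cycle through
that clique with an ear. -/
lemma IsBigClique.exists_ear [Fintype V] [DecidableEq V] {K : Finset V} (h : G.IsBigClique K)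
    (h2 : TwoConnected G) : ∃ c d A B Q p q r s z z', G.Ear K c d A B Q p q r s z z' := by
  classical
  let P : ℕ → Prop := fun m => ∃ a b l, G.PathList a b l ∧ G.Adj b a ∧ l.Nodup ∧
    (∀ k ∈ K, k ∈ l) ∧ l.length = m
  have hbound : ∀ m, P m → m ≤ Fintype.card V := by
    rintro m ⟨a, b, l, -, -, hn, -, rfl⟩
    exact hn.length_le_card
  have hex : ∃ m, P m := by
    obtain ⟨a, ha, b, hb, hab⟩ := Finset.one_lt_card.1 (show 1 < K.card by have := h.six_le; omega)
    have hn : (a :: ((K.erase b).erase a).toList ++ [b]).Nodup := by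
      simp [List.nodup_append, Finset.nodup_toList, hab]
      tauto
    refine ⟨_, a, b, _, .of_isClique_of_ends h.isClique hn fun w hw => ?_,
      (h.adj ha hb hab).symm, hn, fun k hk => by simp; tauto, rfl⟩
    simp at hw
    rcases hw with rfl | hw | rfl
    exacts [ha, hw.2.2, hb]
  obtain ⟨m₀, hm₀⟩ := hex
  obtain ⟨a, b, C, pC, hba, hn, hK, hlen⟩ :=
    Nat.findGreatest_spec (P := P) (hbound m₀ hm₀) hm₀
  have hmax : ∀ ⦃a b l⦄, G.PathList a b l → G.Adj b a → l.Nodup → (∀ k ∈ K, k ∈ l) →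
      l.length ≤ C.length := by
    intro a b l pl hl hnl hKl
    have : P l.length := ⟨a, b, l, pl, hl, hnl, hKl, rfl⟩
    exact hlen ▸ Nat.le_findGreatest (hbound _ this) this
  obtain ⟨x, hx⟩ : ∃ x, x ∉ C := by
    by_contra! hC
    exact h.not_isHamiltonian (isHamiltonian_of_pathList h2.1 pC hba hn hC)
  obtain ⟨c, hc, d, hd, hcd, z, z', Q, pQ, hnQ, hQ, hcz, hzd⟩ := h2.exists_ear (C := {v | v ∈ C})
    pC.left_mem pC.right_mem hba.ne.symm hx
  obtain ⟨t, T, pT, htc, hperm⟩ := pC.rotate hba hc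
  have hT : (c :: T ++ Q).Nodup := by
    refine List.nodup_append.2 ⟨hperm.nodup_iff.2 hn, hnQ, ?_⟩
    rintro v hv v' hv' rfl
    exact hQ v hv' (hperm.mem_iff.1 hv)
  have hno : ∀ {a b l}, G.PathList a b l → G.Adj b a → l.Perm (c :: T ++ Q) → False := by
    intro a b l pl hl hp
    have h1 := hmax pl hl (hp.nodup_iff.2 hT) fun k hk => hp.mem_iff.2 <|
      List.mem_append_left _ (hperm.mem_iff.2 (hK k hk))
    have h2 := hp.length_eq
    have h3 := hperm.length_eq
    have h4 := List.length_pos_iff.2 pQ.ne_nil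
    rw [List.length_append] at h2
    omega
  have hdT : d ∈ T := (List.mem_cons.1 (hperm.mem_iff.2 hd)).resolve_left hcd.symm
  obtain ⟨A, B, rfl⟩ := List.append_of_mem hdT
  obtain ⟨y, -, -, pd⟩ := pT.split (l := c :: A) (by simp)
  by_cases hA : A = []
  · subst hA
    refine (hno (l := c :: Q ++ d :: B) (.cons hcz (pQ.append hzd pd)) htc ?_).elim
    refine List.perm_iff_count.2 fun v => ?_
    simp only [List.count_append, List.count_cons, List.count_nil]
    omega
  by_cases hB : B = []
  · subst hB
    obtain rfl := pd.eq_of_singleton.2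
    refine (hno (l := c :: (A ++ [t]) ++ Q.reverse) (pT.append hzd.symm pQ.reverse) hcz.symm
      ?_).elim
    exact (List.reverse_perm Q).append_left _
  obtain ⟨p, hcp, pT⟩ := pT.uncons (by simp)
  obtain ⟨q, pA, hqd, pd⟩ := pT.split hA
  obtain ⟨r, hdr, pB⟩ := pd.uncons hB
  have hp : (c :: d :: (A ++ B)).Perm (c :: (A ++ d :: B)) := List.perm_middle.symm.cons c
  refine ⟨c, d, A, B, Q, p, q, r, t, z, z', h, pA, pB, pQ, hcp, hqd, hdr, htc, hcz, hzd,
    ((hp.append_right Q).nodup_iff.2 hT), fun k hk => ?_, fun a b l pl hl hnl hKl => ?_⟩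
  · exact (hp.trans hperm).mem_iff.2 (hK k hk)
  · have := hmax pl hl hnl hKl
    have := (hp.trans hperm).length_eq
    simp at this
    omega

end SimpleGraph

namespace SimpleGraph

variable {V : Type*} {G : SimpleGraph V} [Fintype V] [DecidableEq V] {K : Finset V}
  {c d p q r s z z' : V} {A B Q : List V}

namespace Ear

/-- Traverse the cycle and the ear backwards. -/
lemma swap (h : G.Ear K c d A B Q p q r s z z') :
    G.Ear K d c A.reverse B.reverse Q.reverse q p s r z' z where
  toIsBigClique := h.toIsBigClique
  pathA := h.pathA.reverse
  pathB := h.pathB.reverse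
  pathQ := h.pathQ.reverse
  cp := h.qd.symm
  qd := h.cp.symm
  dr := h.sc.symm
  sc := h.dr.symm
  cz := h.zd.symm
  zd := h.cz.symm
  nodup := by
    refine (List.Perm.nodup_iff ?_).1 h.nodup
    refine List.perm_iff_count.2 fun v => ?_
    simp only [List.count_append, List.count_cons, List.count_reverse]
    omega
  subset k hk := by
    have := h.subset k hk
    simp at this ⊢
    tauto
  longest a b l hl hba hn hk := by simpa using h.longest hl hba hn hk

/-- Traverse the cycle backwards, but not the ear. -/
lemma flip (h : G.Ear K c d A B Q p q r s z z') :
    G.Ear K c d B.reverse A.reverse Q s r q p z z' where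
  toIsBigClique := h.toIsBigClique
  pathA := h.pathB.reverse
  pathB := h.pathA.reverse
  pathQ := h.pathQ
  cp := h.sc.symm
  qd := h.dr.symm
  dr := h.qd.symm
  sc := h.cp.symm
  cz := h.cz
  zd := h.zd
  nodup := by
    refine (List.Perm.nodup_iff ?_).1 h.nodup
    refine List.perm_iff_count.2 fun v => ?_
    simp only [List.count_append, List.count_cons, List.count_reverse]
    omega
  subset k hk := by
    have := h.subset k hk
    simp at this ⊢
    tauto
  longest a b l hl hba hn hk := by
    have := h.longest hl hba hn hk
    simp
    omega

lemma ne_of_mem (h : G.Ear K c d A B Q p q r s z z') {v w : V} (hv : v ∈ A) (hw : w ∈ B) :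
    v ≠ w := by
  have := h.nodup
  simp [List.nodup_append] at this
  grind

lemma notMem_of_mem (h : G.Ear K c d A B Q p q r s z z') {v : V} (hv : v ∈ Q) :
    v ∉ c :: d :: (A ++ B) := by
  have : (c :: d :: (A ++ B) ++ Q).Nodup := h.nodup
  exact fun hv' => (List.nodup_append.1 this).2.2 v hv' v hv rfl

lemma notMem_clique_of_mem (h : G.Ear K c d A B Q p q r s z z') {v : V} (hv : v ∈ Q) : v ∉ K :=
  fun hv' => h.notMem_of_mem hv (h.subset v hv')

lemma false_of_perm (h : G.Ear K c d A B Q p q r s z z') {a b : V} {l : List V}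
    (hl : G.PathList a b l) (hba : G.Adj b a)
    (hp : l.Perm (c :: d :: (A ++ B ++ Q))) : False := by
  have h1 := h.longest hl hba (hp.nodup_iff.2 h.nodup) fun k hk => hp.mem_iff.2 <| by
    have := h.subset k hk
    simp at this ⊢
    tauto
  have h2 := hp.length_eq
  have h3 := List.length_pos_iff.2 h.pathQ.ne_nil
  simp at h2
  omega

lemma not_adj_zp (h : G.Ear K c d A B Q p q r s z z') : ¬ G.Adj z p := by
  intro hzp
  have hp : (c :: z :: A ++ d :: B).Perm (z :: c :: d :: (A ++ B)) := by
    refine List.perm_iff_count.2 fun v => ?_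
    simp only [List.count_append, List.count_cons]
    omega
  have hn : (z :: c :: d :: (A ++ B)).Nodup :=
    List.nodup_cons.2 ⟨h.notMem_of_mem h.pathQ.left_mem,
      (List.nodup_append.1 (show (c :: d :: (A ++ B) ++ Q).Nodup from h.nodup)).1⟩
  have := h.longest (.cons h.cz ((PathList.cons hzp h.pathA).append h.qd (.cons h.dr h.pathB))) h.sc
    (hp.nodup_iff.2 hn) fun k hk => hp.mem_iff.2 (List.mem_cons_of_mem _ (h.subset k hk))
  simp at this

lemma ps (h : G.Ear K c d A B Q p q r s z z') : G.Adj p s := by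
  have hz := h.notMem_of_mem h.pathQ.left_mem
  rcases h.clawFree.adj h.cp h.sc.symm h.cz (h.ne_of_mem h.pathA.left_mem h.pathB.right_mem)
    (by rintro rfl; simp [h.pathA.left_mem] at hz) (by rintro rfl; simp [h.pathB.right_mem] at hz)
    with h' | h' | h'
  exacts [h', absurd h'.symm h.not_adj_zp, absurd h'.symm h.flip.not_adj_zp]

lemma qr (h : G.Ear K c d A B Q p q r s z z') : G.Adj q r := h.swap.ps

lemma not_adj_pr (h : G.Ear K c d A B Q p q r s z z') : ¬ G.Adj p r := by
  intro hpr
  refine h.false_of_perm (l := c :: Q ++ d :: A.reverse ++ B) (PathList.append (.append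
    (.cons h.cz h.pathQ) h.zd (.cons h.qd.symm h.pathA.reverse)) hpr h.pathB) h.sc ?_
  refine List.perm_iff_count.2 fun v => ?_
  simp only [List.count_append, List.count_cons, List.count_reverse]
  omega

lemma not_adj_qs (h : G.Ear K c d A B Q p q r s z z') : ¬ G.Adj q s :=
  fun h' => h.flip.not_adj_pr h'.symm

lemma p_ne_q (h : G.Ear K c d A B Q p q r s z z') : p ≠ q := by
  rintro rfl
  exact h.not_adj_pr h.qr

lemma s_ne_r (h : G.Ear K c d A B Q p q r s z z') : s ≠ r := h.flip.p_ne_q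

lemma p_mem (h : G.Ear K c d A B Q p q r s z z') (hc : c ∈ K) : p ∈ K := by
  by_contra hp
  refine h.not_adj_zp (h.adj_of_notMem hc (h.notMem_clique_of_mem h.pathQ.left_mem) hp h.cz h.cp ?_)
  rintro rfl
  exact h.notMem_of_mem h.pathQ.left_mem (by simp [h.pathA.left_mem])

lemma q_notMem (h : G.Ear K c d A B Q p q r s z z') (hc : c ∈ K) : q ∉ K := fun hq =>
  h.not_adj_qs (h.adj hq (h.flip.p_mem hc) (h.ne_of_mem h.pathA.right_mem h.pathB.right_mem))

lemma notMem_of_mem_left (h : G.Ear K c d A B Q p q r s z z') (hc : c ∈ K) : d ∉ K := fun hd =>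
  h.q_notMem hc (h.swap.p_mem hd)

/-- If `c` lies in the clique, then at least two vertices of `A` follow the last vertex of the
clique. -/
lemma exists_tail (h : G.Ear K c d A B Q p q r s z z') (hc : c ∈ K) :
    ∃ A₁ A₂ g y, A = A₁ ++ A₂ ∧ G.PathList p g A₁ ∧ G.Adj g y ∧ G.PathList y q A₂ ∧ g ∈ K ∧
      (∀ v ∈ A₂, v ∉ K) ∧ 2 ≤ A₂.length := by
  obtain ⟨A₁, A₂, g, y, rfl, h1, h2, h3, hg, h4⟩ :=
    h.pathA.split_last (· ∈ K) ⟨p, h.pathA.left_mem, h.p_mem hc⟩ (h.q_notMem hc)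
  refine ⟨A₁, A₂, g, y, rfl, h1, h2, h3, hg, h4, ?_⟩
  by_contra! hlt
  obtain ⟨x, rfl⟩ : ∃ x, A₂ = [x] := by
    have := List.length_pos_iff.2 h3.ne_nil
    exact List.length_eq_one_iff.1 (by omega)
  obtain ⟨rfl, rfl⟩ := h3.eq_of_singleton
  have hgs : G.Adj s g :=
    h.adj (h.flip.p_mem hc) hg (h.ne_of_mem (by simp [h1.right_mem]) h.pathB.right_mem).symm
  refine h.false_of_perm (l := c :: Q ++ d :: q :: B ++ A₁.reverse) (PathList.append (.append
    (.cons h.cz h.pathQ) h.zd (.cons h.qd.symm (.cons h.qr h.pathB))) hgs h1.reverse) h.cp.symm ?_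
  refine List.perm_iff_count.2 fun v => ?_
  simp only [List.count_append, List.count_cons, List.count_reverse, List.count_nil]
  omega

end Ear

/-- The configuration of `EP_n`. -/
structure EPConfig (G : SimpleGraph V) (K : Finset V) (a₁ a₂ a₃ b₁ b₂ b₃ c₁ c₂ c₃ : V) : Prop
    extends G.IsBigClique K where
  a₁_mem : a₁ ∈ K
  a₂_mem : a₂ ∈ K
  a₃_mem : a₃ ∈ K
  a₁_ne_a₂ : a₁ ≠ a₂
  a₁_ne_a₃ : a₁ ≠ a₃
  a₂_ne_a₃ : a₂ ≠ a₃
  nodup : [b₁, b₂, b₃, c₁, c₂, c₃].Nodup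
  notMem : ∀ v ∈ [b₁, b₂, b₃, c₁, c₂, c₃], v ∉ K
  ac₁ : G.Adj a₁ c₁
  ac₂ : G.Adj a₂ c₂
  ac₃ : G.Adj a₃ c₃
  cb₁ : G.Adj c₁ b₁
  cb₂ : G.Adj c₂ b₂
  cb₃ : G.Adj c₃ b₃
  b₁₂ : G.Adj b₁ b₂
  b₁₃ : G.Adj b₁ b₃
  b₂₃ : G.Adj b₂ b₃

/-- The configuration of `EP'_n`. -/
structure EP'Config (G : SimpleGraph V) (K : Finset V) (a₁ b₁ a₂ a₃ b₂ b₃ c₂ c₃ : V) : Prop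
    extends G.IsBigClique K where
  a₁_mem : a₁ ∈ K
  b₁_mem : b₁ ∈ K
  a₁_ne_b₁ : a₁ ≠ b₁
  nodup : [a₂, a₃, b₂, b₃, c₂, c₃].Nodup
  notMem : ∀ v ∈ [a₂, a₃, b₂, b₃, c₂, c₃], v ∉ K
  a₁₂ : G.Adj a₁ a₂
  a₁₃ : G.Adj a₁ a₃
  a₂₃ : G.Adj a₂ a₃
  b₁₂ : G.Adj b₁ b₂
  b₁₃ : G.Adj b₁ b₃
  b₂₃ : G.Adj b₂ b₃
  ac₂ : G.Adj a₂ c₂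
  cb₂ : G.Adj c₂ b₂
  ac₃ : G.Adj a₃ c₃
  cb₃ : G.Adj c₃ b₃

namespace Ear

lemma exists_epConfig (h : G.Ear K c d A B Q p q r s z z') (hc : c ∈ K) :
    ∃ a₁ a₂ a₃ b₁ b₂ b₃ c₁ c₂ c₃, G.EPConfig K a₁ a₂ a₃ b₁ b₂ b₃ c₁ c₂ c₃ := by
  obtain ⟨A₁, A₂, g, y, rfl, pA₁, hgy, pA₂, hg, hA₂, hA₂'⟩ := h.exists_tail hc
  obtain ⟨B₁, B₂, k, x, hB, pB₁, hkx, pB₂, hk, hB₂, hB₂'⟩ := h.flip.exists_tail hc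
  obtain rfl : B = B₂.reverse ++ B₁.reverse := by
    rw [← List.reverse_append, ← hB, List.reverse_reverse]
  have hn : (c :: d :: (A₁ ++ A₂ ++ (B₂ ++ B₁) ++ Q)).Nodup := by
    refine (List.Perm.nodup_iff ?_).1 h.nodup
    refine List.perm_iff_count.2 fun v => ?_
    simp only [List.count_append, List.count_cons, List.count_reverse]
  have hd := h.notMem_of_mem_left hc
  have hQ := fun v => h.notMem_clique_of_mem (v := v)
  have hn' : (d :: (A₂ ++ (B₂ ++ Q))).Nodup := by
    refine hn.sublist (.cons _ (.cons_cons _ ?_))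
    simp only [List.append_assoc]
    refine (List.Sublist.append_left ?_ A₂).trans (List.sublist_append_right A₁ _)
    exact (List.sublist_append_right B₁ Q).append_left B₂
  have hK : ∀ v ∈ d :: (A₂ ++ (B₂ ++ Q)), v ∉ K := by
    simp only [List.mem_cons, List.mem_append]
    rintro v (rfl | hv | hv | hv)
    exacts [hd, hA₂ v hv, hB₂ v hv, hQ v hv]
  have hlen := h.card_list_le hn' hK
  have hQ' := List.length_pos_iff.2 h.pathQ.ne_nil
  simp only [List.length_cons, List.length_append] at hlen
  obtain ⟨y', q', rfl⟩ := List.length_eq_two.1 (show A₂.length = 2 by omega)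
  obtain ⟨x', r', rfl⟩ := List.length_eq_two.1 (show B₂.length = 2 by omega)
  obtain ⟨z₀, rfl⟩ := List.length_eq_one_iff.1 (show Q.length = 1 by omega)
  obtain ⟨rfl, rfl⟩ := h.pathQ.eq_of_singleton
  obtain rfl := pA₂.left_eq
  obtain rfl := pA₂.right_eq (l := [y])
  obtain rfl := pB₂.left_eq
  obtain rfl := pB₂.right_eq (l := [x])
  have hyq : G.Adj y q := by
    obtain ⟨w, h1, h2⟩ := pA₂.uncons (by simp)
    exact h2.left_eq ▸ h1
  have hxr : G.Adj x r := by
    obtain ⟨w, h1, h2⟩ := pB₂.uncons (by simp)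
    exact h2.left_eq ▸ h1
  have hgA := pA₁.right_mem
  have hkB := pB₁.right_mem
  have hp : [d, q, r, z', y, x].Perm (d :: ([y, q] ++ ([x, r] ++ [z']))) := by
    refine List.perm_iff_count.2 fun v => ?_
    simp only [List.count_append, List.count_cons, List.count_nil]
    omega
  refine ⟨c, g, k, d, q, r, z', y, x, h.toIsBigClique, hc, hg, hk, ?_, ?_, ?_, hp.nodup_iff.2 hn',
    fun v hv => hK v (hp.mem_iff.1 hv), h.cz, hgy, hkx, h.zd, hyq, hxr, h.qd.symm, h.dr, h.qr⟩
  · rintro rfl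
    simp [hgA] at hn
  · rintro rfl
    simp [hkB] at hn
  · rintro rfl
    simp [List.nodup_append] at hn
    grind

end Ear

end SimpleGraph

namespace SimpleGraph

variable {V : Type*} {G : SimpleGraph V} [Fintype V] [DecidableEq V] {K : Finset V}

namespace Ear

variable {c d p q r s z z' : V} {A B Q : List V}

lemma length_add_le (h : G.Ear K c d A B Q p q r s z z') (hc : c ∉ K) (hd : d ∉ K)
    {A' B' : List V} (hA' : A'.Sublist A) (hB' : B'.Sublist B) (hA : ∀ v ∈ A', v ∉ K)
    (hB : ∀ v ∈ B', v ∉ K) : A'.length + B'.length + Q.length ≤ 4 := by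
  have := h.card_list_le (h.nodup.sublist (((hA'.append hB').append (.refl Q)).cons_cons d
    |>.cons_cons c)) (by
      simp only [List.mem_cons, List.mem_append]
      rintro v (rfl | rfl | (hv | hv) | hv)
      exacts [hc, hd, hA v hv, hB v hv, h.notMem_clique_of_mem hv])
  simp only [List.length_cons, List.length_append] at this
  omega

lemma three_le_length (h : G.Ear K c d A B Q p q r s z z') : 3 ≤ B.length := by
  by_contra! hlt
  obtain ⟨t, rfl⟩ := h.pathB.exists_cons
  have ht : t ≠ [] := by
    rintro rfl
    exact h.s_ne_r (h.pathB.eq_of_singleton.2)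
  obtain ⟨s', rfl⟩ : ∃ s', t = [s'] := by
    have := List.length_pos_iff.2 ht
    simp at hlt
    exact List.length_eq_one_iff.1 (by omega)
  obtain rfl := h.pathB.right_eq (l := [r])
  refine h.false_of_perm (l := s :: c :: Q ++ d :: r :: A.reverse) (PathList.append
    (.cons h.sc (.cons h.cz h.pathQ)) h.zd (.cons h.dr (.cons h.qr.symm h.pathA.reverse))) h.ps ?_
  refine List.perm_iff_count.2 fun v => ?_
  simp only [List.count_append, List.count_cons, List.count_reverse, List.count_nil]
  omega

lemma exists_ep'Config_of_mem (h : G.Ear K c d A B Q p q r s z z') (hc : c ∉ K) (hd : d ∉ K)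
    (hp : p ∈ K) : ∃ a₁ b₁ a₂ a₃ b₂ b₃ c₂ c₃, G.EP'Config K a₁ b₁ a₂ a₃ b₂ b₃ c₂ c₃ := by
  have hs : s ∉ K := fun hs => h.ne_of_mem h.pathA.left_mem h.pathB.right_mem
    (h.unique hc hp hs h.cp h.sc.symm)
  have hr : r ∉ K := fun hr => h.not_adj_pr
    (h.adj hp hr (h.ne_of_mem h.pathA.left_mem h.pathB.left_mem))
  have hQ := List.length_pos_iff.2 h.pathQ.ne_nil
  have hqA : [q].Sublist A := List.singleton_sublist.2 h.pathA.right_mem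
  have hB : ∀ v ∈ B, v ∉ K := by
    by_contra! hex
    obtain ⟨l₁, l₂, g, y, hBl, p₁, hgy, p₂, hg, hl₂⟩ := h.pathB.split_last (· ∈ K) hex hs
    have hl₂' : 2 ≤ l₂.length := by
      by_contra! hlt
      obtain ⟨x, rfl⟩ : ∃ x, l₂ = [x] := by
        have := List.length_pos_iff.2 p₂.ne_nil
        exact List.length_eq_one_iff.1 (by omega)
      obtain ⟨rfl, rfl⟩ := p₂.eq_of_singleton
      exact h.ne_of_mem h.pathA.left_mem (by simp [hBl, p₁.right_mem])
        (h.unique hs hp hg h.ps.symm hgy.symm)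
    have hq : q ∈ K := by
      by_contra hq
      have hsub : ([r] ++ l₂).Sublist B :=
        hBl ▸ (List.singleton_sublist.2 p₁.left_mem).append (.refl l₂)
      have := h.length_add_le hc hd hqA hsub (by simpa) (by simpa [hr])
      simp only [List.length_append, List.length_singleton] at this
      omega
    obtain ⟨m₁, m₂, k, x, hml, p₃, hkx, p₄, hk, hm₂⟩ :=
      p₁.reverse.split_last (· ∈ K) ⟨g, by simp [p₁.right_mem], hg⟩ hr
    have hm₂' : 2 ≤ m₂.length := by
      by_contra! hlt
      obtain ⟨x, rfl⟩ : ∃ x, m₂ = [x] := by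
        have := List.length_pos_iff.2 p₄.ne_nil
        exact List.length_eq_one_iff.1 (by omega)
      obtain ⟨rfl, rfl⟩ := p₄.eq_of_singleton
      have hkB : k ∈ l₁.reverse := by simp [hml, p₃.right_mem]
      exact h.ne_of_mem h.pathA.right_mem (by rw [hBl]; simp at hkB ⊢; tauto)
        (h.unique hr hq hk h.qr.symm hkx.symm)
    have hsub : (m₂.reverse ++ l₂).Sublist B := by
      obtain rfl : l₁ = m₂.reverse ++ m₁.reverse := by
        rw [← List.reverse_append, ← hml, List.reverse_reverse]
      exact hBl ▸ (List.sublist_append_left _ _).append (.refl l₂)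
    have := h.length_add_le hc hd (List.nil_sublist A) hsub (by simp) (by
      simp only [List.mem_append, List.mem_reverse]
      rintro v (hv | hv)
      exacts [hm₂ v hv, hl₂ v hv])
    simp only [List.length_append, List.length_reverse] at this
    omega
  have h3 := h.three_le_length
  have hq : q ∈ K := by
    by_contra hq
    have := h.length_add_le hc hd hqA (.refl B) (by simpa) hB
    simp only [List.length_singleton] at this
    omega
  have hlen := h.length_add_le hc hd (List.nil_sublist A) (.refl B) (by simp) hB
  simp only [List.length_nil] at hlen
  obtain ⟨z₀, rfl⟩ := List.length_eq_one_iff.1 (show Q.length = 1 by omega)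
  obtain ⟨r', w, s', rfl⟩ := List.length_eq_three.1 (show B.length = 3 by omega)
  obtain ⟨rfl, rfl⟩ := h.pathQ.eq_of_singleton
  obtain rfl := h.pathB.left_eq
  obtain rfl := h.pathB.right_eq (l := [r, w])
  obtain ⟨w', hrw, pw⟩ := h.pathB.uncons (by simp)
  obtain rfl := pw.left_eq
  obtain ⟨s', hws, ps⟩ := pw.uncons (by simp)
  obtain rfl := ps.left_eq
  have hperm : [c, s', d, r, z', w'].Perm (c :: d :: ([r, w', s'] ++ [z'])) := by
    refine List.perm_iff_count.2 fun v => ?_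
    simp only [List.count_append, List.count_cons, List.count_nil]
    omega
  refine ⟨p, q, c, s', d, r, z', w', h.toIsBigClique, hp, hq, h.p_ne_q,
    hperm.nodup_iff.2 (h.nodup.sublist
      (((List.sublist_append_right A _).append (.refl _)).cons_cons d |>.cons_cons c)),
    fun v hv => ?_, h.cp.symm, h.ps, h.sc.symm, h.qd, h.qr, h.dr, h.cz, h.zd, hws.symm, hrw.symm⟩
  have hzK := h.notMem_clique_of_mem h.pathQ.left_mem
  have hwK := hB w' (by simp)
  simp only [List.mem_cons, List.not_mem_nil, or_false] at hv
  rcases hv with rfl | rfl | rfl | rfl | rfl | rfl <;> assumption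

lemma exists_config (h : G.Ear K c d A B Q p q r s z z') :
    (∃ a₁ a₂ a₃ b₁ b₂ b₃ c₁ c₂ c₃, G.EPConfig K a₁ a₂ a₃ b₁ b₂ b₃ c₁ c₂ c₃) ∨
      ∃ a₁ b₁ a₂ a₃ b₂ b₃ c₂ c₃, G.EP'Config K a₁ b₁ a₂ a₃ b₂ b₃ c₂ c₃ := by
  by_cases hc : c ∈ K
  · exact .inl (h.exists_epConfig hc)
  by_cases hd : d ∈ K
  · exact .inl (h.swap.exists_epConfig hd)
  right
  by_cases hp : p ∈ K
  · exact h.exists_ep'Config_of_mem hc hd hp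
  by_cases hq : q ∈ K
  · exact h.swap.exists_ep'Config_of_mem hd hc hq
  by_cases hs : s ∈ K
  · exact h.flip.exists_ep'Config_of_mem hc hd hs
  by_cases hr : r ∈ K
  · exact h.flip.swap.exists_ep'Config_of_mem hd hc hr
  have key : ∀ {a b : V} {l : List V}, G.PathList a b l → a ≠ b → [a, b].Sublist l := by
    intro a b l p hab
    obtain ⟨t, rfl⟩ := p.exists_cons
    have := (List.mem_cons.1 p.right_mem).resolve_left hab.symm
    exact (List.singleton_sublist.2 this).cons_cons a
  have := h.length_add_le hc hd (key h.pathA h.p_ne_q) (key h.pathB h.s_ne_r.symm)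
    (by simp [hp, hq]) (by simp [hr, hs])
  have := List.length_pos_iff.2 h.pathQ.ne_nil
  simp only [List.length_cons, List.length_nil] at *
  omega

end Ear

namespace IsBigClique

/-- Variant of `false_of_pathList` for a path made up of all vertices outside `K`, listed as `L`,
and a list `M` of vertices of `K`. -/
lemma false_of_perm (h : G.IsBigClique K) {M L l : List V} {u v a b : V} (hM : ∀ v ∈ M, v ∈ K)
    (hnM : M.Nodup) (hnL : L.Nodup) (hL : ∀ v ∈ L, v ∉ K) (hL6 : 6 ≤ L.length)
    (p : G.PathList u v l) (hp : l.Perm (M ++ L)) (ha : a ∈ K) (hb : b ∈ K) (hab : a ≠ b)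
    (haM : a ∉ M) (hbM : b ∉ M) (hau : G.Adj a u) (hbv : G.Adj b v) : False := by
  have hn : l.Nodup := hp.nodup_iff.2 <| List.nodup_append.2 ⟨hnM, hnL, by
    rintro w hw w' hw' rfl
    exact hL w hw' (hM w hw)⟩
  refine h.false_of_pathList p hn (fun w => ?_) ha hb hab ?_ ?_ hau hbv
  · have := h.mem_or_mem hnL hL hL6 w
    rw [hp.mem_iff, List.mem_append]
    tauto
  · rw [hp.mem_iff, List.mem_append]
    exact fun h' => h'.elim haM fun h' => hL a h' ha
  · rw [hp.mem_iff, List.mem_append]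
    exact fun h' => h'.elim hbM fun hmem => hL b hmem hb

/-- Label the vertices by `Fin n` with the clique first, starting with `F`, and then `L`. -/
lemma exists_equiv (h : G.IsBigClique K) {n : ℕ} (hn : Fintype.card V = n) {F L : List V}
    (hF : ∀ v ∈ F, v ∈ K) (hnF : F.Nodup) (hnL : L.Nodup) (hL : ∀ v ∈ L, v ∉ K)
    (hL6 : L.length = 6) : ∃ f : V ≃ Fin n, (∀ v ∈ K, (f v).val < n - 6) ∧
      (∀ (i : ℕ) (hi : i < F.length), (f F[i]).val = i) ∧
      ∀ (i : ℕ) (hi : i < L.length), (f L[i]).val = n - 6 + i := by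
  obtain ⟨S, hS⟩ : ∃ S, S = F ++ (K \ F.toFinset).toList := ⟨_, rfl⟩
  have hmS : ∀ v, v ∈ S ↔ v ∈ K := by
    intro v
    have := hF v
    simp [hS]
    tauto
  have hnS : S.Nodup := by
    rw [hS]
    simp only [List.nodup_append, hnF, Finset.nodup_toList, true_and]
    rintro v hv v' hv' rfl
    simp [hv] at hv'
  have hnT : (S ++ L).Nodup := List.nodup_append.2 ⟨hnS, hnL, by
    rintro w hw w' hw' rfl
    exact hL w hw' ((hmS w).1 hw)⟩
  have hmT : ∀ v, v ∈ S ++ L := fun v => by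
    rw [List.mem_append, hmS]
    exact h.mem_or_mem hnL hL hL6.ge v
  have hlen : (S ++ L).length = n := by
    rw [← List.toFinset_card_of_nodup hnT, ← hn, ← Finset.card_univ]
    congr 1
    ext v
    simpa using hmT v
  have hlenS : S.length = n - 6 := by
    rw [List.length_append] at hlen
    omega
  let g : V → Fin n := fun v => ⟨(S ++ L).idxOf v, hlen ▸ List.idxOf_lt_length_of_mem (hmT v)⟩
  have hg : Function.Injective g := fun v w hvw =>
    (List.idxOf_inj (hmT v)).1 (congrArg Fin.val hvw)
  refine ⟨.ofBijective g ((Fintype.bijective_iff_injective_and_card g).2 ⟨hg, by simp [hn]⟩),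
    fun v hv => ?_, fun i hi => ?_, fun i hi => ?_⟩
  · change (S ++ L).idxOf v < n - 6
    rw [List.idxOf_append_of_mem ((hmS v).2 hv), ← hlenS]
    exact List.idxOf_lt_length_of_mem ((hmS v).2 hv)
  · change (S ++ L).idxOf F[i] = i
    rw [hS, List.append_assoc, List.idxOf_append_of_mem (List.getElem_mem hi), hnF.idxOf_getElem]
  · change (S ++ L).idxOf L[i] = n - 6 + i
    rw [List.idxOf_append_of_notMem, hnL.idxOf_getElem, hlenS]
    rw [hmS]
    exact hL _ (List.getElem_mem hi)

end IsBigClique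

end SimpleGraph

namespace SimpleGraph

variable {V : Type*} {G : SimpleGraph V} [Fintype V] [DecidableEq V] {K : Finset V}

namespace EPConfig

variable {a₁ a₂ a₃ b₁ b₂ b₃ c₁ c₂ c₃ : V}

lemma swap₁₂ (h : G.EPConfig K a₁ a₂ a₃ b₁ b₂ b₃ c₁ c₂ c₃) :
    G.EPConfig K a₂ a₁ a₃ b₂ b₁ b₃ c₂ c₁ c₃ := by
  have hp : [b₂, b₁, b₃, c₂, c₁, c₃].Perm [b₁, b₂, b₃, c₁, c₂, c₃] := by
    refine List.perm_iff_count.2 fun v => ?_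
    simp only [List.count_cons, List.count_nil]
    omega
  exact ⟨h.toIsBigClique, h.a₂_mem, h.a₁_mem, h.a₃_mem, h.a₁_ne_a₂.symm, h.a₂_ne_a₃, h.a₁_ne_a₃,
    hp.nodup_iff.2 h.nodup, fun v hv => h.notMem v (hp.mem_iff.1 hv), h.ac₂, h.ac₁, h.ac₃, h.cb₂,
    h.cb₁, h.cb₃, h.b₁₂.symm, h.b₂₃, h.b₁₃⟩

lemma swap₂₃ (h : G.EPConfig K a₁ a₂ a₃ b₁ b₂ b₃ c₁ c₂ c₃) :
    G.EPConfig K a₁ a₃ a₂ b₁ b₃ b₂ c₁ c₃ c₂ := by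
  have hp : [b₁, b₃, b₂, c₁, c₃, c₂].Perm [b₁, b₂, b₃, c₁, c₂, c₃] := by
    refine List.perm_iff_count.2 fun v => ?_
    simp only [List.count_cons, List.count_nil]
    omega
  exact ⟨h.toIsBigClique, h.a₁_mem, h.a₃_mem, h.a₂_mem, h.a₁_ne_a₃, h.a₁_ne_a₂, h.a₂_ne_a₃.symm,
    hp.nodup_iff.2 h.nodup, fun v hv => h.notMem v (hp.mem_iff.1 hv), h.ac₁, h.ac₃, h.ac₂, h.cb₁,
    h.cb₃, h.cb₂, h.b₁₃, h.b₁₂, h.b₂₃.symm⟩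

lemma not_adj_c₁_c₂ (h : G.EPConfig K a₁ a₂ a₃ b₁ b₂ b₃ c₁ c₂ c₃) : ¬ G.Adj c₁ c₂ := by
  intro h12
  refine h.false_of_perm (M := []) (l := [c₁, c₂, b₂, b₁, b₃, c₃]) (by simp) (by simp) h.nodup
    h.notMem le_rfl (.cons h12 (.cons h.cb₂ (.cons h.b₁₂.symm (.cons h.b₁₃ (.cons h.cb₃.symm
    (.single _)))))) ?_ h.a₁_mem h.a₃_mem h.a₁_ne_a₃ (by simp) (by simp) h.ac₁ h.ac₃
  refine List.perm_iff_count.2 fun v => ?_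
  simp only [List.count_cons, List.count_append, List.count_nil]
  omega

lemma not_adj_c₁_b₂ (h : G.EPConfig K a₁ a₂ a₃ b₁ b₂ b₃ c₁ c₂ c₃) : ¬ G.Adj c₁ b₂ := by
  intro h12
  refine h.false_of_perm (M := []) (l := [c₂, b₂, c₁, b₁, b₃, c₃]) (by simp) (by simp) h.nodup
    h.notMem le_rfl (.cons h.cb₂ (.cons h12.symm (.cons h.cb₁ (.cons h.b₁₃ (.cons h.cb₃.symm
    (.single _)))))) ?_ h.a₂_mem h.a₃_mem h.a₂_ne_a₃ (by simp) (by simp) h.ac₂ h.ac₃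
  refine List.perm_iff_count.2 fun v => ?_
  simp only [List.count_cons, List.count_append, List.count_nil]
  omega

lemma not_adj_a₂_b₁ (h : G.EPConfig K a₁ a₂ a₃ b₁ b₂ b₃ c₁ c₂ c₃) : ¬ G.Adj a₂ b₁ := by
  intro hab
  have := h.nodup
  refine h.swap₁₂.not_adj_c₁_b₂ (h.adj_of_notMem h.a₂_mem (h.notMem _ (by simp))
    (h.notMem _ (by simp)) h.ac₂ hab ?_)
  rintro rfl
  simp at this

lemma eq_of_adj_b₁ (h : G.EPConfig K a₁ a₂ a₃ b₁ b₂ b₃ c₁ c₂ c₃) {a : V} (ha : a ∈ K)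
    (hab : G.Adj a b₁) : a = a₁ := by
  by_contra ha₁
  have ha₂ : a ≠ a₂ := by
    rintro rfl
    exact h.not_adj_a₂_b₁ hab
  have ha₃ : a ≠ a₃ := by
    rintro rfl
    exact h.swap₂₃.not_adj_a₂_b₁ hab
  refine h.false_of_perm (M := [a, a₂]) (l := [c₁, b₁, a, a₂, c₂, b₂, b₃, c₃])
    (by simp [ha, h.a₂_mem]) (by simp [ha₂]) h.nodup h.notMem le_rfl
    (.cons h.cb₁ (.cons hab.symm (.cons (h.adj ha h.a₂_mem ha₂) (.cons h.ac₂ (.cons h.cb₂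
    (.cons h.b₂₃ (.cons h.cb₃.symm (.single _)))))))) ?_ h.a₁_mem h.a₃_mem h.a₁_ne_a₃
    (by simp [h.a₁_ne_a₂, Ne.symm ha₁]) (by simp [h.a₂_ne_a₃.symm, ha₃.symm]) h.ac₁ h.ac₃
  refine List.perm_iff_count.2 fun v => ?_
  simp only [List.count_cons, List.count_append, List.count_nil]
  omega

lemma eq_of_adj_c₁ (h : G.EPConfig K a₁ a₂ a₃ b₁ b₂ b₃ c₁ c₂ c₃) {a : V} (ha : a ∈ K)
    (hab : G.Adj a c₁) : a = a₁ :=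
  h.unique (h.notMem c₁ (by simp)) ha h.a₁_mem hab.symm h.ac₁.symm

lemma exists_equiv_EPgraph (h : G.EPConfig K a₁ a₂ a₃ b₁ b₂ b₃ c₁ c₂ c₃) {n : ℕ} (hn : 12 ≤ n)
    (hV : Fintype.card V = n) :
    ∃ f : V ≃ Fin n, ∀ u v, G.Adj u v → (EPgraph n).Adj (f u) (f v) := by
  obtain ⟨f, hK, hF, hL⟩ := h.exists_equiv hV (F := [a₁, a₂, a₃])
    (by simp [h.a₁_mem, h.a₂_mem, h.a₃_mem]) (by simp [h.a₁_ne_a₂, h.a₁_ne_a₃, h.a₂_ne_a₃])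
    h.nodup h.notMem rfl
  have fa₁ : (f a₁).val = 0 := hF 0 (by simp)
  have fa₂ : (f a₂).val = 1 := hF 1 (by simp)
  have fa₃ : (f a₃).val = 2 := hF 2 (by simp)
  have fb₁ : (f b₁).val = n - 6 := hL 0 (by simp)
  have fb₂ : (f b₂).val = n - 6 + 1 := hL 1 (by simp)
  have fb₃ : (f b₃).val = n - 6 + 2 := hL 2 (by simp)
  have fc₁ : (f c₁).val = n - 6 + 3 := hL 3 (by simp)
  have fc₂ : (f c₂).val = n - 6 + 4 := hL 4 (by simp)
  have fc₃ : (f c₃).val = n - 6 + 5 := hL 5 (by simp)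
  have h132 := h.swap₂₃
  have h213 := h.swap₁₂
  have h231 := h213.swap₂₃
  have h312 := h132.swap₁₂
  have cc₁₂ := h.not_adj_c₁_c₂
  have cc₁₃ := h132.not_adj_c₁_c₂
  have cc₂₃ := h231.not_adj_c₁_c₂
  have cb₁₂ := h.not_adj_c₁_b₂
  have cb₁₃ := h132.not_adj_c₁_b₂
  have cb₂₁ := h213.not_adj_c₁_b₂
  have cb₂₃ := h231.not_adj_c₁_b₂
  have cb₃₁ := h312.not_adj_c₁_b₂
  have cb₃₂ := h312.swap₂₃.not_adj_c₁_b₂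
  have mem : ∀ v, v ∈ K ∨ v = b₁ ∨ v = b₂ ∨ v = b₃ ∨ v = c₁ ∨ v = c₂ ∨ v = c₃ := fun v => by
    simpa using h.mem_or_mem h.nodup h.notMem le_rfl v
  have key : ∀ u v, u ∈ K → G.Adj u v → (EPgraph n).Adj (f u) (f v) := by
    intro u v hu huv
    rw [EPgraph, fromRel_adj]
    refine ⟨f.injective.ne huv.ne, .inl ?_⟩
    rcases mem v with hv | rfl | rfl | rfl | rfl | rfl | rfl
    · exact .inl ⟨hK u hu, hK v hv⟩
    · obtain rfl := h.eq_of_adj_b₁ hu huv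
      omega
    · obtain rfl := h213.eq_of_adj_b₁ hu huv
      omega
    · obtain rfl := h312.eq_of_adj_b₁ hu huv
      omega
    · obtain rfl := h.eq_of_adj_c₁ hu huv
      omega
    · obtain rfl := h213.eq_of_adj_c₁ hu huv
      omega
    · obtain rfl := h312.eq_of_adj_c₁ hu huv
      omega
  refine ⟨f, fun u v huv => ?_⟩
  rcases mem u with hu | hu
  · exact key u v hu huv
  rcases mem v with hv | hv
  · exact (key v u hv huv.symm).symm
  rw [EPgraph, fromRel_adj]
  refine ⟨f.injective.ne huv.ne, ?_⟩
  rcases hu with rfl | rfl | rfl | rfl | rfl | rfl <;>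
    rcases hv with rfl | rfl | rfl | rfl | rfl | rfl <;>
    first
    | exact absurd huv ‹_›
    | exact absurd huv.symm ‹_›
    | exact absurd rfl huv.ne
    | omega

end EPConfig

namespace EP'Config

variable {a₁ b₁ a₂ a₃ b₂ b₃ c₂ c₃ : V}

lemma swap_ab (h : G.EP'Config K a₁ b₁ a₂ a₃ b₂ b₃ c₂ c₃) :
    G.EP'Config K b₁ a₁ b₂ b₃ a₂ a₃ c₂ c₃ := by
  have hp : [b₂, b₃, a₂, a₃, c₂, c₃].Perm [a₂, a₃, b₂, b₃, c₂, c₃] := by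
    refine List.perm_iff_count.2 fun v => ?_
    simp only [List.count_cons, List.count_nil]
    omega
  exact ⟨h.toIsBigClique, h.b₁_mem, h.a₁_mem, h.a₁_ne_b₁.symm, hp.nodup_iff.2 h.nodup,
    fun v hv => h.notMem v (hp.mem_iff.1 hv), h.b₁₂, h.b₁₃, h.b₂₃, h.a₁₂, h.a₁₃, h.a₂₃,
    h.cb₂.symm, h.ac₂.symm, h.cb₃.symm, h.ac₃.symm⟩

lemma swap₂₃ (h : G.EP'Config K a₁ b₁ a₂ a₃ b₂ b₃ c₂ c₃) :
    G.EP'Config K a₁ b₁ a₃ a₂ b₃ b₂ c₃ c₂ := by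
  have hp : [a₃, a₂, b₃, b₂, c₃, c₂].Perm [a₂, a₃, b₂, b₃, c₂, c₃] := by
    refine List.perm_iff_count.2 fun v => ?_
    simp only [List.count_cons, List.count_nil]
    omega
  exact ⟨h.toIsBigClique, h.a₁_mem, h.b₁_mem, h.a₁_ne_b₁, hp.nodup_iff.2 h.nodup,
    fun v hv => h.notMem v (hp.mem_iff.1 hv), h.a₁₃, h.a₁₂, h.a₂₃.symm, h.b₁₃, h.b₁₂, h.b₂₃.symm,
    h.ac₃, h.cb₃, h.ac₂, h.cb₂⟩

/-- There is no path through the vertices outside `K` whose ends have distinct neighbours in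
`K`. -/
lemma false_of_path (h : G.EP'Config K a₁ b₁ a₂ a₃ b₂ b₃ c₂ c₃) {l : List V} {u v a b : V}
    (p : G.PathList u v l) (hp : l.Perm [a₂, a₃, b₂, b₃, c₂, c₃]) (ha : a ∈ K) (hb : b ∈ K)
    (hab : a ≠ b) (hau : G.Adj a u) (hbv : G.Adj b v) : False :=
  h.false_of_perm (M := []) (by simp) (by simp) h.nodup h.notMem le_rfl p (by simpa) ha hb hab
    (by simp) (by simp) hau hbv

lemma not_adj_a₂_b₃ (h : G.EP'Config K a₁ b₁ a₂ a₃ b₂ b₃ c₂ c₃) : ¬ G.Adj a₂ b₃ := by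
  intro hab
  refine h.false_of_path (l := [a₃, c₃, b₃, a₂, c₂, b₂]) (.cons h.ac₃ (.cons h.cb₃ (.cons hab.symm
    (.cons h.ac₂ (.cons h.cb₂ (.single _)))))) ?_ h.a₁_mem h.b₁_mem h.a₁_ne_b₁ h.a₁₃ h.b₁₂
  refine List.perm_iff_count.2 fun v => ?_
  simp only [List.count_cons, List.count_nil]
  omega

lemma not_adj_a₂_c₃ (h : G.EP'Config K a₁ b₁ a₂ a₃ b₂ b₃ c₂ c₃) : ¬ G.Adj a₂ c₃ := by
  intro hac
  refine h.false_of_path (l := [a₃, c₃, a₂, c₂, b₂, b₃]) (.cons h.ac₃ (.cons hac.symm (.cons h.ac₂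
    (.cons h.cb₂ (.cons h.b₂₃ (.single _)))))) ?_ h.a₁_mem h.b₁_mem h.a₁_ne_b₁ h.a₁₃ h.b₁₃
  refine List.perm_iff_count.2 fun v => ?_
  simp only [List.count_cons, List.count_nil]
  omega

lemma not_adj_c₂_c₃ (h : G.EP'Config K a₁ b₁ a₂ a₃ b₂ b₃ c₂ c₃) : ¬ G.Adj c₂ c₃ := by
  intro hcc
  refine h.false_of_path (l := [a₃, a₂, c₂, c₃, b₃, b₂]) (.cons h.a₂₃.symm (.cons h.ac₂ (.cons hcc
    (.cons h.cb₃ (.cons h.b₂₃.symm (.single _)))))) ?_ h.a₁_mem h.b₁_mem h.a₁_ne_b₁ h.a₁₃ h.b₁₂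
  refine List.perm_iff_count.2 fun v => ?_
  simp only [List.count_cons, List.count_nil]
  omega

lemma not_adj_c₂ (h : G.EP'Config K a₁ b₁ a₂ a₃ b₂ b₃ c₂ c₃) {a : V} (ha : a ∈ K) :
    ¬ G.Adj a c₂ := by
  intro hac
  by_cases haa : a₁ = a
  · subst haa
    refine h.false_of_path (l := [b₂, b₃, c₃, a₃, a₂, c₂]) (.cons h.b₂₃ (.cons h.cb₃.symm (.cons
      h.ac₃.symm (.cons h.a₂₃.symm (.cons h.ac₂ (.single _)))))) ?_ h.b₁_mem ha h.a₁_ne_b₁.symm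
      h.b₁₂ hac
    refine List.perm_iff_count.2 fun v => ?_
    simp only [List.count_cons, List.count_nil]
    omega
  · refine h.false_of_path (l := [a₂, a₃, c₃, b₃, b₂, c₂]) (.cons h.a₂₃ (.cons h.ac₃ (.cons h.cb₃
      (.cons h.b₂₃.symm (.cons h.cb₂.symm (.single _)))))) ?_ h.a₁_mem ha haa h.a₁₂ hac
    refine List.perm_iff_count.2 fun v => ?_
    simp only [List.count_cons, List.count_nil]
    omega

lemma eq_of_adj_a₂ (h : G.EP'Config K a₁ b₁ a₂ a₃ b₂ b₃ c₂ c₃) {a : V} (ha : a ∈ K)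
    (haa : G.Adj a a₂) : a = a₁ :=
  h.unique (h.notMem a₂ (by simp)) ha h.a₁_mem haa.symm h.a₁₂.symm

lemma exists_equiv_EP'graph (h : G.EP'Config K a₁ b₁ a₂ a₃ b₂ b₃ c₂ c₃) {n : ℕ} (hn : 12 ≤ n)
    (hV : Fintype.card V = n) :
    ∃ f : V ≃ Fin n, ∀ u v, G.Adj u v → (EP'graph n).Adj (f u) (f v) := by
  obtain ⟨m, rfl⟩ := Nat.exists_eq_add_of_le' (show 6 ≤ n by omega)
  obtain ⟨f, hK, hF, hL⟩ := h.exists_equiv hV (F := [a₁, b₁])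
    (by simp [h.a₁_mem, h.b₁_mem]) (by simp [h.a₁_ne_b₁]) h.nodup h.notMem rfl
  have fa₁ : (f a₁).val = 0 := hF 0 (by simp)
  have fb₁ : (f b₁).val = 1 := hF 1 (by simp)
  have fa₂ : (f a₂).val = m := hL 0 (by simp)
  have fa₃ : (f a₃).val = m + 1 := hL 1 (by simp)
  have fb₂ : (f b₂).val = m + 2 := hL 2 (by simp)
  have fb₃ : (f b₃).val = m + 3 := hL 3 (by simp)
  have fc₂ : (f c₂).val = m + 4 := hL 4 (by simp)
  have fc₃ : (f c₃).val = m + 5 := hL 5 (by simp)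
  have ab₂₃ := h.not_adj_a₂_b₃
  have ab₃₂ := h.swap₂₃.not_adj_a₂_b₃
  have ac₂₃ := h.not_adj_a₂_c₃
  have ac₃₂ := h.swap₂₃.not_adj_a₂_c₃
  have bc₂₃ := h.swap_ab.not_adj_a₂_c₃
  have bc₃₂ := h.swap_ab.swap₂₃.not_adj_a₂_c₃
  have cc₂₃ := h.not_adj_c₂_c₃
  have mem : ∀ v, v ∈ K ∨ v = a₂ ∨ v = a₃ ∨ v = b₂ ∨ v = b₃ ∨ v = c₂ ∨ v = c₃ := fun v => by
    simpa using h.mem_or_mem h.nodup h.notMem le_rfl v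
  have key : ∀ u v, u ∈ K → G.Adj u v → (EP'graph (m + 6)).Adj (f u) (f v) := by
    intro u v hu huv
    rw [EP'graph, fromRel_adj]
    refine ⟨f.injective.ne huv.ne, .inl ?_⟩
    rcases mem v with hv | rfl | rfl | rfl | rfl | rfl | rfl
    · exact .inl ⟨hK u hu, hK v hv⟩
    · obtain rfl := h.eq_of_adj_a₂ hu huv
      simp [fa₁, fa₂]
    · obtain rfl := h.swap₂₃.eq_of_adj_a₂ hu huv
      simp [fa₁, fa₃]
    · obtain rfl := h.swap_ab.eq_of_adj_a₂ hu huv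
      simp [fb₁, fb₂]
    · obtain rfl := h.swap_ab.swap₂₃.eq_of_adj_a₂ hu huv
      simp [fb₁, fb₃]
    · exact absurd huv (h.not_adj_c₂ hu)
    · exact absurd huv (h.swap₂₃.not_adj_c₂ hu)
  refine ⟨f, fun u v huv => ?_⟩
  rcases mem u with hu | hu
  · exact key u v hu huv
  rcases mem v with hv | hv
  · exact (key v u hv huv.symm).symm
  rw [EP'graph, fromRel_adj]
  refine ⟨f.injective.ne huv.ne, ?_⟩
  rcases hu with rfl | rfl | rfl | rfl | rfl | rfl <;>
    rcases hv with rfl | rfl | rfl | rfl | rfl | rfl <;>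
    first
    | exact absurd huv ‹_›
    | exact absurd huv.symm ‹_›
    | exact absurd rfl huv.ne
    | simp [fa₂, fa₃, fb₂, fb₃, fc₂, fc₃]

end EP'Config

end SimpleGraph

namespace SimpleGraph

variable {V : Type*} {G : SimpleGraph V}

lemma _root_.TwoConnected.mono [Fintype V] {G' : SimpleGraph V} (h : TwoConnected G)
    (hle : G ≤ G') : TwoConnected G' :=
  ⟨h.1, fun v => (h.2 v).mono fun _ _ huv => hle huv⟩

lemma exists_iso_le {W : Type*} {H : SimpleGraph W} (f : V ≃ W)
    (hf : ∀ u v, G.Adj u v → H.Adj (f u) (f v)) :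
    ∃ H' : SimpleGraph W, H' ≤ H ∧ Nonempty (G ≃g H') :=
  ⟨G.map f.toEmbedding, (map_le_iff_le_comap _ _ _).2 fun u v huv => hf u v huv, ⟨Iso.map f G⟩⟩

variable [Fintype V] [DecidableEq V]

lemma DiamondFree.exists_isBigClique [DecidableRel G.Adj] (hD : G.DiamondFree) (hG : ClawFree G)
    {n : ℕ} (hn : 12 ≤ n) (hV : Fintype.card V = n)
    (hE : n * n + 114 ≤ ∑ v, G.degree v + 15 * n) (hH : ¬ G.IsHamiltonian) :
    ∃ K : Finset V, G.IsBigClique K := by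
  obtain ⟨K₀, hK₀, hcard⟩ := hD.exists_isClique hG hn hV hE
  obtain ⟨K, hK⟩ := G.maximumClique_exists
  have hle := hK.maximum K₀ hK₀
  refine ⟨K, hG, hK.isClique, by omega, by omega, fun w a b hw ha hb hwa hwb => ?_, hH⟩
  by_contra hab
  have hcl : G.IsClique (insert w K : Finset V) := by
    rw [Finset.coe_insert]
    refine hK.isClique.insert fun v hv _ => ?_
    rcases eq_or_ne v a with rfl | hva
    · exact hwa
    rcases eq_or_ne v b with rfl | hvb
    · exact hwb
    exact hD (hK.isClique ha hb hab) hwa.symm (hK.isClique ha hv hva.symm) hwb.symm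
      (hK.isClique hb hv hvb.symm) (ne_of_mem_of_not_mem hv hw).symm
  have := hK.maximum _ hcl
  rw [Finset.card_insert_of_notMem hw] at this
  omega

/-- A dense 2-connected claw-free graph is Hamiltonian, or embeds into `EPgraph n` or
`EP'graph n` as a spanning subgraph. -/
lemma isHamiltonian_or_exists_equiv {n : ℕ} (hn : 12 ≤ n) (hV : Fintype.card V = n)
    (G : SimpleGraph V) [inst : DecidableRel G.Adj] (h2 : TwoConnected G) (hG : ClawFree G)
    (hE : n * n + 114 ≤ ∑ v, G.degree v + 15 * n) :
    G.IsHamiltonian ∨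
      (∃ f : V ≃ Fin n, ∀ u v, G.Adj u v → (EPgraph n).Adj (f u) (f v)) ∨
      ∃ f : V ≃ Fin n, ∀ u v, G.Adj u v → (EP'graph n).Adj (f u) (f v) := by
  classical
  induction G using WellFoundedGT.induction generalizing inst with
  | ind G ih =>
  by_cases hD : G.DiamondFree
  · by_contra! hno
    obtain ⟨K, hK⟩ := hD.exists_isBigClique hG hn hV hE hno.1
    obtain ⟨c, d, A, B, Q, p, q, r, s, z, z', hear⟩ := hK.exists_ear h2
    obtain ⟨a₁, a₂, a₃, b₁, b₂, b₃, c₁, c₂, c₃, h⟩ | ⟨a₁, b₁, a₂, a₃, b₂, b₃, c₂, c₃, h⟩ :=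
      hear.exists_config
    · obtain ⟨f, hf⟩ := h.exists_equiv_EPgraph hn hV
      obtain ⟨u, v, huv, hfuv⟩ := hno.2.1 f
      exact hfuv (hf u v huv)
    · obtain ⟨f, hf⟩ := h.exists_equiv_EP'graph hn hV
      obtain ⟨u, v, huv, hfuv⟩ := hno.2.2 f
      exact hfuv (hf u v huv)
  · unfold DiamondFree at hD
    push Not at hD
    obtain ⟨x, y, u, v, hxy, hxu, hxv, hyu, hyv, huv, hnuv⟩ := hD
    have hle := G.le_localCompletion x
    have hlt : G < G.localCompletion x :=
      lt_of_le_of_ne hle fun h => hnuv (by rw [h]; exact .inr ⟨huv, hxu, hxv⟩)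
    have hE' : n * n + 114 ≤ ∑ v, (G.localCompletion x).degree v + 15 * n :=
      hE.trans (Nat.add_le_add_right (Finset.sum_le_sum fun w _ => degree_le_of_le hle) _)
    obtain h | ⟨f, hf⟩ | ⟨f, hf⟩ := ih _ hlt (h2.mono hle) (clawFree_localCompletion hG x) hE'
    · exact .inl (isHamiltonian_of_localCompletion hG h2.1 hxu hxv hxy hyu.symm hyv huv hnuv h)
    · exact .inr (.inl ⟨f, fun u v h => hf u v (hle h)⟩)
    · exact .inr (.inr ⟨f, fun u v h => hf u v (hle h)⟩)

end SimpleGraph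

theorem statement_9 {V : Type*} [Fintype V] [DecidableEq V] (G : SimpleGraph V)
    [DecidableRel G.Adj] (n : ℕ) (hn : 12 ≤ n) (hcard : Fintype.card V = n)
    (h2conn : TwoConnected G) (hclaw : ClawFree G)
    (he : (G.edgeFinset.card : ℝ) ≥ (n : ℝ) * ((n : ℝ) - 15) / 2 + 57) :
    G.IsHamiltonian ∨
      (∃ H : SimpleGraph (Fin n), H ≤ EPgraph n ∧ Nonempty (G ≃g H)) ∨
      (∃ H : SimpleGraph (Fin n), H ≤ EP'graph n ∧ Nonempty (G ≃g H)) := by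
  have hE : n * n + 114 ≤ ∑ v, G.degree v + 15 * n := by
    rw [sum_degrees_eq_twice_card_edges]
    have : (n * n + 114 : ℝ) ≤ 2 * G.edgeFinset.card + 15 * n := by linarith
    exact_mod_cast this
  obtain h | ⟨f, hf⟩ | ⟨f, hf⟩ := isHamiltonian_or_exists_equiv hn hcard G h2conn hclaw hE
  · exact .inl h
  · exact .inr (.inl (exists_iso_le f hf))
  · exact .inr (.inr (exists_iso_le f hf))
end
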